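/- Let χ: ℝ → ℝ be a fixed smooth function with χ(t) = 1 for t ≤ 4/3 and χ(t) = 0 for t ≥ 5/3, let ρ ≥ 1, and consider the trace-free symmetric two-tensor h_{ik}(x) = χ(|x|/ρ) Σ_{2 ≤ |α| ≤ d} h_{ik,α} x^α on ℝ^n_+, where d = ⌊(n−2)/2⌋ and the coefficient matrices (h_{ik,α})_{i,k} are symmetric and trace-free. Let V be a smooth vector field on ℝ^n_+ such that: (a) Σ_{k=1}^n ∂_k [ u^{2n/(n−2)} ( h_{ik} − ∂_i V_k − ∂_k V_i + (2/n)(div V) δ_{ik} ) ] = 0 on ℝ^n_+ for all i; (b) V_n(x) = 0 and ∂_n V_i(x) = h_{in}(x) for all x ∈ ∂ℝ^n_+ and i ∈ {1,…,n−1}; (c) ∫_{ℝ^n_+} u^{2(n+2)/(n−2)} |V|² dx ≤ K ∫_{ℝ^n_+} u^{2n/(n−2)} |h|² dx and ∫_{ℝ^n_+} (1+|x|²)^{−n} |∂V|² dx < ∞; (d) for every integer d' with 2 ≤ d' ≤ d, sup_{r ≥ 1} r^{−2d'−n−2} ∫_{(B_{2r}(0) \ B_r(0)) ∩ ℝ^n_+}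 |V|² dx < ∞. Then for every multi-index β there is a constant C, depending only on n, |β|, χ, and K (but not on ρ), such that |∂^β V(x)|² ≤ C Σ_{2 ≤ |α| ≤ d} Σ_{i,k=1}^n |h_{ik,α}|² (1 + |x|²)^{|α|+1−|β|} for all x ∈ ℝ^n_+. -/

import Mathlib

noncomputable section

open MeasureTheory Metric

/-- Euclidean space `ℝ^n`. -/
abbrev Euc (n : ℕ) := EuclideanSpace ℝ (Fin n)

/-- Partial derivative in the `i`-th coordinate direction. -/
def pd {n : ℕ} (i : Fin n) (f : Euc n → ℝ) : Euc n → ℝ :=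
  fun x => fderiv ℝ f x (EuclideanSpace.single i 1)

/-- Kronecker delta. -/
def kd {n : ℕ} (i k : Fin n) : ℝ := if i = k then 1 else 0

/-- The finite set of multi-indices `α` with `2 ≤ |α| ≤ d`. -/
def MIdx (n d : ℕ) : Finset (Fin n → ℕ) :=
  (Fintype.piFinset fun _ : Fin n => Finset.range (d + 1)).filter
    fun α => 2 ≤ ∑ i, α i ∧ ∑ i, α i ≤ d

/-- `u(x) = (1/(1+|x|²))^{(n-2)/2}`. -/
def u0 (n : ℕ) : Euc n → ℝ :=
  fun x => (1 / (1 + ‖x‖ ^ 2)) ^ (((n : ℝ) - 2) / 2)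

/-- Iterated partial derivative along a list of coordinate directions. -/
def pdIter {n : ℕ} : List (Fin n) → (Euc n → ℝ) → (Euc n → ℝ)
  | [], f => f
  | i :: t, f => pd i (pdIter t f)

section
variable {n : ℕ}

def SA (n : ℕ) : Subalgebra ℝ (Euc n → ℝ) where
  carrier := {f | ContDiff ℝ (⊤ : ℕ∞) f}
  mul_mem' := by
    intro a b ha hb
    have h1 : ContDiff ℝ (⊤ : ℕ∞) a := ha
    have h2 : ContDiff ℝ (⊤ : ℕ∞) b := hb
    exact h1.mul h2
  add_mem' := by
    intro a b ha hb
    have h1 : ContDiff ℝ (⊤ : ℕ∞) a := ha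
    have h2 : ContDiff ℝ (⊤ : ℕ∞) b := hb
    exact h1.add h2
  algebraMap_mem' := by
    intro r
    have h1 : ContDiff ℝ (⊤ : ℕ∞) (fun _ : Euc n => r) := contDiff_const
    exact h1
lemma SA.sm (f : SA n) : ContDiff ℝ (⊤ : ℕ∞) (f : Euc n → ℝ) := f.2
lemma SA.cont (f : SA n) : Continuous (f : Euc n → ℝ) := (SA.sm f).continuous
lemma SA.diff (f : SA n) : Differentiable ℝ (f : Euc n → ℝ) :=
  (SA.sm f).differentiable (by simp)
lemma pd_sm (i : Fin n) {f : Euc n → ℝ} (hf : ContDiff ℝ (⊤ : ℕ∞) f) :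
    ContDiff ℝ (⊤ : ℕ∞) (pd i f) := by
  unfold pd
  exact (hf.fderiv_right (m := (⊤ : ℕ∞)) (by simp)).clm_apply contDiff_const
def D (i : Fin n) : Derivation ℝ (SA n) (SA n) :=
  Derivation.mk'
    { toFun := fun f => ⟨pd i f, pd_sm i f.2⟩
      map_add' := by
        intro f g
        apply Subtype.ext; funext x
        show pd i ((f : Euc n → ℝ) + g) x = pd i f x + pd i g x
        simp only [pd]
        rw [fderiv_add (SA.diff f x) (SA.diff g x)]; rfl
      map_smul' := by
        intro c f
        apply Subtype.ext; funext x
        show pd i (c • (f : Euc n → ℝ)) x = c * pd i f x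
        simp only [pd]
        rw [fderiv_const_smul (SA.diff f x)]; rfl }
    (by
      intro f g
      apply Subtype.ext; funext x
      show pd i ((f : Euc n → ℝ) * g) x = (f : Euc n → ℝ) x * pd i g x + (g : Euc n → ℝ) x * pd i f x
      simp only [pd]
      rw [fderiv_mul (SA.diff f x) (SA.diff g x)]; rfl)
def ev (x : Euc n) : SA n →ₐ[ℝ] ℝ := (Pi.evalAlgHom ℝ _ x).comp (SA n).val
lemma ev_def (x : Euc n) (f : SA n) : ev x f = (f : Euc n → ℝ) x := rfl
lemma ev_D (x : Euc n) (i : Fin n) (f : SA n) :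
    ev x (D i f) = fderiv ℝ (f : Euc n → ℝ) x (EuclideanSpace.single i 1) := rfl
lemma D_coe (i : Fin n) (f : SA n) : ((D i f : SA n) : Euc n → ℝ) = pd i f := rfl
lemma SA.ext' {f g : SA n} (h : ∀ x, ev x f = ev x g) : f = g :=
  Subtype.ext (funext h)
lemma D_mul (i : Fin n) (f g : SA n) : D i (f * g) = D i f * g + f * D i g := by
  rw [Derivation.leibniz]; simp only [smul_eq_mul]; ring
lemma D_pow (i : Fin n) (f : SA n) (k : ℕ) :
    D i (f ^ (k+1)) = ((k : ℝ) + 1) • (f ^ k * D i f) := by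
  rw [Derivation.leibniz_pow]
  simp only [smul_eq_mul, Nat.add_sub_cancel]
  rw [← Nat.cast_smul_eq_nsmul ℝ]; push_cast; rfl
lemma D_comm (i k : Fin n) (f : SA n) : D i (D k f) = D k (D i f) := by
  apply SA.ext'; intro x
  have hs : IsSymmSndFDerivAt ℝ (f : Euc n → ℝ) x := by
    apply ContDiffAt.isSymmSndFDerivAt (n := (⊤ : ℕ∞)) (SA.sm f).contDiffAt
    simp only [minSmoothness_of_isRCLikeNormedField]
    exact WithTop.coe_le_coe.2 le_top
  have key : ∀ a b : Fin n, ev x (D a (D b f)) =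
      fderiv ℝ (fderiv ℝ (f : Euc n → ℝ)) x (EuclideanSpace.single a 1) (EuclideanSpace.single b 1) := by
    intro a b
    rw [ev_D, D_coe]
    unfold pd
    have hd : DifferentiableAt ℝ (fderiv ℝ (f : Euc n → ℝ)) x :=
      (((SA.sm f).fderiv_right (m := (⊤ : ℕ∞)) (by simp)).differentiable (by simp)) x
    rw [fderiv_clm_apply hd (by fun_prop)]
    simp
  rw [key, key]
  exact hs _ _
def X (i : Fin n) : SA n :=
  ⟨fun x => x i, show ContDiff ℝ (⊤ : ℕ∞) _ from (EuclideanSpace.proj (𝕜 := ℝ) i).contDiff⟩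
lemma ev_X (x : Euc n) (i : Fin n) : ev x (X i) = x i := rfl
lemma D_X (i k : Fin n) : D i (X k) = if i = k then 1 else 0 := by
  apply SA.ext'; intro x
  rw [ev_D]
  have : fderiv ℝ ((X k : SA n) : Euc n → ℝ) x = (EuclideanSpace.proj (𝕜 := ℝ) k) :=
    (EuclideanSpace.proj (𝕜 := ℝ) k).hasFDerivAt.fderiv
  rw [this]
  by_cases h : i = k
  · subst h; simp
  · simp [h, Ne.symm h, eq_comm]
def sqf (n : ℕ) : SA n := 1 + ∑ i, X i * X i
lemma ev_sq (x : Euc n) : ev x (sqf n) = 1 + ∑ i, x i * x i := by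
  simp [sqf, map_add, map_sum, ev_X]
lemma ev_sq' (x : Euc n) : ev x (sqf n) = 1 + ‖x‖^2 := by
  rw [ev_sq, EuclideanSpace.norm_sq_eq]; simp [pow_two]
lemma ev_sq_pos (x : Euc n) : 1 ≤ ev x (sqf n) := by
  rw [ev_sq']; nlinarith [sq_nonneg ‖x‖]
lemma D_sq (i : Fin n) : D i (sqf n) = 2 * X i := by
  unfold sqf
  rw [map_add, map_sum]
  simp only [D_mul, D_X]
  rw [Derivation.map_one_eq_zero]
  simp [Finset.sum_add_distrib]; ring
def inv' (f : SA n) (hf : ∀ x, ev x f ≠ 0) : SA n :=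
  ⟨fun x => (ev x f)⁻¹, show ContDiff ℝ (⊤ : ℕ∞) _ from ContDiff.inv (SA.sm f) hf⟩
def w (n : ℕ) : SA n := inv' (sqf n) (fun x => by have := ev_sq_pos x; positivity)
local notation "eW" a:max => ev a (w _)
local notation "eS" a:max => ev a (sqf _)
local notation "mnL" => mul_le_mul_of_nonneg_left
local notation "mnR" => mul_le_mul_of_nonneg_right
lemma ev_w (x : Euc n) : eW x = (eS x)⁻¹ := rfl
lemma w_sq (n : ℕ) : w n * sqf n = 1 := by
  apply SA.ext'; intro x
  rw [map_mul, ev_w, map_one]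
  have := ev_sq_pos x
  field_simp
lemma ev_w_pos (x : Euc n) : 0 < eW x := by
  rw [ev_w]; have := ev_sq_pos x; positivity
lemma ev_w_le (x : Euc n) : eW x ≤ 1 := by
  rw [ev_w]; have := ev_sq_pos x; exact inv_le_one_of_one_le₀ this
lemma ev_w_mul (x : Euc n) : eW x * (1 + ∑ i, x i * x i) = 1 := by
  rw [← ev_sq, ← map_mul, w_sq, map_one]
lemma D_w (i : Fin n) : D i (w n) = - (2 * X i * w n * w n) := by
  have h : D i (w n * sqf n) = 0 := by rw [w_sq]; exact Derivation.map_one_eq_zero _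
  rw [D_mul, D_sq] at h
  have h1 : w n * sqf n = 1 := w_sq n
  have : D i (w n) * (w n * sqf n) = - (2 * X i * w n * w n) := by
    linear_combination (w n) * h
  rwa [h1, mul_one] at this
lemma D_w_pow (i : Fin n) (k : ℕ) :
    D i (w n ^ k) = - ((2 * (k:ℝ)) • (X i * w n * w n ^ k)) := by
  cases k with
  | zero => simp
  | succ k =>
    rw [D_pow, D_w]
    simp only [Algebra.smul_def]
    push_cast
    simp only [map_mul, map_add, map_one, map_ofNat, map_natCast]
    ring
def DL : List (Fin n) → SA n → SA n
  | [], f => f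
  | i :: t, f => D i (DL t f)
lemma DL_coe (L : List (Fin n)) (f : SA n) : ((DL L f : SA n) : Euc n → ℝ) = pdIter L f := by
  induction L with
  | nil => rfl
  | cons i t ih => simp only [DL, pdIter, D_coe, ih]
lemma DL_D (L : List (Fin n)) (i : Fin n) (f : SA n) : DL L (D i f) = D i (DL L f) := by
  induction L with
  | nil => rfl
  | cons k t ih => simp only [DL, ih]; rw [D_comm]
lemma DL_add (L : List (Fin n)) (f g : SA n) : DL L (f + g) = DL L f + DL L g := by
  induction L with
  | nil => rfl
  | cons k t ih => simp only [DL, ih, map_add]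
lemma DL_smul (L : List (Fin n)) (c : ℝ) (f : SA n) : DL L (c • f) = c • DL L f := by
  induction L with
  | nil => rfl
  | cons k t ih => simp only [DL, ih, Derivation.map_smul]
def DLl (L : List (Fin n)) : SA n →ₗ[ℝ] SA n where
  toFun := DL L
  map_add' := DL_add L
  map_smul' := DL_smul L
lemma DL_sub (L : List (Fin n)) (f g : SA n) : DL L (f - g) = DL L f - DL L g :=
  map_sub (DLl L) f g
lemma DL_sum {ι : Type*} (L : List (Fin n)) (s : Finset ι) (f : ι → SA n) :
    DL L (∑ i ∈ s, f i) = ∑ i ∈ s, DL L (f i) := map_sum (DLl L) f s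
lemma DL_perm {L L' : List (Fin n)} (h : L.Perm L') (f : SA n) : DL L f = DL L' f := by
  induction h with
  | nil => rfl
  | cons a _ ih => simp only [DL, ih]
  | swap a b l => simp only [DL]; exact D_comm _ _ _
  | trans _ _ h1 h2 => rw [h1, h2]
section
def HS (l : Fin n) : Set (Euc n) := {x | 0 ≤ x l}
lemma ev_cont (f : SA n) : Continuous (fun x => ev x f) := SA.cont f
lemma HS_closed (l : Fin n) : IsClosed (HS l) :=
  isClosed_le continuous_const (ev_cont (X l))
lemma HS_meas (l : Fin n) : MeasurableSet (HS l) := (HS_closed l).measurableSet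
lemma intble_of_supp {f : Euc n → ℝ} (hf : Continuous f) (R : ℝ)
    (h : ∀ x, R ≤ ‖x‖ → f x = 0) : Integrable f := by
  apply hf.integrable_of_hasCompactSupport
  apply HasCompactSupport.intro (isCompact_closedBall (0 : Euc n) R)
  intro x hx
  apply h
  simp at hx; exact hx.le
lemma D_supp {f : SA n} {R : ℝ} (h : ∀ x, R ≤ ‖x‖ → ev x f = 0) (i : Fin n) :
    ∀ x, R ≤ ‖x‖ → ev x (D i f) = 0 := by
  have h1 : ∀ x, R < ‖x‖ → ev x (D i f) = 0 := by
    intro x hx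
    rw [ev_D]
    have : (f : Euc n → ℝ) =ᶠ[nhds x] (fun _ => 0) := by
      have : ∀ᶠ y in nhds x, R < ‖y‖ := continuous_norm.continuousAt.eventually (lt_mem_nhds hx)
      filter_upwards [this] with y hy
      exact h y hy.le
    rw [this.fderiv_eq]; simp
  intro x hx
  rcases hx.lt_or_eq with hx | hx
  · exact h1 x hx
  by_cases h0 : x = 0
  ·
    subst h0
    simp at hx; subst hx
    rw [ev_D]
    have : (f : Euc n → ℝ) = (fun _ => 0) := by funext y; exact h y (norm_nonneg y)
    rw [this]; simp
  · have hlim : Filter.Tendsto (fun t : ℝ => ev (t • x) (D i f)) (nhdsWithin 1 (Set.Ioi 1)) (nhds (ev x (D i f))) := by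
      have : Continuous (fun t : ℝ => ev (t • x) (D i f)) := (ev_cont _).comp (by fun_prop)
      have h2 := this.tendsto 1
      simp only [one_smul] at h2
      exact h2.mono_left nhdsWithin_le_nhds
    have h3 : Filter.Tendsto (fun t : ℝ => ev (t • x) (D i f)) (nhdsWithin 1 (Set.Ioi 1)) (nhds 0) := by
      apply Filter.Tendsto.congr' _ tendsto_const_nhds
      filter_upwards [self_mem_nhdsWithin] with t ht
      symm; apply h1
      rw [norm_smul, hx]
      have ht' : (1:ℝ) < t := ht
      rw [Real.norm_of_nonneg (by linarith)]
      have : 0 < ‖x‖ := norm_pos_iff.2 h0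
      nlinarith
    exact tendsto_nhds_unique hlim h3
lemma abs_coord_le (x : Euc n) (i : Fin n) : |x i| ≤ ‖x‖ := by
  have := PiLp.norm_apply_le x i
  simpa using this
lemma int_div_zero (l0 : Fin n) (Y : Fin n → SA n) (R : ℝ)
    (hs : ∀ i x, R ≤ ‖x‖ → ev x (Y i) = 0) (hb : ∀ x, x l0 = 0 → ev x (Y l0) = 0) :
    ∫ x in HS l0, ∑ i, ev x (D i (Y i)) = 0 := by
  obtain ⟨m, rfl⟩ : ∃ m, n = m + 1 := ⟨n - 1, by have := l0.2; omega⟩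
  wlog hR : 0 < R generalizing R with H
  · exact H (max R 1) (fun i x hx => hs i x (le_trans (le_max_left _ _) hx)) (by positivity)
  let a : Fin (m+1) → ℝ := fun i => if i = l0 then 0 else -R
  let b : Fin (m+1) → ℝ := fun _ => R
  have hle : a ≤ b := by
    intro i; simp only [a, b]; split_ifs <;> linarith
  let e : (Fin (m+1) → ℝ) → Euc (m+1) := WithLp.toLp 2
  have hec : Continuous e := by simpa [e] using PiLp.continuous_toLp 2 (fun _ : Fin (m+1) => ℝ)
  let eL : (Fin (m+1) → ℝ) →L[ℝ] Euc (m+1) :=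
    ((PiLp.continuousLinearEquiv 2 ℝ (fun _ : Fin (m+1) => ℝ)).symm : _ →L[ℝ] _)
  have hL : ∀ x, eL x = e x := fun x => rfl
  have hdiv := integral_divergence_of_hasFDerivAt_off_countable' a b hle
    (fun i x => ev (e x) (Y i))
    (fun i x => (fderiv ℝ (Y i : Euc (m+1) → ℝ) (e x)).comp eL) ∅ Set.countable_empty
    (fun i => ((ev_cont (Y i)).comp hec).continuousOn)
    (by
      intro x _ i
      have h1 : HasFDerivAt (Y i : Euc (m+1) → ℝ) (fderiv ℝ (Y i : Euc (m+1) → ℝ) (eL x)) (eL x) :=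
        (SA.diff (Y i) _).hasFDerivAt
      exact h1.comp x eL.hasFDerivAt)
    (by
      apply ContinuousOn.integrableOn_compact isCompact_Icc
      apply Continuous.continuousOn
      apply continuous_finset_sum
      intro i _
      have : Continuous (fun x => ev (e x) (D i (Y i))) := (ev_cont _).comp hec
      exact this)
  have hpt : ∀ x : Fin (m+1) → ℝ, ∑ i, ((fderiv ℝ (Y i : Euc (m+1) → ℝ) (e x)).comp eL) (Pi.single i 1)
      = ∑ i, ev (e x) (D i (Y i)) := by
    intro x; rfl
  simp only [hpt] at hdiv
  rw [Finset.sum_eq_zero] at hdiv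
  · rw [← integral_indicator (HS_meas l0)]
    rw [← (PiLp.volume_preserving_toLp (Fin (m+1))).integral_comp
      (MeasurableEquiv.toLp 2 (Fin (m+1) → ℝ)).measurableEmbedding]
    rw [← hdiv, ← integral_indicator measurableSet_Icc]
    congr 1; funext x
    by_cases h1 : x ∈ Set.Icc a b
    · rw [Set.indicator_of_mem h1, Set.indicator_of_mem]
      have := h1.1 l0
      simp [a] at this
      exact this
    · rw [Set.indicator_of_notMem h1]
      by_cases h2 : WithLp.toLp 2 x ∈ HS l0
      · rw [Set.indicator_of_mem h2]
        apply Finset.sum_eq_zero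
        intro i _
        apply D_supp (hs i)
        by_contra h3
        push Not at h3
        apply h1
        have h4 : ∀ j, |x j| < R := fun j => lt_of_le_of_lt (abs_coord_le (WithLp.toLp 2 x) j) h3
        constructor
        · intro j; simp only [a]; split_ifs with hj
          · subst hj; exact h2
          · exact (abs_lt.1 (h4 j)).1.le
        · intro j; exact (abs_lt.1 (h4 j)).2.le
      · rw [Set.indicator_of_notMem h2]
  · intro i _
    have f1 : ∀ x : Fin m → ℝ, ev (e (i.insertNth (b i) x)) (Y i) = 0 := by
      intro x
      apply hs
      refine le_trans ?_ (abs_coord_le _ i)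
      have : (e (i.insertNth (b i) x)) i = b i := by simp [e]
      rw [this]; exact le_abs_self R
    have f2 : ∀ x : Fin m → ℝ, ev (e (i.insertNth (a i) x)) (Y i) = 0 := by
      intro x
      have : (e (i.insertNth (a i) x)) i = a i := by simp [e]
      by_cases hi : i = l0
      · subst hi
        apply hb; rw [this]; simp [a]
      · apply hs
        refine le_trans ?_ (abs_coord_le _ i)
        rw [this]; simp [a, hi]; exact le_abs_self R
    simp only [f1, f2]; simp
lemma energy (l0 : Fin n) (Y : Fin n → SA n) (R : ℝ)
    (hs : ∀ i x, R ≤ ‖x‖ → ev x (Y i) = 0) (hb : ∀ x, x l0 = 0 → ev x (Y l0) = 0)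
    {f g : Euc n → ℝ} (hf : IntegrableOn f (HS l0)) (hg : IntegrableOn g (HS l0))
    (h : ∀ x ∈ HS l0, f x ≤ g x + ∑ i, ev x (D i (Y i))) :
    ∫ x in HS l0, f x ≤ ∫ x in HS l0, g x := by
  have hi : IntegrableOn (fun x => ∑ i, ev x (D i (Y i))) (HS l0) := by
    apply Integrable.integrableOn
    apply intble_of_supp _ R
    · intro x hx
      exact Finset.sum_eq_zero fun i _ => D_supp (hs i) i x hx
    · exact continuous_finset_sum _ fun i _ => ev_cont _
  have h0 := int_div_zero l0 Y R hs hb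
  calc ∫ x in HS l0, f x ≤ ∫ x in HS l0, (g x + ∑ i, ev x (D i (Y i))) :=
        setIntegral_mono_on hf (hg.add hi) (HS_meas l0) h
    _ = _ := by rw [integral_add hg hi, h0, add_zero]
end
section
open Finset
def dv (x : Euc n) (P : Fin n → SA n) : ℝ := ∑ i, ev x (D i (P i))
lemma ev_smul (x : Euc n) (c : ℝ) (f : SA n) : ev x (c • f) = c * ev x f := by
  rw [map_smul, smul_eq_mul]
lemma D_smul (i : Fin n) (c : ℝ) (f : SA n) : D i (c • f) = c • D i f :=
  Derivation.map_smul _ _ _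
lemma dv_mul (x : Euc n) (f : SA n) (P : Fin n → SA n) :
    dv x (fun i => f * P i) = ev x f * dv x P + ∑ i, ev x (D i f) * ev x (P i) := by
  unfold dv
  rw [mul_sum, ← sum_add_distrib]
  refine sum_congr rfl fun i _ => ?_
  rw [D_mul, map_add, map_mul, map_mul]; ring
lemma dv_add (x : Euc n) (P Q : Fin n → SA n) :
    dv x (fun i => P i + Q i) = dv x P + dv x Q := by
  unfold dv; rw [← sum_add_distrib]
  refine sum_congr rfl fun i _ => ?_
  rw [map_add, map_add]
lemma dv_sub (x : Euc n) (P Q : Fin n → SA n) :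
    dv x (fun i => P i - Q i) = dv x P - dv x Q := by
  unfold dv; rw [← sum_sub_distrib]
  refine sum_congr rfl fun i _ => ?_
  rw [map_sub, map_sub]
lemma dv_smul (x : Euc n) (c : ℝ) (P : Fin n → SA n) :
    dv x (fun i => c • P i) = c * dv x P := by
  unfold dv; rw [mul_sum]
  refine sum_congr rfl fun i _ => ?_
  rw [D_smul, ev_smul]
def T0 (V : Fin n → SA n) : SA n := ∑ i, D i (V i)
def xv (V : Fin n → SA n) : SA n := ∑ i, X i * V i
def V2 (V : Fin n → SA n) : SA n := ∑ i, V i * V i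
lemma ev_T0 (x : Euc n) (V : Fin n → SA n) : ev x (T0 V) = ∑ i, ev x (D i (V i)) := by
  simp [T0, map_sum]
lemma ev_xv (x : Euc n) (V : Fin n → SA n) : ev x (xv V) = ∑ i, x i * ev x (V i) := by
  simp [xv, map_sum, ev_X]
lemma ev_V2 (x : Euc n) (V : Fin n → SA n) : ev x (V2 V) = ∑ i, ev x (V i) * ev x (V i) := by
  simp [V2, map_sum]
lemma ev_D_T0 (x : Euc n) (V : Fin n → SA n) (i : Fin n) :
    ev x (D i (T0 V)) = ∑ k, ev x (D i (D k (V k))) := by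
  simp [T0, map_sum]
lemma ev_D_xv (x : Euc n) (V : Fin n → SA n) (i : Fin n) :
    ev x (D i (xv V)) = ev x (V i) + ∑ k, x k * ev x (D i (V k)) := by
  simp only [xv, map_sum, D_mul, D_X, map_add, map_mul, ev_X, sum_add_distrib]
  congr 1
  simp [apply_ite (ev x), ite_mul]
lemma ev_D_V2 (x : Euc n) (V : Fin n → SA n) (i : Fin n) :
    ev x (D i (V2 V)) = 2 * ∑ k, ev x (V k) * ev x (D i (V k)) := by
  simp only [V2, map_sum, D_mul, map_add, map_mul, mul_sum]
  refine sum_congr rfl fun i _ => ?_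
  ring
lemma dv_L1 (x : Euc n) (V : Fin n → SA n) :
    dv x (fun i => ∑ k, V k * D k (V i)) =
      (∑ i, ∑ k, ev x (D i (V k)) * ev x (D k (V i))) + ∑ k, ev x (V k) * ev x (D k (T0 V)) := by
  unfold dv
  simp only [map_sum, D_mul, map_add, map_mul, sum_add_distrib]
  congr 1
  rw [sum_comm]
  refine sum_congr rfl fun k _ => ?_
  rw [ev_D_T0, mul_sum]
  refine sum_congr rfl fun i _ => ?_
  rw [D_comm]
lemma dv_L2 (x : Euc n) (V : Fin n → SA n) :
    dv x (fun i => T0 V * V i) = ev x (T0 V) * ev x (T0 V) + ∑ k, ev x (V k) * ev x (D k (T0 V)) := by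
  rw [dv_mul]
  have : dv x (fun i => V i) = ev x (T0 V) := by rw [ev_T0]; rfl
  rw [this]; congr 1
  exact sum_congr rfl fun i _ => mul_comm _ _
lemma dv_V (x : Euc n) (V : Fin n → SA n) : dv x (fun i => V i) = ev x (T0 V) := by
  rw [ev_T0]; rfl
lemma dv_L3 (x : Euc n) (V : Fin n → SA n) :
    dv x (fun i => xv V * V i) = ev x (xv V) * ev x (T0 V) + ev x (V2 V)
      + ∑ i, ∑ k, x k * ev x (V i) * ev x (D i (V k)) := by
  rw [dv_mul, dv_V, add_assoc]; congr 1
  simp only [ev_D_xv, ev_V2, add_mul, sum_add_distrib, sum_mul]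
  congr 1
  refine sum_congr rfl fun i _ => sum_congr rfl fun k _ => ?_
  ring
lemma dv_X (x : Euc n) : dv x (fun i => X i) = n := by
  unfold dv; simp [D_X]
lemma dv_L4 (x : Euc n) (V : Fin n → SA n) :
    dv x (fun i => V2 V * X i) = n * ev x (V2 V)
      + 2 * ∑ i, ∑ k, x i * ev x (V k) * ev x (D i (V k)) := by
  rw [dv_mul, dv_X, mul_comm]; congr 1
  simp only [ev_D_V2, ev_X, mul_sum, sum_mul]
  refine sum_congr rfl fun i _ => sum_congr rfl fun k _ => ?_
  ring
def Sf (V : Fin n → SA n) (i k : Fin n) : SA n :=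
  D i (V k) + D k (V i) - (if i = k then (2 / (n:ℝ)) • T0 V else 0)
structure Sys {n : ℕ} (l0 : Fin n) (h : Fin n → Fin n → SA n) (V : Fin n → SA n) : Prop where
  hsym : ∀ i k, h i k = h k i
  htr : ∀ x, ∑ i, ev x (h i i) = 0
  eqn : ∀ x ∈ HS l0, ∀ i, ∑ k, ev x (D k (w n ^ n * (h i k - Sf V i k))) = 0
  b1 : ∀ x : Euc n, x l0 = 0 → ev x (V l0) = 0
  b2 : ∀ x : Euc n, x l0 = 0 → ∀ i, i ≠ l0 → ev x (D l0 (V i)) = ev x (h i l0)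
lemma dot_Y (x : Euc n) (V : Fin n → SA n) (p : Fin n → ℝ) (c1 c2 : ℝ) :
    ∑ i, p i * ev x ((∑ k, V k * D k (V i)) - T0 V * V i + c1 • (w n * (xv V * V i))
       + c2 • (w n * (V2 V * X i))) =
     (∑ i, ∑ k, p k * ev x (V i) * ev x (D i (V k))) - (∑ i, p i * ev x (V i)) * ev x (T0 V)
     + c1 * eW x * ev x (xv V) * (∑ i, p i * ev x (V i))
     + c2 * eW x * (∑ i, p i * x i) * ev x (V2 V) := by
  simp only [map_add, map_sub, map_mul, ev_smul, map_sum, mul_add, mul_sub, sum_add_distrib,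
    sum_sub_distrib, ev_X, mul_sum, sum_mul]
  congr 1
  congr 1
  congr 1
  · rw [sum_comm]
    refine sum_congr rfl fun i _ => sum_congr rfl fun k _ => ?_
    ring
  · refine sum_congr rfl fun i _ => ?_
    ring
  · refine sum_congr rfl fun i _ => ?_
    ring
  · refine sum_congr rfl fun i _ => ?_
    ring
end
section
open Finset
def ct1 (x : Euc n) (V : Fin n → SA n) (p : Fin n → ℝ) : ℝ :=
  ∑ i, ∑ k, p i * ev x (V k) * ev x (D i (V k))
def ct2 (x : Euc n) (V : Fin n → SA n) (p : Fin n → ℝ) : ℝ :=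
  ∑ i, ∑ k, p k * ev x (V i) * ev x (D i (V k))
def dt (x : Euc n) (V : Fin n → SA n) (p : Fin n → ℝ) : ℝ := ∑ i, p i * ev x (V i)
def a1 (x : Euc n) (V : Fin n → SA n) : ℝ :=
  ∑ i, ∑ k, ev x (D i (V k)) * ev x (D k (V i))
def a2 (x : Euc n) (V : Fin n → SA n) : ℝ :=
  ∑ i, ∑ k, ev x (D i (V k)) * ev x (D i (V k))
def Yf (V : Fin n → SA n) (i : Fin n) : SA n :=
  (∑ k, V k * D k (V i)) - T0 V * V i + (2 * ((n:ℝ) - 2)) • (w n * (xv V * V i))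
       + (2:ℝ) • (w n * (V2 V * X i))
lemma ev_D_w (x : Euc n) (i : Fin n) : ev x (D i (w n)) = -2 * x i * eW x ^ 2 := by
  rw [D_w]; have h2 : ev x (2 : SA n) = 2 := map_ofNat (ev x) 2
  simp [ev_X, h2]; ring
lemma ev_D_wp (x : Euc n) (i : Fin n) (k : ℕ) :
    ev x (D i (w n ^ k)) = -2 * k * x i * eW x * eW x ^ k := by
  rw [D_w_pow]; simp [ev_X]; ring
lemma sum_x_V (x : Euc n) (V : Fin n → SA n) : dt x V (fun i => x i) = ev x (xv V) := by
  rw [ev_xv]; rfl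
lemma dv_Yf (x : Euc n) (V : Fin n → SA n) :
    dv x (fun i => Yf V i) = a1 x V - ev x (T0 V) ^ 2
      + 2 * ((n:ℝ) - 2) * (eW x * (ev x (xv V) * ev x (T0 V) + ev x (V2 V)
         + ct2 x V (fun i => x i)) - 2 * eW x ^ 2 * ev x (xv V) ^ 2)
      + 2 * (eW x * (n * ev x (V2 V) + 2 * ct1 x V (fun i => x i))
         - 2 * eW x^2 * (∑ i, x i * x i) * ev x (V2 V)) := by
  unfold Yf
  rw [dv_add x (fun i => (∑ k, V k * D k (V i)) - T0 V * V i + (2 * ((n:ℝ) - 2)) • (w n * (xv V * V i))),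
    dv_add x (fun i => (∑ k, V k * D k (V i)) - T0 V * V i),
    dv_sub x (fun i => (∑ k, V k * D k (V i))), dv_smul, dv_smul, dv_mul x (w n), dv_mul x (w n),
    dv_L1, dv_L2, dv_L3, dv_L4]
  have e1 : ∑ i, ev x (D i (w n)) * ev x (xv V * V i) = - 2 * eW x ^ 2 * ev x (xv V) ^ 2 := by
    conv_rhs => rw [pow_two (ev x (xv V))]; rw [← mul_assoc]; arg 2; rw [ev_xv]
    rw [mul_sum]
    refine sum_congr rfl fun i _ => ?_
    rw [ev_D_w, map_mul]; ring
  have e2 : ∑ i, ev x (D i (w n)) * ev x (V2 V * X i) =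
      - 2 * eW x ^ 2 * (∑ i, x i * x i) * ev x (V2 V) := by
    rw [mul_sum, sum_mul]
    refine sum_congr rfl fun i _ => ?_
    rw [ev_D_w, map_mul, ev_X]; ring
  rw [e1, e2]
  simp only [ct1, ct2, a1]
  ring
lemma dv_wqY (x : Euc n) (V : Fin n → SA n) (q : SA n) :
    dv x (fun i => (w n ^ n * q) * Yf V i) =
     eW x ^ n * (ev x q * dv x (fun i => Yf V i)
      + (∑ i, ev x (D i q) * ev x (Yf V i)) - 2 * n * eW x * ev x q * ∑ i, x i * ev x (Yf V i)) := by
  rw [dv_mul, map_mul, map_pow]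
  have : ∑ i, ev x (D i (w n ^ n * q)) * ev x (Yf V i) =
      eW x ^ n * ((∑ i, ev x (D i q) * ev x (Yf V i)) - 2 * n * eW x * ev x q * ∑ i, x i * ev x (Yf V i)) := by
    simp only [mul_sub, mul_sum]
    rw [← sum_sub_distrib]
    refine sum_congr rfl fun i _ => ?_
    rw [D_mul, map_add, map_mul, map_mul, ev_D_wp, map_pow]; ring
  rw [this]; ring
lemma dot_Yf (x : Euc n) (V : Fin n → SA n) (p : Fin n → ℝ) :
    ∑ i, p i * ev x (Yf V i) =
     ct2 x V p - dt x V p * ev x (T0 V)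
     + 2 * ((n:ℝ) - 2) * eW x * ev x (xv V) * dt x V p
     + 2 * eW x * (∑ i, p i * x i) * ev x (V2 V) := by
  unfold Yf; rw [dot_Y]; rfl
lemma dv_F1 (x : Euc n) (V : Fin n → SA n) (q : SA n) :
    dv x (fun i => (w n ^ (n+1) * q) * (V2 V * X i)) =
     eW x ^ (n+1) * (ev x q * (n * ev x (V2 V) + 2 * ct1 x V (fun i => x i))
      + (∑ i, ev x (D i q) * x i) * ev x (V2 V)
      - 2 * (n + 1) * eW x * ev x q * (∑ i, x i * x i) * ev x (V2 V)) := by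
  rw [dv_mul, map_mul, map_pow, dv_L4]
  have : ∑ i, ev x (D i (w n ^ (n+1) * q)) * ev x (V2 V * X i) =
      eW x ^ (n+1) * ((∑ i, ev x (D i q) * x i) * ev x (V2 V)
      - 2 * (n + 1) * eW x * ev x q * (∑ i, x i * x i) * ev x (V2 V)) := by
    simp only [mul_sub, mul_sum, sum_mul]
    rw [← sum_sub_distrib]
    refine sum_congr rfl fun i _ => ?_
    rw [D_mul, map_add, map_mul, map_mul, map_mul, ev_D_wp, map_pow, ev_X]; push_cast; ring
  rw [this]; simp only [ct1]; ring
lemma dv_X1 {l0 : Fin n} {h : Fin n → Fin n → SA n} {V : Fin n → SA n} (H : Sys l0 h V)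
    (x : Euc n) (hx : x ∈ HS l0) (q : SA n) :
    dv x (fun k => ∑ i, (w n ^ n * (h i k - Sf V i k)) * (q * V i)) =
    eW x ^ n * ((∑ i, ∑ k, ev x (h i k) * (ev x (D k q) * ev x (V i) + ev x q * ev x (D k (V i))))
     - (ct1 x V (fun i => ev x (D i q)) + ct2 x V (fun i => ev x (D i q)))
     - ev x q * (a1 x V + a2 x V)
     + 2 / n * ev x (T0 V) * (dt x V (fun i => ev x (D i q)) + ev x q * ev x (T0 V))) := by
  unfold dv
  have e0 : ∑ k, ev x (D k (∑ i, (w n ^ n * (h i k - Sf V i k)) * (q * V i))) =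
     ∑ i, (∑ k, ev x (D k (w n ^ n * (h i k - Sf V i k)))) * ev x (q * V i)
     + eW x^n * ∑ i, ∑ k, (ev x (h i k) - ev x (Sf V i k)) *
       (ev x (D k q) * ev x (V i) + ev x q * ev x (D k (V i))) := by
    simp only [map_sum]
    rw [sum_comm]
    simp only [sum_mul, mul_sum]
    rw [← sum_add_distrib]
    refine sum_congr rfl fun i _ => ?_
    rw [← sum_add_distrib]
    refine sum_congr rfl fun k _ => ?_
    rw [D_mul k (w n ^ n * (h i k - Sf V i k)), D_mul k q]
    simp only [map_add, map_mul, map_sub, map_pow]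
    ring
  rw [e0]
  have e1 : ∑ i, (∑ k, ev x (D k (w n ^ n * (h i k - Sf V i k)))) * ev x (q * V i) = 0 := by
    apply sum_eq_zero; intro i _; rw [H.eqn x hx i, zero_mul]
  rw [e1, zero_add]
  congr 1
  have e2 : ∑ i, ∑ k, ev x (Sf V i k) * (ev x (D k q) * ev x (V i) + ev x q * ev x (D k (V i))) =
      (ct1 x V (fun i => ev x (D i q)) + ct2 x V (fun i => ev x (D i q)))
     + ev x q * (a1 x V + a2 x V)
     - 2 / n * ev x (T0 V) * (dt x V (fun i => ev x (D i q)) + ev x q * ev x (T0 V)) := by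
    have f1 : ct1 x V (fun i => ev x (D i q)) =
        ∑ i, ∑ k, ev x (D k q) * ev x (V i) * ev x (D k (V i)) := by
      unfold ct1; rw [sum_comm]
    have f2 : a2 x V = ∑ i, ∑ k, ev x (D k (V i)) * ev x (D k (V i)) := by
      unfold a2; rw [sum_comm]
    have f3 : ∑ i, ∑ k, ev x (if i = k then (2 / (n:ℝ)) • T0 V else 0) *
        (ev x (D k q) * ev x (V i) + ev x q * ev x (D k (V i))) =
        2 / n * ev x (T0 V) * (dt x V (fun i => ev x (D i q)) + ev x q * ev x (T0 V)) := by
      simp only [apply_ite (ev x), ite_mul, map_zero, zero_mul]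
      simp only [sum_ite_eq, mem_univ, if_true, ev_smul]
      rw [← mul_sum, sum_add_distrib, ← mul_sum, ← ev_T0]; rfl
    rw [← f3, f1, f2]
    unfold ct2 a1
    simp only [mul_add, mul_sum]
    simp only [← sum_add_distrib, ← sum_sub_distrib]
    refine sum_congr rfl fun i _ => sum_congr rfl fun k _ => ?_
    simp only [Sf, map_add, map_sub]
    ring
  have e3 : ∑ i, ∑ k, (ev x (h i k) - ev x (Sf V i k)) *
       (ev x (D k q) * ev x (V i) + ev x q * ev x (D k (V i))) =
       ∑ i, ∑ k, ev x (h i k) * (ev x (D k q) * ev x (V i) + ev x q * ev x (D k (V i)))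
       - ∑ i, ∑ k, ev x (Sf V i k) * (ev x (D k q) * ev x (V i) + ev x q * ev x (D k (V i))) := by
    simp only [sub_mul, sum_sub_distrib]
  rw [e3, e2]; ring
def Bm (x : Euc n) (V : Fin n → SA n) (i k : Fin n) : ℝ :=
  ev x (D i (V k)) - 2 * eW x * (x i * ev x (V k)) + 2 * eW x * (ev x (V i) * x k)
    - (if i = k then 2 * eW x * ev x (xv V) else 0)
def bb (x : Euc n) (V : Fin n → SA n) : ℝ := ∑ i, ∑ k, Bm x V i k ^ 2
lemma ct_B (x : Euc n) (V : Fin n → SA n) (p : Fin n → ℝ) :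
    ∑ i, ∑ k, p i * ev x (V k) * Bm x V i k =
      ct1 x V p - 2 * eW x * (∑ i, p i * x i) * ev x (V2 V) := by
  have e1 : (∑ i, ∑ k, p i * ev x (V k) * (if i = k then 2 * eW x * ev x (xv V) else 0)) =
     2 * eW x * ∑ i, ∑ k, p i * ev x (V i) * (x k * ev x (V k)) := by
    simp only [mul_ite, mul_zero, sum_ite_eq, mem_univ, if_true, ← mul_sum, ← sum_mul, ← ev_xv]
    ring
  have e2 : (∑ i, p i * x i) * ev x (V2 V) = ∑ i, ∑ k, p i * x i * (ev x (V k) * ev x (V k)) := by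
    rw [ev_V2, sum_mul_sum]
  rw [mul_assoc, e2]
  have e3 : ∑ i, ∑ k, p i * ev x (V k) * Bm x V i k =
     ct1 x V p - 2 * eW x * (∑ i, ∑ k, p i * x i * (ev x (V k) * ev x (V k)))
     + 2 * eW x * (∑ i, ∑ k, p i * ev x (V i) * (x k * ev x (V k)))
     - (∑ i, ∑ k, p i * ev x (V k) * (if i = k then 2 * eW x * ev x (xv V) else 0)) := by
    unfold ct1
    simp only [mul_sum]
    simp only [← sum_add_distrib, ← sum_sub_distrib]
    refine sum_congr rfl fun i _ => sum_congr rfl fun k _ => ?_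
    unfold Bm; ring
  rw [e3, e1]; ring
lemma bb_eq (x : Euc n) (V : Fin n → SA n) :
    bb x V = a2 x V + 8 * eW x^2 * ((∑ i, x i * x i) * ev x (V2 V) - ev x (xv V)^2)
      + 4 * n * eW x^2 * ev x (xv V)^2
      - 4 * eW x * (ct1 x V (fun i => x i) - ct2 x V (fun i => x i))
      - 4 * eW x * ev x (xv V) * ev x (T0 V) := by
  have e1 : ∑ i : Fin n, ∑ k : Fin n, (if i = k then 2 * eW x * ev x (xv V) else 0) ^ 2 =
     4 * n * eW x^2 * ev x (xv V)^2 := by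
    simp [ite_pow]; ring
  have e2 : ∑ i, ∑ k, 2 * ev x (D i (V k)) * (if i = k then 2 * eW x * ev x (xv V) else 0) =
     4 * eW x * ev x (xv V) * ev x (T0 V) := by
    simp only [mul_ite, mul_zero, sum_ite_eq, mem_univ, if_true]
    rw [ev_T0, mul_sum]
    exact sum_congr rfl fun i _ => by ring
  have e3 : ∑ i, ∑ k, 4 * eW x * (x i * ev x (V k) - ev x (V i) * x k) * (if i = k then 2 * eW x * ev x (xv V) else 0) = 0 := by
    simp only [mul_ite, mul_zero, sum_ite_eq, mem_univ, if_true]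
    apply sum_eq_zero; intro i _; ring
  have e4 : (∑ i, x i * x i) * ev x (V2 V) = ∑ i, ∑ k, x i * x i * (ev x (V k) * ev x (V k)) := by
    rw [ev_V2, sum_mul_sum]
  have e4' : (∑ i, x i * x i) * ev x (V2 V) = ∑ i, ∑ k, x k * x k * (ev x (V i) * ev x (V i)) := by
    rw [e4, sum_comm]
  have e5 : ev x (xv V)^2 = ∑ i, ∑ k, x i * ev x (V i) * (x k * ev x (V k)) := by
    rw [ev_xv, pow_two, sum_mul_sum]
  have e6 : bb x V = a2 x V + 4 * eW x^2 * (∑ i, ∑ k, x i * x i * (ev x (V k) * ev x (V k)))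
     + 4 * eW x^2 * (∑ i, ∑ k, x k * x k * (ev x (V i) * ev x (V i)))
     - 8 * eW x^2 * (∑ i, ∑ k, x i * ev x (V i) * (x k * ev x (V k)))
     + (∑ i : Fin n, ∑ k : Fin n, (if i = k then 2 * eW x * ev x (xv V) else 0) ^ 2)
     - 4 * eW x * ct1 x V (fun i => x i) + 4 * eW x * ct2 x V (fun i => x i)
     - (∑ i, ∑ k, 2 * ev x (D i (V k)) * (if i = k then 2 * eW x * ev x (xv V) else 0))
     + (∑ i, ∑ k, 4 * eW x * (x i * ev x (V k) - ev x (V i) * x k) * (if i = k then 2 * eW x * ev x (xv V) else 0)) := by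
    unfold bb a2 ct1 ct2
    simp only [mul_sum]
    simp only [← sum_add_distrib, ← sum_sub_distrib]
    refine sum_congr rfl fun i _ => sum_congr rfl fun k _ => ?_
    unfold Bm; ring
  rw [e6, e1, e2, e3, ← e4, ← e4', ← e5]; ring
lemma h_B {l0 : Fin n} {h : Fin n → Fin n → SA n} {V : Fin n → SA n} (H : Sys l0 h V)
    (x : Euc n) : ∑ i, ∑ k, ev x (h i k) * ev x (D k (V i)) = ∑ i, ∑ k, ev x (h i k) * Bm x V k i := by
  have e1 : ∑ i, ∑ k, ev x (h i k) * (if k = i then 2 * eW x * ev x (xv V) else 0) = 0 := by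
    simp only [mul_ite, mul_zero, sum_ite_eq', mem_univ, if_true, ← sum_mul, H.htr x, zero_mul]
  have e2 : ∑ i, ∑ k, ev x (h i k) * (ev x (V k) * x i) = ∑ i, ∑ k, ev x (h i k) * (x k * ev x (V i)) := by
    rw [sum_comm]
    refine sum_congr rfl fun i _ => sum_congr rfl fun k _ => ?_
    rw [H.hsym]; ring
  have e3 : ∑ i, ∑ k, ev x (h i k) * Bm x V k i = ∑ i, ∑ k, ev x (h i k) * ev x (D k (V i))
     - 2 * eW x * (∑ i, ∑ k, ev x (h i k) * (x k * ev x (V i)))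
     + 2 * eW x * (∑ i, ∑ k, ev x (h i k) * (ev x (V k) * x i))
     - ∑ i, ∑ k, ev x (h i k) * (if k = i then 2 * eW x * ev x (xv V) else 0) := by
    simp only [mul_sum]
    simp only [← sum_add_distrib, ← sum_sub_distrib]
    refine sum_congr rfl fun i _ => sum_congr rfl fun k _ => ?_
    unfold Bm; ring
  rw [e3, e1, e2]; ring
end
section
open Finset
lemma amgm {p a c ε δ : ℝ} (h : p ^ 2 ≤ a * c) (ha : 0 ≤ a) (hc : 0 ≤ c) (hε : 0 < ε)
    (hδ : 4 * ε * δ = 1) : |p| ≤ ε * a + δ * c := by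
  have hδ0 : 0 < δ := by
    by_contra h0
    push Not at h0
    nlinarith
  have h1 : 0 ≤ ε * a + δ * c := by positivity
  apply abs_le_of_sq_le_sq _ h1
  have h2 : (ε * a - δ * c) ^ 2 ≥ 0 := sq_nonneg _
  have h3 : (ε * a + δ * c) ^ 2 = (ε * a - δ * c) ^ 2 + a * c := by
    linear_combination (a * c) * hδ
  rw [h3]; linarith
lemma cs1 (a b : Fin n → ℝ) : (∑ i, a i * b i) ^ 2 ≤ (∑ i, a i * a i) * ∑ i, b i * b i := by
  have := sum_mul_sq_le_sq_mul_sq univ a b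
  simpa [pow_two] using this
lemma cs2 (a b : Fin n → Fin n → ℝ) :
    (∑ i, ∑ k, a i k * b i k) ^ 2 ≤ (∑ i, ∑ k, a i k ^ 2) * ∑ i, ∑ k, b i k ^ 2 := by
  have := sum_mul_sq_le_sq_mul_sq (univ : Finset (Fin n × Fin n)) (fun p => a p.1 p.2) (fun p => b p.1 p.2)
  simpa [Fintype.sum_prod_type] using this
lemma cs3 (p v : Fin n → ℝ) (B : Fin n → Fin n → ℝ) :
    (∑ i, ∑ k, p i * v k * B i k) ^ 2 ≤ (∑ i, p i * p i) * (∑ i, v i * v i) * ∑ i, ∑ k, B i k ^ 2 := by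
  have := cs2 (fun i k => p i * v k) B
  refine this.trans (le_of_eq ?_)
  congr 1
  rw [sum_mul_sum]
  refine sum_congr rfl fun i _ => sum_congr rfl fun k _ => ?_
  ring
lemma ct1_lin (x : Euc n) (V : Fin n → SA n) (p g : Fin n → ℝ) (a b : ℝ) :
    ct1 x V (fun i => a * p i + b * g i) = a * ct1 x V p + b * ct1 x V g := by
  unfold ct1; simp only [mul_sum, ← sum_add_distrib]
  refine sum_congr rfl fun i _ => sum_congr rfl fun k _ => ?_
  ring
lemma ct2_lin (x : Euc n) (V : Fin n → SA n) (p g : Fin n → ℝ) (a b : ℝ) :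
    ct2 x V (fun i => a * p i + b * g i) = a * ct2 x V p + b * ct2 x V g := by
  unfold ct2; simp only [mul_sum, ← sum_add_distrib]
  refine sum_congr rfl fun i _ => sum_congr rfl fun k _ => ?_
  ring
lemma dt_lin (x : Euc n) (V : Fin n → SA n) (p g : Fin n → ℝ) (a b : ℝ) :
    dt x V (fun i => a * p i + b * g i) = a * dt x V p + b * dt x V g := by
  unfold dt; simp only [mul_sum, ← sum_add_distrib]
  refine sum_congr rfl fun i _ => ?_
  ring
lemma dot_lin (p g y : Fin n → ℝ) (a b : ℝ) :
    ∑ i, (a * p i + b * g i) * y i = a * (∑ i, p i * y i) + b * ∑ i, g i * y i := by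
  simp only [mul_sum, ← sum_add_distrib]
  refine sum_congr rfl fun i _ => ?_
  ring
def Tf (V : Fin n → SA n) : SA n := T0 V - (2 * (n:ℝ)) • (w n * xv V)
lemma ev_Tf (x : Euc n) (V : Fin n → SA n) :
    ev x (Tf V) = ev x (T0 V) - 2 * n * eW x * ev x (xv V) := by
  simp [Tf]; ring
def hh (x : Euc n) (h : Fin n → Fin n → SA n) : ℝ := ∑ i, ∑ k, ev x (h i k) ^ 2
def g2 (x : Euc n) (f : SA n) : ℝ := ∑ i, ev x (D i f) * ev x (D i f)
lemma g2_nonneg (x : Euc n) (f : SA n) : 0 ≤ g2 x f :=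
  sum_nonneg fun i _ => mul_self_nonneg _
lemma hh_nonneg (x : Euc n) (h : Fin n → Fin n → SA n) : 0 ≤ hh x h :=
  sum_nonneg fun i _ => sum_nonneg fun k _ => sq_nonneg _
lemma bb_nonneg (x : Euc n) (V : Fin n → SA n) : 0 ≤ bb x V :=
  sum_nonneg fun i _ => sum_nonneg fun k _ => sq_nonneg _
lemma V2_nonneg (x : Euc n) (V : Fin n → SA n) : 0 ≤ ev x (V2 V) := by
  rw [ev_V2]; exact sum_nonneg fun i _ => mul_self_nonneg _
def fld2 (h : Fin n → Fin n → SA n) (V : Fin n → SA n) (q : SA n) (k : Fin n) : SA n :=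
  - ((∑ i, (w n ^ n * (h i k - Sf V i k)) * (q * V i)) + (w n ^ n * q) * Yf V k
    + (((n:ℝ) - 3) / 2) • ((w n ^ (n+1) * q) * (V2 V * X k)))
lemma dv_neg (x : Euc n) (P : Fin n → SA n) : dv x (fun i => - P i) = - dv x P := by
  unfold dv; simp [sum_neg_distrib]
lemma dv_fld2 (h : Fin n → Fin n → SA n) (V : Fin n → SA n) (q : SA n) (x : Euc n) :
    dv x (fld2 h V q) = - (dv x (fun k => ∑ i, (w n ^ n * (h i k - Sf V i k)) * (q * V i))
      + dv x (fun i => (w n ^ n * q) * Yf V i)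
      + (((n:ℝ) - 3) / 2) * dv x (fun i => (w n ^ (n+1) * q) * (V2 V * X i))) := by
  unfold fld2
  rw [dv_neg, dv_add x (fun k => (∑ i, (w n ^ n * (h i k - Sf V i k)) * (q * V i)) + (w n ^ n * q) * Yf V k),
    dv_add x (fun k => (∑ i, (w n ^ n * (h i k - Sf V i k)) * (q * V i))), dv_smul]
lemma scal2 (n ω r b a1 T0 xv V2 α1 α2 c1g c2g gV gx m η hx hg hA : ℝ) (hn : n ≠ 0) (hω : ω * (1 + r) = 1)
    (β γ T a2 : ℝ) (hb : a2 = b - 8 * ω^2 * (r * V2 - xv^2) - 4 * n * ω^2 * xv^2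
      + 4 * ω * (α1 - α2) + 4 * ω * xv * T0)
    (hβ : β = α1 - 2 * ω * r * V2) (hγ : γ = c1g - 2 * ω * gx * V2)
    (hT : T = T0 - 2 * n * ω * xv) :
    - (((η^2 * m * ω * hx + 2 * η * hg + η^2 * hA)
       - (((η^2 * m * ω) * α1 + 2 * η * c1g) + ((η^2 * m * ω) * α2 + 2 * η * c2g))
       - η^2 * (a1 + a2)
       + 2 / n * T0 * (((η^2 * m * ω) * xv + 2 * η * gV) + η^2 * T0))
    + (η^2 * (a1 - T0^2 + 2 * (n - 2) * (ω * (xv * T0 + V2 + α2) - 2 * ω^2 * xv^2)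
       + 2 * (ω * (n * V2 + 2 * α1) - 2 * ω^2 * r * V2))
       + (((η^2 * m * ω) * α2 + 2 * η * c2g) - ((η^2 * m * ω) * xv + 2 * η * gV) * T0
          + 2 * (n - 2) * ω * xv * ((η^2 * m * ω) * xv + 2 * η * gV)
          + 2 * ω * ((η^2 * m * ω) * r + 2 * η * gx) * V2)
       - 2 * n * ω * η^2 * (α2 - xv * T0 + 2 * (n - 2) * ω * xv * xv + 2 * ω * r * V2))
    + (n - 3) / 2 * (ω * (η^2 * (n * V2 + 2 * α1) + ((η^2 * m * ω) * r + 2 * η * gx) * V2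
        - 2 * (n + 1) * ω * η^2 * r * V2)))
    = η^2 * (b + (1 - 2/n) * T^2 + (m - (n - 3)) * (ω * β) + (n-3)/2 * (n - 2 - m) * (ω * V2)
       - (n-3)/2 * (2*n - 2 - m) * (ω * (ω * V2)))
      + (1 - 2/n) * T * (η^2 * m * (ω * xv) + 2 * η * gV) + 2 * η * γ - (n-3) * η * (ω * gx) * V2
      - 4 * (n-1) * η^2 * (ω * (ω * V2)) - (η^2 * m * ω * hx + 2 * η * hg + η^2 * hA) := by
  have hr : ω * r = 1 - ω := by linarith
  have hω0 : ω ≠ 0 := by rintro rfl; simp at hω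
  have hr' : r = (1 - ω) / ω := by field_simp; linarith
  subst hb hβ hγ hT hr'
  field_simp
  ring
end
section
open Finset
lemma scal2_ineq (n ω r b xv V2 gV gx m η hx hg hB β γ T G H : ℝ) (hn : 6 ≤ n) (hω0 : 0 < ω)
    (hω : ω * (1 + r) = 1) (hr : 0 ≤ r) (hm0 : 0 ≤ m) (hm : m ≤ n - 3)
    (hb : 0 ≤ b) (hV : 0 ≤ V2) (hG : 0 ≤ G) (hH : 0 ≤ H)
    (f1 : β^2 ≤ r * V2 * b) (f2 : γ^2 ≤ G * V2 * b) (f3 : xv^2 ≤ r * V2) (f4 : gV^2 ≤ G * V2)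
    (f5 : gx^2 ≤ G * r) (f6 : hB^2 ≤ H * b) (f7 : hx^2 ≤ r * V2 * H) (f8 : hg^2 ≤ G * V2 * H) :
    1/4 * (η^2 * (b + ω * V2)) ≤ η^2 * (b + (1 - 2/n) * T^2 + (m - (n - 3)) * (ω * β) + (n-3)/2 * (n - 2 - m) * (ω * V2)
       - (n-3)/2 * (2*n - 2 - m) * (ω * (ω * V2)))
      + (1 - 2/n) * T * (η^2 * m * (ω * xv) + 2 * η * gV) + 2 * η * γ - (n-3) * η * (ω * gx) * V2
      - 4 * (n-1) * η^2 * (ω * (ω * V2)) - (η^2 * m * ω * hx + 2 * η * hg + η^2 * hB)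
      + 20 * n^2 * (η^2 * T^2 + η^2 * (ω * (ω * V2)) + η^2 * H + G * V2) := by
  have hωr : ω * r ≤ 1 := by linarith
  have hωr0 : 0 ≤ ω * r := by positivity
  set τ := ω * V2 with hτ
  have hτ0 : 0 ≤ τ := by positivity
  have hη := sq_nonneg η
  set e := η^2 with he
  have hkey : ω^2 * (r * V2) ≤ τ := by
    have : ω^2 * (r * V2) = (ω * r) * τ := by rw [hτ]; ring
    rw [this]; exact mul_le_of_le_one_left hτ0 hωr
  have hs0 : 0 ≤ 1 - 2/n := by
    rw [sub_nonneg, div_le_one (by linarith)]; linarith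
  have hs1 : 1 - 2/n ≤ 1 := by
    have : 0 ≤ 2/n := by positivity
    linarith
  set κ := n - 3 - m with hκ
  have hκ0 : 0 ≤ κ := by linarith
  have t1 : |κ * (ω * β)| ≤ 1/2 * b + 1/2 * (κ^2 * τ) := by
    apply amgm _ hb (by positivity) (by norm_num) (by norm_num)
    calc (κ * (ω * β))^2 = κ^2 * (ω^2 * β^2) := by ring
      _ ≤ κ^2 * (ω^2 * (r * V2 * b)) := by gcongr
      _ = κ^2 * (ω^2 * (r * V2)) * b := by ring
      _ ≤ κ^2 * τ * b := by gcongr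
      _ = _ := by ring
  have t1' : κ^2 * τ ≤ (n-3) * κ * τ := by
    have : κ^2 ≤ (n-3) * κ := by rw [pow_two]; exact mnR (by linarith) hκ0
    gcongr
  have hmn : m^2 ≤ n^2 := pow_le_pow_left₀ hm0 (by linarith) 2
  have t3 : |T * (m * (ω * xv))| ≤ 1/8 * τ + 2 * (n^2 * T^2) := by
    apply amgm _ hτ0 (by positivity) (by norm_num) (by norm_num)
    calc (T * (m * (ω * xv)))^2 = T^2 * m^2 * (ω^2 * xv^2) := by ring
      _ ≤ T^2 * n^2 * (ω^2 * (r * V2)) := by gcongr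
      _ ≤ T^2 * n^2 * τ := by gcongr
      _ = _ := by ring
  have t4 : |η * T * gV| ≤ 1/2 * (e * T^2) + 1/2 * (G * V2) := by
    apply amgm _ (by positivity) (by positivity) (by norm_num) (by norm_num)
    calc (η * T * gV)^2 = e * T^2 * gV^2 := by rw [he]; ring
      _ ≤ e * T^2 * (G * V2) := by gcongr
  have t5 : |η * γ| ≤ 1/16 * (e * b) + 4 * (G * V2) := by
    apply amgm _ (by positivity) (by positivity) (by norm_num) (by norm_num)
    calc (η * γ)^2 = e * γ^2 := by rw [he]; ring
      _ ≤ e * (G * V2 * b) := by gcongr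
      _ = _ := by ring
  have t6 : |(n-3) * η * (ω * gx) * V2| ≤ 1/8 * (e * τ) + 2 * ((n-3)^2 * (G * V2)) := by
    apply amgm _ (by positivity) (by positivity) (by norm_num) (by norm_num)
    calc ((n-3) * η * (ω * gx) * V2)^2 = (n-3)^2 * e * ω^2 * gx^2 * V2^2 := by rw [he]; ring
      _ ≤ (n-3)^2 * e * ω^2 * (G * r) * V2^2 := by gcongr
      _ = (n-3)^2 * e * G * V2 * (ω^2 * (r * V2)) := by ring
      _ ≤ (n-3)^2 * e * G * V2 * τ := by gcongr
      _ = _ := by ring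
  have t7 : |m * (ω * hx)| ≤ 1/8 * τ + 2 * (n^2 * H) := by
    apply amgm _ hτ0 (by positivity) (by norm_num) (by norm_num)
    calc (m * (ω * hx))^2 = m^2 * (ω^2 * hx^2) := by ring
      _ ≤ n^2 * (ω^2 * (r * V2 * H)) := by gcongr
      _ = n^2 * (ω^2 * (r * V2)) * H := by ring
      _ ≤ n^2 * τ * H := by gcongr
      _ = _ := by ring
  have t8 : |η * hg| ≤ 1/2 * (e * H) + 1/2 * (G * V2) := by
    apply amgm _ (by positivity) (by positivity) (by norm_num) (by norm_num)
    calc (η * hg)^2 = e * hg^2 := by rw [he]; ring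
      _ ≤ e * (G * V2 * H) := by gcongr
      _ = _ := by ring
  have t9 : |hB| ≤ 1/16 * b + 4 * H := by
    apply amgm _ hb hH (by norm_num) (by norm_num)
    linarith
  have s1 : e * ((m - (n-3)) * (ω * β) + (n-3)/2 * (n-2-m) * τ) ≥ e * (-(1/2) * b + 3/2 * τ) := by
    apply mnL _ hη
    have := neg_abs_le (κ * (ω * β))
    have := le_abs_self (κ * (ω * β))
    have e1 : (m - (n-3)) * (ω * β) = - (κ * (ω * β)) := by rw [hκ]; ring
    have e2 : (n-3)/2 * (n-2-m) * τ = ((n-3) * κ * τ) / 2 + (n-3)/2 * τ := by rw [hκ]; ring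
    have e3 : 3/2 * τ ≤ (n-3)/2 * τ := by gcongr; linarith
    rw [e1, e2]; linarith
  have s2 : (n-3)/2 * (2*n - 2 - m) * (ω * τ) + 4 * (n-1) * (ω * τ) ≤ 19 * n^2 * (ω * τ) := by
    rw [← add_mul]; apply mnR _ (by positivity)
    nlinarith only [hn, hm, hm0]
  have s2' := mnL s2 hη
  have s3 : |(1 - 2/n) * (e * (T * (m * (ω * xv))))| ≤ e * (1/8 * τ + 2 * (n^2 * T^2)) := by
    rw [abs_mul, abs_mul, abs_of_nonneg hs0, abs_of_nonneg hη]
    have : e * |T * (m * (ω * xv))| ≤ e * (1/8 * τ + 2 * (n^2 * T^2)) := by gcongr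
    have h0 : 0 ≤ e * |T * (m * (ω * xv))| := by positivity
    exact (mul_le_of_le_one_left h0 hs1).trans this
  have s4 : |(1 - 2/n) * (η * T * gV)| ≤ 1/2 * (e * T^2) + 1/2 * (G * V2) := by
    rw [abs_mul, abs_of_nonneg hs0]
    have h0 : 0 ≤ |η * T * gV| := by positivity
    exact (mul_le_of_le_one_left h0 hs1).trans t4
  have s7 := mnL ((le_abs_self _).trans t7) hη
  have s9 := mnL ((le_abs_self _).trans t9) hη
  have p1 : 0 ≤ (1 - 2/n) * (e * T^2) := by positivity
  have p2 : 0 ≤ (n^2 - 1) * (e * T^2) := mul_nonneg (by nlinarith only [hn]) (by positivity)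
  have p3 : 0 ≤ (n^2 - 36) * (G * V2) := mul_nonneg (by nlinarith only [hn]) (by positivity)
  have p4 : 0 ≤ (n^2 - 36) * (e * H) := mul_nonneg (by nlinarith only [hn]) (by positivity)
  have p5 : (n-3)^2 * (G * V2) ≤ n^2 * (G * V2) := mnR (by nlinarith only [hn]) (by positivity)
  have p6 : 0 ≤ e * b := by positivity
  have p7 : 0 ≤ e * τ := by positivity
  have p8 : 0 ≤ n^2 * (e * (ω * τ)) := by positivity
  have l3 := neg_le_of_abs_le s3
  have l4 := neg_le_of_abs_le s4
  have l5 := neg_le_of_abs_le t5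
  have l6 := le_of_abs_le t6
  have l8 := le_of_abs_le t8
  have pT : 0 ≤ n^2 * (e * T^2) := by positivity
  have pG : 0 ≤ n^2 * (G * V2) := by positivity
  have pH : 0 ≤ n^2 * (e * H) := by positivity
  have pT1 : 0 ≤ e * T^2 := by positivity
  have pG1 : 0 ≤ G * V2 := by positivity
  have pH1 : 0 ≤ e * H := by positivity
  generalize 1 - 2/n = σ at *
  clear_value κ
  clear_value e τ
  linarith only [s1, s2', l3, l4, l5, l6, s7, l8, s9, p1, p2, p3, p4, p5, p6, p7, p8, pT, pG, pH, pT1, pG1, pH1]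
end
section
open Finset
lemma hasDerivAt_line (f : SA n) (x : Euc n) (i : Fin n) (t : ℝ) :
    HasDerivAt (fun t : ℝ => ev (x + t • EuclideanSpace.single i (1:ℝ)) f)
      (ev (x + t • EuclideanSpace.single i (1:ℝ)) (D i f)) t := by
  have h1 : HasFDerivAt (f : Euc n → ℝ) (fderiv ℝ (f : Euc n → ℝ) (x + t • EuclideanSpace.single i (1:ℝ)))
    (x + t • EuclideanSpace.single i (1:ℝ)) := (SA.diff f _).hasFDerivAt
  have h2 : HasDerivAt (fun t : ℝ => x + t • EuclideanSpace.single i (1:ℝ)) (EuclideanSpace.single i (1:ℝ)) t := by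
    have := ((hasDerivAt_id t).smul_const (EuclideanSpace.single i (1:ℝ) : Euc n)).const_add x
    simpa using this
  exact h1.comp_hasDerivAt t h2
lemma D_bdry {l i : Fin n} (hi : i ≠ l) {f : SA n} (hf : ∀ x : Euc n, x l = 0 → ev x f = 0)
    (x : Euc n) (hx : x l = 0) : ev x (D i f) = 0 := by
  have h1 := hasDerivAt_line f x i 0
  simp only [zero_smul, add_zero] at h1
  have h2 : (fun t : ℝ => ev (x + t • EuclideanSpace.single i (1:ℝ)) f) = fun _ => 0 := by
    funext t; apply hf; simp [hx, hi.symm]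
  rw [h2] at h1
  exact h1.unique (hasDerivAt_const _ _)
lemma fld2_bdry {l0 : Fin n} {h : Fin n → Fin n → SA n} {V : Fin n → SA n} (H : Sys l0 h V)
    (q : SA n) (x : Euc n) (hx : x l0 = 0) : ev x (fld2 h V q l0) = 0 := by
  have hV := H.b1 x hx
  have h1 : ∀ i, i ≠ l0 → ev x (D i (V l0)) = 0 := fun i hi => D_bdry hi H.b1 x hx
  have e1 : ∑ i, ev x (w n ^ n * (h i l0 - Sf V i l0) * (q * V i)) = 0 := by
    apply sum_eq_zero; intro i _
    by_cases hi : i = l0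
    · subst hi; simp [hV]
    · simp only [map_mul, map_sub, Sf, map_add, if_neg hi, map_zero, h1 i hi, H.b2 x hx i hi]; ring
  have e2 : ∑ k, ev x (V k * D k (V l0)) = 0 := by
    apply sum_eq_zero; intro i _
    by_cases hi : i = l0
    · subst hi; simp [hV]
    · simp [h1 i hi]
  have e3 : ev x (Yf V l0) = 0 := by
    unfold Yf
    rw [map_add, map_add, map_sub, map_sum, e2]
    simp [hV, ev_X, hx]
  unfold fld2
  rw [map_neg, map_add, map_add, map_sum, e1]
  simp [e3, ev_X, hx]
lemma fld2_supp (h : Fin n → Fin n → SA n) (V : Fin n → SA n)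
    (q : SA n) (x : Euc n) (hx : ev x q = 0) (k : Fin n) : ev x (fld2 h V q k) = 0 := by
  simp [fld2, hx]
lemma ev_D_q (x : Euc n) (φ η : SA n) (m : ℝ)
    (hφ : ∀ i, ev x (D i φ) = m * eW x * x i * ev x φ) (i : Fin n) :
    ev x (D i (φ * (η * η))) = (ev x φ * (ev x η ^2 * m * eW x)) * x i
      + (ev x φ * (2 * ev x η)) * ev x (D i η) := by
  simp only [D_mul, map_add, map_mul, hφ]; ring
lemma step2_aux {W a b c l r : ℝ} (hW : 0 ≤ W) (hc : c = W * l) (h1 : l = r) (h2 : a ≤ r + b) :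
    W * a ≤ W * b + c := by
  rw [hc, h1, ← mul_add]
  exact mnL (by linarith) hW
lemma step2_pt (hn : 6 ≤ n) {l0 : Fin n} {h : Fin n → Fin n → SA n} {V : Fin n → SA n}
    (H : Sys l0 h V) (x : Euc n) (hx : x ∈ HS l0) (φ η : SA n) (m : ℝ)
    (hφ : ∀ i, ev x (D i φ) = m * eW x * x i * ev x φ) (hφ0 : 0 ≤ ev x φ)
    (hm0 : 0 ≤ m) (hm : m ≤ n - 3) :
    eW x ^ n * ev x φ * (1/4 * (ev x η ^ 2 * (bb x V + eW x * ev x (V2 V)))) ≤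
     eW x ^ n * ev x φ * (20 * n^2 * (ev x η ^2 * ev x (Tf V) ^ 2
        + ev x η ^ 2 * (eW x * (eW x * ev x (V2 V))) + ev x η ^2 * hh x h
        + g2 x η * ev x (V2 V)))
     + dv x (fld2 h V (φ * (η * η))) := by
  have hq := ev_D_q x φ η m hφ
  have hn' : (6:ℝ) ≤ n := by exact_mod_cast hn
  have hB := h_B H x
  have eh : ∑ i, ∑ k, ev x (h i k) * (ev x (D k (φ * (η * η))) * ev x (V i) + ev x (φ * (η*η)) * ev x (D k (V i)))
     = ev x φ * (ev x η ^2 * m * eW x * (∑ i, ∑ k, x i * ev x (V k) * ev x (h i k))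
      + 2 * ev x η * (∑ i, ∑ k, ev x (D i η) * ev x (V k) * ev x (h i k))
      + ev x η ^2 * ∑ i, ∑ k, ev x (h i k) * Bm x V k i) := by
    rw [← hB]
    have c1 : ∀ p : Fin n → ℝ, ∑ i, ∑ k, p i * ev x (V k) * ev x (h i k) =
      ∑ i, ∑ k, p k * ev x (V i) * ev x (h i k) := by
      intro p; rw [sum_comm]
      refine sum_congr rfl fun i _ => sum_congr rfl fun k _ => ?_
      rw [H.hsym]
    rw [c1, c1]
    simp only [mul_sum, mul_add]
    simp only [← sum_add_distrib]
    refine sum_congr rfl fun i _ => sum_congr rfl fun k _ => ?_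
    rw [hq, map_mul, map_mul]; ring
  have hid := scal2 n (eW x) (∑ i, x i * x i) (bb x V) (a1 x V) (ev x (T0 V)) (ev x (xv V)) (ev x (V2 V))
    (ct1 x V (fun i => x i)) (ct2 x V (fun i => x i)) (ct1 x V (fun i => ev x (D i η)))
    (ct2 x V (fun i => ev x (D i η))) (dt x V (fun i => ev x (D i η))) (∑ i, ev x (D i η) * x i) m (ev x η)
    (∑ i, ∑ k, x i * ev x (V k) * ev x (h i k)) (∑ i, ∑ k, ev x (D i η) * ev x (V k) * ev x (h i k))
    (∑ i, ∑ k, ev x (h i k) * Bm x V k i) (by linarith) (ev_w_mul x) _ _ _ (a2 x V)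
    (by rw [bb_eq]; ring) (ct_B x V (fun i => x i)) (ct_B x V (fun i => ev x (D i η))) (ev_Tf x V)
  have hin := scal2_ineq n (eW x) (∑ i, x i * x i) (bb x V) (ev x (xv V)) (ev x (V2 V))
    (dt x V (fun i => ev x (D i η))) (∑ i, ev x (D i η) * x i) m (ev x η)
    (∑ i, ∑ k, x i * ev x (V k) * ev x (h i k)) (∑ i, ∑ k, ev x (D i η) * ev x (V k) * ev x (h i k))
    (∑ i, ∑ k, ev x (h i k) * Bm x V k i) (∑ i, ∑ k, x i * ev x (V k) * Bm x V i k)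
    (∑ i, ∑ k, ev x (D i η) * ev x (V k) * Bm x V i k) (ev x (Tf V)) (g2 x η) (hh x h)
    hn' (ev_w_pos x) (ev_w_mul x) (sum_nonneg fun i _ => mul_self_nonneg _) hm0 hm (bb_nonneg x V)
    (V2_nonneg x V) (g2_nonneg x η) (hh_nonneg x h)
    (by rw [ev_V2]; exact cs3 (fun i => x i) (fun k => ev x (V k)) (Bm x V))
    (by rw [ev_V2]; exact cs3 (fun i => ev x (D i η)) (fun k => ev x (V k)) (Bm x V))
    (by rw [ev_V2, ev_xv]; exact cs1 _ _)
    (by rw [ev_V2]; exact cs1 _ _)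
    (cs1 _ _)
    (by
      have := cs2 (fun i k => ev x (h i k)) (fun i k => Bm x V k i)
      refine this.trans (le_of_eq ?_)
      unfold hh bb; congr 1; rw [sum_comm])
    (by rw [ev_V2]; exact cs3 (fun i => x i) (fun k => ev x (V k)) (fun i k => ev x (h i k)))
    (by rw [ev_V2]; exact cs3 (fun i => ev x (D i η)) (fun k => ev x (V k)) (fun i k => ev x (h i k)))
  refine step2_aux ((mul_nonneg (pow_nonneg (ev_w_pos x).le _) hφ0)) ?_ hid hin
  rw [dv_fld2, dv_X1 H x hx, dv_wqY, dv_F1, dv_Yf, dot_Yf, dot_Yf, eh]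
  simp only [hq]
  rw [ct1_lin, ct2_lin, dt_lin, dot_lin, sum_x_V, map_mul, map_mul]
  simp only [pow_succ (eW x) n]
  ring
end
section
open Finset
def Gf (l0 : Fin n) (h : Fin n → Fin n → SA n) (V : Fin n → SA n) (p : ℕ) (k i : Fin n) : SA n :=
  w n ^ p * (D k (V i) - D i (V k)) - (4:ℝ) • (w n ^ (p+1) * (X k * V i - X i * V k))
   - w n ^ p * ((if k = l0 then h i l0 else 0) - (if i = l0 then h k l0 else 0))
lemma Gf_anti (l0 : Fin n) (h : Fin n → Fin n → SA n) (V : Fin n → SA n) (p : ℕ) (k i : Fin n) :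
    Gf l0 h V p k i = - Gf l0 h V p i k := by
  simp only [Gf, Algebra.smul_def]; ring
lemma Gf_bdry {l0 : Fin n} {h : Fin n → Fin n → SA n} {V : Fin n → SA n} (H : Sys l0 h V)
    (p : ℕ) (x : Euc n) (hx : x l0 = 0) (i : Fin n) : ev x (Gf l0 h V p l0 i) = 0 := by
  by_cases hi : i = l0
  · subst hi; simp [Gf]
  · have h1 : ev x (D i (V l0)) = 0 := D_bdry hi H.b1 x hx
    simp [Gf, hi, h1, H.b1 x hx, H.b2 x hx i hi, hx, ev_X]
def zz (l0 : Fin n) (h : Fin n → Fin n → SA n) (x : Euc n) (i : Fin n) : ℝ :=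
  ∑ k, (ev x (D k (h i k)) - 2 * n * eW x * (x k * ev x (h i k)))
  - (ev x (D l0 (h i l0)) - 2 * ((n:ℝ) - 2) * eW x * (x l0 * ev x (h i l0)))
  + if i = l0 then ∑ k, (ev x (D k (h k l0)) - 2 * ((n:ℝ) - 2) * eW x * (x k * ev x (h k l0))) else 0
lemma eqn_lame (hn : 0 < n) {l0 : Fin n} {h : Fin n → Fin n → SA n} {V : Fin n → SA n} (H : Sys l0 h V)
    (x : Euc n) (hx : x ∈ HS l0) (i : Fin n) :
    ∑ k, ev x (D k (D k (V i))) + (1 - 2 / n) * ev x (D i (T0 V))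
      - 2 * n * eW x * (∑ k, x k * ev x (D i (V k)) + ∑ k, x k * ev x (D k (V i))
         - 2 / n * x i * ev x (T0 V))
     = ∑ k, (ev x (D k (h i k)) - 2 * n * eW x * (x k * ev x (h i k))) := by
  have h1 := H.eqn x hx i
  have hw := (ev_w_pos x).ne'
  have e : ∀ k, ev x (D k (w n ^ n * (h i k - Sf V i k))) = eW x ^ n *
     ((ev x (D k (h i k)) - 2 * n * eW x * (x k * ev x (h i k)))
      - (ev x (D k (D k (V i))) + ev x (D i (D k (V k))) - (if i = k then 2 / n * ev x (D k (T0 V)) else 0)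
        - 2 * n * eW x * (x k * ev x (D i (V k)) + x k * ev x (D k (V i))
          - (if i = k then 2 / n * (x k * ev x (T0 V)) else 0)))) := by
    intro k
    rw [D_mul, map_add, map_mul, map_mul, ev_D_wp, map_pow]
    simp only [Sf, map_sub, map_add]
    rw [D_comm k i]
    split_ifs with hik
    · subst hik; simp only [D_smul, ev_smul]; ring
    · simp only [map_zero]; ring
  simp only [e] at h1
  rw [← mul_sum] at h1
  have h2 := (mul_eq_zero.1 h1).resolve_left (pow_ne_zero _ hw)
  rw [sum_sub_distrib] at h2
  rw [sub_eq_zero.1 h2]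
  simp only [sum_sub_distrib, sum_add_distrib, ← mul_sum, Fintype.sum_ite_eq]
  rw [ev_D_T0, ← ev_D_T0]
  ring
lemma ev_D_Tf (x : Euc n) (V : Fin n → SA n) (i : Fin n) : ev x (D i (Tf V)) =
    ev x (D i (T0 V)) - 2 * n * (eW x * (ev x (V i) + ∑ k, x k * ev x (D i (V k)))
      - 2 * eW x ^ 2 * x i * ev x (xv V)) := by
  simp only [Tf, map_sub, D_smul, D_mul, ev_smul, map_add, map_mul, ev_D_xv, ev_D_w]
  ring
lemma dv_Gf (l0 : Fin n) (h : Fin n → Fin n → SA n) (V : Fin n → SA n) (p : ℕ) (hp : p + 2 = n)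
    (x : Euc n) (i : Fin n) :
    ∑ k, ev x (D k (Gf l0 h V p k i)) = eW x ^ p * (
      (∑ k, ev x (D k (D k (V i))) - ev x (D i (T0 V)) - 2 * ((n:ℝ)-2) * eW x *
        (∑ k, x k * ev x (D k (V i)) - ∑ k, x k * ev x (D i (V k))))
      - 4 * eW x * ((n - 1) * ev x (V i) + ∑ k, x k * ev x (D k (V i)) - x i * ev x (T0 V)
         - 2 * ((n:ℝ) - 1) * eW x * ((∑ k, x k * x k) * ev x (V i) - x i * ev x (xv V)))
      - ((ev x (D l0 (h i l0)) - 2 * ((n:ℝ) - 2) * eW x * (x l0 * ev x (h i l0)))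
        - if i = l0 then ∑ k, (ev x (D k (h k l0)) - 2 * ((n:ℝ) - 2) * eW x * (x k * ev x (h k l0))) else 0)) := by
  have hp' : (p:ℝ) = n - 2 := by rw [← hp]; push_cast; ring
  have e : ∀ k, ev x (D k (Gf l0 h V p k i)) = eW x ^ p * (
     (ev x (D k (D k (V i))) - ev x (D i (D k (V k))) - 2 * ((n:ℝ)-2) * eW x *
        (x k * ev x (D k (V i)) - x k * ev x (D i (V k))))
      - 4 * eW x * ((ev x (V i) - (if k = i then ev x (V k) else 0)) + x k * ev x (D k (V i)) - x i * ev x (D k (V k))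
         - 2 * ((n:ℝ) - 1) * eW x * ((x k * x k) * ev x (V i) - x i * (x k * ev x (V k))))
      - ((if k = l0 then (ev x (D k (h i l0)) - 2 * ((n:ℝ) - 2) * eW x * (x k * ev x (h i l0))) else 0)
        - if i = l0 then (ev x (D k (h k l0)) - 2 * ((n:ℝ) - 2) * eW x * (x k * ev x (h k l0))) else 0)) := by
    intro k
    simp only [Gf, map_sub, D_mul, D_smul, ev_smul, map_add, map_mul, ev_D_wp, map_pow, D_X, ev_X]
    rw [D_comm k i]
    push_cast
    rw [hp']
    simp only [apply_ite (D k), apply_ite (ev x), map_zero, map_one, if_true]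
    split_ifs <;> subst_vars <;> ring
  simp only [e]
  rw [← mul_sum]
  congr 1
  simp only [sum_sub_distrib, sum_add_distrib, ← mul_sum, Fintype.sum_ite_eq', ← sum_mul]
  rw [ev_D_T0, ev_T0, ev_xv]
  by_cases hi : i = l0
  · simp [hi, sum_sub_distrib, mul_sum]; left; ring
  · simp [hi]; left; ring
lemma gid {l0 : Fin n} {h : Fin n → Fin n → SA n} {V : Fin n → SA n} (H : Sys l0 h V)
    (p : ℕ) (hp : p + 2 = n) (x : Euc n) (hx : x ∈ HS l0) (i : Fin n) :
    ∑ k, ev x (D k (Gf l0 h V p k i)) = eW x ^ p * (zz l0 h x i - (2 - 2 / n) * ev x (D i (Tf V))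
      - 8 * ((n:ℝ) - 1) * eW x ^ 2 * ev x (V i)) := by
  have hn : 0 < n := by omega
  have hn' : (n:ℝ) ≠ 0 := by positivity
  rw [dv_Gf l0 h V p hp, ev_D_Tf]
  unfold zz
  rw [← eqn_lame hn H x hx i]
  congr 1
  have hw := ev_w_mul x
  have hr : eW x * ∑ i, x i * x i = 1 - eW x := by linarith
  generalize (if i = l0 then ∑ k, (ev x (D k (h k l0)) - 2 * ((n:ℝ) - 2) * eW x * (x k * ev x (h k l0))) else 0) = Q
  generalize ∑ k, x k * x k = r at *
  field_simp
  linear_combination (8 * (n:ℝ) * (n-1) * ev x (V i) * eW x) * hr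
def psf (V : Fin n → SA n) (q : SA n) : SA n := w n * (q * Tf V)
def fld1 (l0 : Fin n) (h : Fin n → Fin n → SA n) (V : Fin n → SA n) (q : SA n) (p : ℕ) (k : Fin n) : SA n :=
  - (∑ i, Gf l0 h V p k i * D i (psf V q))
   - ((2 - 2 / (n:ℝ)) * ((n - 2) / 2)) • ((w n ^ (p+2) * (q * (Tf V * Tf V))) * X k)
   + ((2 - 2 / (n:ℝ)) * ((n - 2) / 2) * (2 * n)) • ((w n ^ (p + 2) * psf V q) * V k)
lemma fld1_bdry {l0 : Fin n} {h : Fin n → Fin n → SA n} {V : Fin n → SA n} (H : Sys l0 h V)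
    (q : SA n) (p : ℕ) (x : Euc n) (hx : x l0 = 0) : ev x (fld1 l0 h V q p l0) = 0 := by
  unfold fld1
  rw [map_add, map_sub, map_neg, map_sum]
  simp [Gf_bdry H p x hx, H.b1 x hx, ev_X, hx]
lemma dv_anti (G : Fin n → Fin n → SA n) (hG : ∀ i k, G k i = - G i k) (ψ : SA n) (x : Euc n) :
    dv x (fun k => ∑ i, G k i * D i ψ) = ∑ i, ev x (D i ψ) * ∑ k, ev x (D k (G k i)) := by
  unfold dv
  simp only [map_sum, D_mul, map_add, map_mul, sum_add_distrib]
  have h0 : ∑ k, ∑ i, ev x (G k i) * ev x (D k (D i ψ)) = 0 := by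
    have : ∑ k, ∑ i, ev x (G k i) * ev x (D k (D i ψ)) = - ∑ k, ∑ i, ev x (G k i) * ev x (D k (D i ψ)) := by
      conv_lhs => rw [sum_comm]
      rw [← sum_neg_distrib]
      refine sum_congr rfl fun i _ => ?_
      rw [← sum_neg_distrib]
      refine sum_congr rfl fun k _ => ?_
      rw [hG, D_comm, map_neg]; ring
    linarith
  rw [h0, add_zero, sum_comm]
  refine sum_congr rfl fun i _ => ?_
  rw [mul_sum]
  exact sum_congr rfl fun k _ => mul_comm _ _
lemma ev_D_psf (x : Euc n) (V : Fin n → SA n) (φ η : SA n) (m : ℝ)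
    (hφ : ∀ i, ev x (D i φ) = m * eW x * x i * ev x φ) (i : Fin n) :
    ev x (D i (psf V (φ * (η * η)))) = ev x φ * eW x * (ev x η * (ev x η * ev x (D i (Tf V))
      + (m - 2) * eW x * ev x η * ev x (Tf V) * x i + 2 * ev x (Tf V) * ev x (D i η))) := by
  unfold psf
  rw [D_mul, D_mul i (φ * (η * η))]
  simp only [map_add, map_mul, ev_D_q x φ η m hφ, ev_D_w]; ring
set_option maxHeartbeats 1000000 in
lemma scal1_ineq (n ω r N τ gT gx m η T G q Q Y V2 Z : ℝ) (hn : 6 ≤ n) (hω0 : 0 < ω)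
    (hω : ω * (1 + r) = 1) (hr : 0 ≤ r) (hm0 : 0 ≤ m) (hm : m ≤ n - 3) (hN : 0 ≤ N) (hG : 0 ≤ G)
    (hV : 0 ≤ V2) (hZ : 0 ≤ Z)
    (f1 : τ ^ 2 ≤ r * N) (f2 : gT^2 ≤ G * N) (f3 : gx ^2 ≤ G * r) (f4 : q ^ 2 ≤ Q * Y)
    (hQ0 : 0 ≤ Q) (hY0 : 0 ≤ Y)
    (hQ : Q ≤ 3 * (η^2 * N + ((m-2) * ω * η * T)^2 * r + 4 * T^2 * G))
    (hY : Y ≤ 2 * ((2*(n-1)*(n+2)*ω^2)^2 * V2 + Z)) :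
    1/16 * (η^2 * (ω * T^2)) ≤
      (2 - 2/n) * (η^2 * N + (m - 2) * ω * η^2 * T * τ + 2 * η * T * gT)
      - (2 - 2/n) * ((n-2)/2) * (ω * (η^2 * (2 * T * τ + T^2 * (n + (m - 2 * n) * (ω * r))) + 2 * η * gx * T^2))
      + (2 - 2/n) * ((n-2)/2) * (2 * n) * (ω^2 * η^2 * T^2) + η * q
      + 2000 * n^6 * (η^2 * (ω^2 * (ω^2 * V2)) + η^2 * Z + G * T^2) := by
  have hr1 : ω * r = 1 - ω := by linarith
  have hωr : ω * r ≤ 1 := by linarith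
  have hωr0 : 0 ≤ ω * r := by positivity
  have hn0 : 0 < n := by linarith
  set c := 2 - 2/n with hc
  have hc1 : 5/3 ≤ c := by
    have : 2 / n ≤ 1/3 := by rw [div_le_div_iff₀ hn0 (by norm_num)]; linarith
    linarith
  have hc2 : c ≤ 2 := by
    have : 0 ≤ 2/n := by positivity
    linarith
  clear_value c
  set t := ω * T^2 with ht
  have ht0 : 0 ≤ t := by positivity
  set κ := n - m with hκ
  have hm' : m = n - κ := by rw [hκ]; ring
  have hκ3 : 3 ≤ κ := by linarith
  have hκn : κ ≤ n := by linarith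
  have t1 : |κ * (ω * T * τ)| ≤ 7/8 * N + 2/7 * (κ^2 * t) := by
    apply amgm _ hN (by positivity) (by norm_num) (by norm_num)
    calc (κ * (ω * T * τ))^2 = κ^2 * (ω^2 * T^2) * τ^2 := by ring
      _ ≤ κ^2 * (ω^2 * T^2) * (r * N) := by gcongr
      _ = N * (κ^2 * t) * (ω * r) := by rw [ht]; ring
      _ ≤ N * (κ^2 * t) * 1 := by gcongr
      _ = _ := by ring
  have t1' := (abs_le.1 t1).2
  have t1'' : 1/8 * N + 1/8 * t ≤ N - κ * (ω * T * τ) + (n-2)/2 * κ * t := by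
    have : 2/7 * κ^2 * t + 1/8 * t ≤ (n-2)/2 * κ * t := by
      have h7 : 2/7 * κ^2 + 1/8 ≤ (n-2)/2 * κ := by nlinarith only [hκ3, hκn, hn]
      nlinarith only [h7, ht0]
    linarith
  have t2 : |T * (η * gT)| ≤ 1/64 * (η^2 * N) + 16 * (T^2 * G) := by
    apply amgm _ (by positivity) (by positivity) (by norm_num) (by norm_num)
    calc (T * (η * gT))^2 = η^2 * T^2 * gT^2 := by ring
      _ ≤ η^2 * T^2 * (G * N) := by gcongr
      _ = _ := by ring
  have t3 : |n * (ω * (η * gx * T^2))| ≤ 1/64 * (η^2 * t) + 16 * (n^2 * (T^2 * G)) := by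
    apply amgm _ (by positivity) (by positivity) (by norm_num) (by norm_num)
    calc (n * (ω * (η * gx * T^2)))^2 = n^2 * ω^2 * η^2 * T^4 * gx^2 := by ring
      _ ≤ n^2 * ω^2 * η^2 * T^4 * (G * r) := by gcongr
      _ = η^2 * t * (n^2 * (T^2 * G)) * (ω * r) := by rw [ht]; ring
      _ ≤ η^2 * t * (n^2 * (T^2 * G)) * 1 := by gcongr
      _ = _ := by ring
  have t4 : |η * q| ≤ 1/(100 * n^2) * Q + 25 * n^2 * (η^2 * Y) := by
    apply amgm _ hQ0 (by positivity) (by positivity) (by field_simp; norm_num)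
    calc (η * q)^2 = η^2 * q^2 := by ring
      _ ≤ η^2 * (Q * Y) := by gcongr
      _ = _ := by ring
  have q1 : ((m-2) * ω * η * T)^2 * r ≤ n^2 * (η^2 * t) := by
    have e : ((m-2) * ω * η * T)^2 * r = (m-2)^2 * ((ω * r) * (η^2 * t)) := by rw [ht]; ring
    have : (m-2)^2 ≤ n^2 := by nlinarith only [hm, hm0, hn]
    rw [e]
    have h3 : (ω * r) * (η^2 * t) ≤ 1 * (η^2 * t) := by gcongr
    calc (m-2)^2 * ((ω * r) * (η^2 * t)) ≤ n^2 * ((ω * r) * (η^2 * t)) := by gcongr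
      _ ≤ n^2 * (1 * (η^2 * t)) := by gcongr
      _ = _ := by ring
  have q2 : 1/(100 * n^2) * Q ≤ 3/100 * (η^2 * N) + 3/100 * (η^2 * t) + (T^2 * G) := by
    have a1 : Q ≤ 3 * (n^2 * (η^2 * N) + n^2 * (η^2 * t) + n^2 * (4 * T^2 * G)) := by
      have : 1 ≤ n^2 := by nlinarith only [hn]
      have b1 : η^2 * N ≤ n^2 * (η^2 * N) := le_mul_of_one_le_left (by positivity) this
      have b2 : 4 * T^2 * G ≤ n^2 * (4 * T^2 * G) := le_mul_of_one_le_left (by positivity) this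
      linarith
    have : 0 < n^2 := by positivity
    rw [div_mul_eq_mul_div, one_mul, div_le_iff₀ (by positivity)]
    have b3 : 0 ≤ n^2 * (T^2 * G) := by positivity
    linarith only [a1, b3]
  have q3 : η^2 * Y ≤ 32 * n^4 * (η^2 * (ω^2 * (ω^2 * V2))) + 2 * (η^2 * Z) := by
    have : (2*(n-1)*(n+2))^2 ≤ (4 * n^2)^2 := by
      exact pow_le_pow_left₀ (by nlinarith only [hn]) (by nlinarith only [hn]) 2
    calc η^2 * Y ≤ η^2 * (2 * ((2*(n-1)*(n+2)*ω^2)^2 * V2 + Z)) := by gcongr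
      _ = 2 * ((2*(n-1)*(n+2))^2 * (η^2 * (ω^2 * (ω^2 * V2)))) + 2 * (η^2 * Z) := by ring
      _ ≤ 2 * ((4 * n^2)^2 * (η^2 * (ω^2 * (ω^2 * V2)))) + 2 * (η^2 * Z) := by gcongr
      _ = _ := by ring
  have t2' := (abs_le.1 t2).1
  have t3' := (abs_le.1 t3).2
  have t4' := (abs_le.1 t4).1
  have hn2 : 36 ≤ n^2 := by nlinarith only [hn]
  have hn4 : n^2 * 36 ≤ n^4 := by nlinarith only [hn2]
  have hn6 : n^4 * 36 ≤ n^6 := by nlinarith only [pow_pos hn0 4, hn2]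
  set v := η^2 * (ω^2 * (ω^2 * V2)) with hv
  have hv0 : 0 ≤ v := by positivity
  have hz0 : 0 ≤ η^2 * Z := by positivity
  have hTG0 : 0 ≤ T^2 * G := by positivity
  have q4 : 25 * n^2 * (η^2 * Y) ≤ 800 * n^6 * v + 50 * n^2 * (η^2 * Z) := by
    calc 25 * n^2 * (η^2 * Y) ≤ 25 * n^2 * (32 * n^4 * v + 2 * (η^2 * Z)) := by gcongr
      _ = _ := by ring
  have u1 : 50 * n^2 * (η^2 * Z) ≤ 2000 * n^6 * (η^2 * Z) := by gcongr ?_ * _; nlinarith only [hn2, hn4, hn6]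
  have u2 : 800 * n^6 * v ≤ 2000 * n^6 * v := by gcongr ?_ * _; nlinarith only [hn2, hn4, hn6]
  have u3 : (64 + 40 * n^2 + 1) * (T^2 * G) ≤ 2000 * n^6 * (T^2 * G) := by gcongr ?_ * _; nlinarith only [hn2, hn4, hn6]
  have id1 : (c) * (η^2 * N + (m - 2) * ω * η^2 * T * τ + 2 * η * T * gT)
      - (c) * ((n-2)/2) * (ω * (η^2 * (2 * T * τ + T^2 * (n + (m - 2 * n) * (ω * r))) + 2 * η * gx * T^2))
      + (c) * ((n-2)/2) * (2 * n) * (ω^2 * η^2 * T^2)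
     = c * (η^2 * (N - κ * (ω * T * τ) + (n-2)/2 * κ * t) + 2 * (T * (η * gT)) + (n-2)/2 * m * (ω^2 * η^2 * T^2)
        - (n - 2) * (ω * (η * gx * T^2))) := by
    rw [hr1, ht, hm']; ring
  have u4 : (n - 2) * (ω * (η * gx * T^2)) ≤ 1/64 * (η^2 * t) + 16 * (n^2 * (T^2 * G)) := by
    by_cases hs : 0 ≤ ω * (η * gx * T^2)
    · nlinarith only [hs, t3']
    · have : 0 ≤ 1/64 * (η^2 * t) + 16 * (n^2 * (T^2 * G)) := by positivity
      nlinarith only [hs, this, hn]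
  have u5 : 0 ≤ (n-2)/2 * m * (ω^2 * η^2 * T^2) := by
    have : 0 ≤ n - 2 := by linarith
    positivity
  have u6 : η^2 * (1/8 * N + 1/8 * t) ≤ η^2 * (N - κ * (ω * T * τ) + (n-2)/2 * κ * t) := by gcongr
  have u7 : 3/32 * (η^2 * N) + 7/64 * (η^2 * t) - 32 * (T^2 * G) - 16 * (n^2 * (T^2 * G)) ≤
     (η^2 * (N - κ * (ω * T * τ) + (n-2)/2 * κ * t) + 2 * (T * (η * gT)) + (n-2)/2 * m * (ω^2 * η^2 * T^2)
        - (n - 2) * (ω * (η * gx * T^2))) := by linarith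
  have u8 : 5/3 * (3/32 * (η^2 * N) + 7/64 * (η^2 * t)) - 2 * (32 * (T^2 * G) + 16 * (n^2 * (T^2 * G))) ≤
     c * (η^2 * (N - κ * (ω * T * τ) + (n-2)/2 * κ * t) + 2 * (T * (η * gT)) + (n-2)/2 * m * (ω^2 * η^2 * T^2)
        - (n - 2) * (ω * (η * gx * T^2))) := by
    have a1 := mnL u7 (show 0 ≤ c by linarith)
    have a2 : 0 ≤ 3/32 * (η^2 * N) + 7/64 * (η^2 * t) := by positivity
    have a3 : 0 ≤ 32 * (T^2 * G) + 16 * (n^2 * (T^2 * G)) := by positivity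
    have a4 := mnR hc1 a2
    have a5 := mnR hc2 a3
    linarith
  rw [id1]
  have hN0 : 0 ≤ η^2 * N := by positivity
  have ht0' : 0 ≤ η^2 * t := by positivity
  have t5 := (neg_le_neg (add_le_add q2 q4)).trans t4'
  have h9 : 0 ≤ n^2 * (T^2 * G) := by positivity
  generalize c * (η^2 * (N - κ * (ω * T * τ) + (n-2)/2 * κ * t) + 2 * (T * (η * gT)) + (n-2)/2 * m * (ω^2 * η^2 * T^2)
        - (n - 2) * (ω * (η * gx * T^2))) = B at *
  linarith only [u8, t5, u1, u2, u3, hN0, ht0', hTG0, h9]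
lemma sum3_sq (a b c : Fin n → ℝ) : ∑ i, (a i + b i + c i) * (a i + b i + c i) ≤
    3 * (∑ i, a i * a i + ∑ i, b i * b i + ∑ i, c i * c i) := by
  rw [← sum_add_distrib, ← sum_add_distrib, mul_sum]
  refine sum_le_sum fun i _ => ?_
  nlinarith [sq_nonneg (a i - b i), sq_nonneg (a i - c i), sq_nonneg (b i - c i)]
lemma sum2_sq (a b : Fin n → ℝ) : ∑ i, (a i - b i) * (a i - b i) ≤
    2 * (∑ i, a i * a i + ∑ i, b i * b i) := by
  rw [← sum_add_distrib, mul_sum]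
  refine sum_le_sum fun i _ => ?_
  nlinarith [sq_nonneg (a i + b i)]
lemma step1_pt (hn : 6 ≤ n) {l0 : Fin n} {h : Fin n → Fin n → SA n} {V : Fin n → SA n}
    (H : Sys l0 h V) (p : ℕ) (hp : p + 2 = n) (x : Euc n) (hx : x ∈ HS l0) (φ η : SA n) (m : ℝ)
    (hφ : ∀ i, ev x (D i φ) = m * eW x * x i * ev x φ) (hφ0 : 0 ≤ ev x φ)
    (hm0 : 0 ≤ m) (hm : m ≤ n - 3) :
    eW x ^ (p+1) * ev x φ * (1/16 * (ev x η ^ 2 * (eW x * ev x (Tf V) ^ 2))) ≤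
     eW x ^ (p+1) * ev x φ * (2000 * n^6 * (ev x η ^ 2 * (eW x ^ 2 * (eW x ^ 2 * ev x (V2 V)))
        + ev x η ^2 * (∑ i, zz l0 h x i * zz l0 h x i)
        + g2 x η * ev x (Tf V) ^ 2))
     + dv x (fld1 l0 h V (φ * (η * η)) p) := by
  have hn' : (6:ℝ) ≤ n := by exact_mod_cast hn
  have hp' : (p:ℝ) = n - 2 := by rw [← hp]; push_cast; ring
  set ω := eW x with hω
  set T := ev x (Tf V) with hT
  set e : Fin n → ℝ := fun i => ev x η * ev x (D i (Tf V)) + (m - 2) * ω * ev x η * T * x i + 2 * T * ev x (D i η) with he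
  set y : Fin n → ℝ := fun i => 2 * ((n:ℝ)-1) * (n+2) * ω^2 * ev x (V i) - zz l0 h x i with hy
  have hin := scal1_ineq n ω (∑ i, x i * x i) (g2 x (Tf V)) (∑ i, x i * ev x (D i (Tf V)))
    (∑ i, ev x (D i η) * ev x (D i (Tf V))) (∑ i, ev x (D i η) * x i) m (ev x η) T (g2 x η)
    (∑ i, e i * y i) (∑ i, e i * e i) (∑ i, y i * y i) (ev x (V2 V)) (∑ i, zz l0 h x i * zz l0 h x i)
    hn' (ev_w_pos x) (ev_w_mul x) (sum_nonneg fun i _ => mul_self_nonneg _) hm0 hm (g2_nonneg _ _) (g2_nonneg _ _)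
    (V2_nonneg _ _) (sum_nonneg fun i _ => mul_self_nonneg _) (cs1 _ _) (cs1 _ _) (cs1 _ _) (cs1 _ _)
    (sum_nonneg fun i _ => mul_self_nonneg _) (sum_nonneg fun i _ => mul_self_nonneg _)
    (by
      refine (sum3_sq _ _ _).trans (le_of_eq ?_)
      congr 1; unfold g2
      congr 1
      · congr 1
        · rw [mul_sum]; exact sum_congr rfl fun i _ => by ring
        · rw [mul_sum]; exact sum_congr rfl fun i _ => by ring
      · rw [mul_sum]; exact sum_congr rfl fun i _ => by ring)
    (by
      refine (sum2_sq _ _).trans (le_of_eq ?_)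
      rw [ev_V2, mul_sum]
      congr 2
      exact sum_congr rfl fun i _ => by ring)
  have hψ := ev_D_psf x V φ η m hφ
  refine step2_aux ((mul_nonneg (pow_nonneg (ev_w_pos x).le _) hφ0)) ?_ rfl hin
  have d1 : dv x (fun k => ∑ i, Gf l0 h V p k i * D i (psf V (φ * (η * η)))) =
      ω^(p+1) * ev x φ * (ev x η * ∑ i, e i * (zz l0 h x i - (2 - 2 / n) * ev x (D i (Tf V))
      - 8 * ((n:ℝ) - 1) * ω ^ 2 * ev x (V i))) := by
    rw [dv_anti _ (fun i k => Gf_anti _ _ _ _ _ _), mul_sum, mul_sum]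
    refine sum_congr rfl fun i _ => ?_
    rw [gid H p hp x hx, hψ, ← hω]
    simp only [e, ← hT]; ring
  have d2 : dv x (fun k => (w n ^ (p+2) * ((φ * (η * η)) * (Tf V * Tf V))) * X k) =
      ω^(p+1) * ev x φ * (ω * (ev x η ^2 * (2 * T * (∑ i, x i * ev x (D i (Tf V))) + T^2 * (n + (m - 2 * n) * (ω * ∑ i, x i * x i))) + 2 * ev x η * (∑ i, ev x (D i η) * x i) * T^2)) := by
    rw [dv_mul, dv_X]
    have : ∀ i, ev x (D i (w n ^ (p+2) * ((φ * (η * η)) * (Tf V * Tf V)))) * ev x (X i) =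
      ω^(p+2) * ev x φ * (ev x η ^ 2 * (2 * T * (x i * ev x (D i (Tf V))) + T^2 * ((m - 2 * n) * ω * (x i * x i))) + 2 * ev x η * (ev x (D i η) * x i) * T^2) := by
      intro i
      rw [D_mul, D_mul i (φ * (η * η)), D_mul i (Tf V)]
      simp only [map_add, map_mul, ev_D_q x φ η m hφ, ev_D_wp, map_pow, ev_X, ← hω, ← hT]
      push_cast; rw [hp']; ring
    simp only [this]
    simp only [← mul_sum, sum_add_distrib, ← sum_mul]
    simp only [map_mul, map_pow, ← hω, ← hT]
    ring
  have d3 : dv x (fun k => (w n ^ (p + 2) * psf V (φ * (η * η))) * V k) =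
      ω^(p+1) * ev x φ * (ω^2 * ev x η ^2 * T^2 + ω^2 * ev x η * ∑ i, e i * ev x (V i)) := by
    rw [dv_mul, dv_V]
    have : ∀ i, ev x (D i (w n ^ (p+2) * psf V (φ * (η * η)))) * ev x (V i) =
      ω^(p+1) * ev x φ * (ω ^ 2 * ev x η * (e i * ev x (V i))
        - 2 * n * ω^3 * ev x η ^ 2 * T * (x i * ev x (V i))) := by
      intro i
      rw [D_mul, map_add, map_mul, map_mul, hψ]
      simp only [map_mul, ev_D_wp, map_pow, psf, e, ← hω, ← hT]
      push_cast; rw [hp']; ring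
    simp only [this]
    simp only [← mul_sum, sum_sub_distrib]
    rw [← ev_xv]
    simp only [psf, map_mul, map_pow, ← hω, ← hT]
    rw [hT, ev_Tf]; ring
  have hfl : dv x (fld1 l0 h V (φ * (η * η)) p) = 
    - dv x (fun k => ∑ i, Gf l0 h V p k i * D i (psf V (φ * (η * η))))
    - ((2 - 2 / (n:ℝ)) * ((n - 2) / 2)) * dv x (fun k => (w n ^ (p+2) * ((φ * (η * η)) * (Tf V * Tf V))) * X k)
    + ((2 - 2 / (n:ℝ)) * ((n - 2) / 2) * (2 * n)) * dv x (fun k => (w n ^ (p + 2) * psf V (φ * (η * η))) * V k) := by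
    unfold fld1
    rw [dv_add x (fun k => - (∑ i, Gf l0 h V p k i * D i (psf V (φ * (η * η)))) - ((2 - 2 / (n:ℝ)) * ((n - 2) / 2)) • ((w n ^ (p+2) * ((φ * (η * η)) * (Tf V * Tf V))) * X k)),
      dv_sub x (fun k => - (∑ i, Gf l0 h V p k i * D i (psf V (φ * (η * η))))), dv_neg, dv_smul, dv_smul]
  rw [hfl, d1, d2, d3]
  have s1 : ∑ i, e i * ev x (D i (Tf V)) = ev x η * g2 x (Tf V) + (m - 2) * ω * ev x η * T * (∑ i, x i * ev x (D i (Tf V)))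
     + 2 * T * ∑ i, ev x (D i η) * ev x (D i (Tf V)) := by
    unfold g2
    simp only [mul_sum, ← sum_add_distrib, e]
    exact sum_congr rfl fun i _ => by ring
  have s2 : ∑ i, e i * y i = 2 * ((n:ℝ)-1) * (n+2) * ω^2 * (∑ i, e i * ev x (V i)) - ∑ i, e i * zz l0 h x i := by
    simp only [mul_sum, ← sum_sub_distrib, y]
    exact sum_congr rfl fun i _ => by ring
  have s3 : ∑ i, e i * (zz l0 h x i - (2 - 2 / n) * ev x (D i (Tf V)) - 8 * ((n:ℝ) - 1) * ω ^ 2 * ev x (V i)) =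
     (∑ i, e i * zz l0 h x i) - (2 - 2 / n) * (∑ i, e i * ev x (D i (Tf V))) - 8 * ((n:ℝ) - 1) * ω ^ 2 * (∑ i, e i * ev x (V i)) := by
    simp only [mul_sum, ← sum_sub_distrib]
    exact sum_congr rfl fun i _ => by ring
  rw [s3, s1, s2]
  generalize ∑ i, e i * ev x (V i) = Q1
  generalize ∑ i, e i * zz l0 h x i = Q2
  have hn0 : (n:ℝ) ≠ 0 := by linarith
  field_simp
  ring
end
section
open Finset
def lam (x : Euc n) : ℝ := √(eS x)
lemma lam_sq (x : Euc n) : lam x ^ 2 = eS x := Real.sq_sqrt (by linarith [ev_sq_pos x])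
lemma one_le_lam (x : Euc n) : 1 ≤ lam x := Real.one_le_sqrt.2 (ev_sq_pos x)
lemma lam_pos (x : Euc n) : 0 < lam x := by linarith [one_le_lam x]
lemma w_lam (x : Euc n) : eW x = lam x ^ (-2:ℤ) := by
  rw [ev_w, ← lam_sq]; rw [zpow_neg]; rfl
lemma norm_le_lam (x : Euc n) : ‖x‖ ≤ lam x := by
  apply Real.le_sqrt_of_sq_le; rw [ev_sq']; linarith
lemma coord_le_lam (x : Euc n) (i : Fin n) : |x i| ≤ lam x :=
  (abs_coord_le x i).trans (norm_le_lam x)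
def J : ℕ → SA n → Euc n → ℝ
  | 0, f, x => |ev x f|
  | k+1, f, x => |ev x f| + lam x * ∑ i, J k (D i f) x
lemma J_nonneg (k : ℕ) : ∀ (f : SA n) (x : Euc n), 0 ≤ J k f x := by
  induction k with
  | zero => intro f x; exact abs_nonneg _
  | succ k ih =>
    intro f x
    exact add_nonneg (abs_nonneg _) (mul_nonneg (lam_pos x).le (sum_nonneg fun i _ => ih _ _))
lemma J_mono (k : ℕ) : ∀ (f : SA n) (x : Euc n), J k f x ≤ J (k+1) f x := by
  induction k with
  | zero =>
    intro f x
    have : 0 ≤ lam x * ∑ i, J 0 (D i f) x := mul_nonneg (lam_pos x).le (sum_nonneg fun i _ => J_nonneg _ _ _)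
    simp only [J] at *; linarith
  | succ k ih =>
    intro f x
    show |ev x f| + lam x * ∑ i, J k (D i f) x ≤ |ev x f| + lam x * ∑ i, J (k+1) (D i f) x
    gcongr with i
    · exact (lam_pos x).le
    · exact ih _ _
lemma J_mono' {k l : ℕ} (h : k ≤ l) (f : SA n) (x : Euc n) : J k f x ≤ J l f x :=
  monotone_nat_of_le_succ (f := fun k => J k f x) (fun k => J_mono k f x) h
lemma J_add (k : ℕ) : ∀ (f g : SA n) (x : Euc n), J k (f + g) x ≤ J k f x + J k g x := by
  induction k with
  | zero => intro f g x; simp only [J, map_add]; exact abs_add_le _ _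
  | succ k ih =>
    intro f g x
    simp only [J, map_add]
    have h1 : ∑ i, J k (D i f + D i g) x ≤ ∑ i, J k (D i f) x + ∑ i, J k (D i g) x := by
      rw [← sum_add_distrib]; exact sum_le_sum fun i _ => ih _ _ _
    have h2 := mnL h1 (lam_pos x).le
    have h3 := abs_add_le (ev x f) (ev x g)
    linarith
lemma J_smul (k : ℕ) : ∀ (c : ℝ) (f : SA n) (x : Euc n), J k (c • f) x = |c| * J k f x := by
  induction k with
  | zero => intro c f x; simp only [J, ev_smul, abs_mul]
  | succ k ih =>
    intro c f x
    simp only [J, ev_smul, abs_mul, D_smul, ih, ← mul_sum]; ring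
lemma J_neg (k : ℕ) (f : SA n) (x : Euc n) : J k (-f) x = J k f x := by
  have := J_smul k (-1) f x
  simpa using this
lemma J_sub (k : ℕ) (f g : SA n) (x : Euc n) : J k (f - g) x ≤ J k f x + J k g x := by
  rw [sub_eq_add_neg, ← J_neg k g]; exact J_add _ _ _ _
lemma J_zero (k : ℕ) (x : Euc n) : J k (0 : SA n) x = 0 := by
  have := J_smul k 0 (0 : SA n) x
  simpa using this
lemma J_sum {ι : Type*} (k : ℕ) (s : Finset ι) (f : ι → SA n) (x : Euc n) :
    J k (∑ i ∈ s, f i) x ≤ ∑ i ∈ s, J k (f i) x := by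
  classical
  induction s using Finset.induction_on with
  | empty => simp [J_zero]
  | insert a s ha ih =>
    rw [sum_insert ha, sum_insert ha]
    exact (J_add _ _ _ _).trans (by linarith)
lemma abs_le_J (k : ℕ) (f : SA n) (x : Euc n) : |ev x f| ≤ J k f x := J_mono' (Nat.zero_le k) f x
lemma J_D (k : ℕ) (f : SA n) (x : Euc n) (i : Fin n) : lam x * J k (D i f) x ≤ J (k+1) f x := by
  have h1 : J k (D i f) x ≤ ∑ i, J k (D i f) x :=
    single_le_sum (f := fun i => J k (D i f) x) (fun i _ => J_nonneg _ _ _) (mem_univ i)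
  have := mnL h1 (lam_pos x).le
  have h2 := abs_nonneg (ev x f)
  show _ ≤ |ev x f| + lam x * ∑ i, J k (D i f) x
  linarith
lemma J_DL (L : List (Fin n)) : ∀ (k : ℕ) (f : SA n) (x : Euc n),
    lam x ^ L.length * J k (DL L f) x ≤ J (k + L.length) f x := by
  induction L with
  | nil => intro k f x; simp [DL]
  | cons i t ih =>
    intro k f x
    have h1 := J_D k (DL t f) x i
    have h2 := ih (k+1) f x
    have h3 := mnL h1 (pow_pos (lam_pos x) t.length).le
    simp only [List.length_cons, DL, pow_succ]
    rw [show k + (t.length + 1) = k + 1 + t.length by ring]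
    linarith
lemma J_mul (k : ℕ) : ∀ (f g : SA n) (x : Euc n), J k (f * g) x ≤ 3 ^ k * (J k f x * J k g x) := by
  induction k with
  | zero => intro f g x; simp only [J, map_mul, abs_mul]; simp
  | succ k ih =>
    intro f g x
    simp only [J, map_mul, abs_mul, D_mul]
    set a := |ev x f|
    set b := |ev x g|
    have hl := (lam_pos x).le
    set A := lam x * ∑ i, J k (D i f) x with hA
    set B := lam x * ∑ i, J k (D i g) x with hB
    have ha : 0 ≤ a := abs_nonneg _
    have hb : 0 ≤ b := abs_nonneg _
    have hA0 : 0 ≤ A := mul_nonneg hl (sum_nonneg fun i _ => J_nonneg _ _ _)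
    have hB0 : 0 ≤ B := mul_nonneg hl (sum_nonneg fun i _ => J_nonneg _ _ _)
    have hf : J k f x ≤ a + A := J_mono k f x
    have hg : J k g x ≤ b + B := J_mono k g x
    have e1 : lam x * ∑ i, J k (D i f * g + f * D i g) x ≤ 3^k * (A * J k g x + J k f x * B) := by
      have : ∑ i, J k (D i f * g + f * D i g) x ≤
        ∑ i, (3^k * (J k (D i f) x * J k g x) + 3^k * (J k f x * J k (D i g) x)) :=
        sum_le_sum fun i _ => (J_add _ _ _ _).trans (add_le_add (ih _ _ _) (ih _ _ _))
      refine (mnL this hl).trans (le_of_eq ?_)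
      rw [sum_add_distrib, ← mul_sum, ← mul_sum, ← sum_mul, ← mul_sum, hA, hB]; ring
    have e2 : A * J k g x + J k f x * B ≤ A * (b + B) + (a + A) * B := by gcongr
    have h3 : (1:ℝ) ≤ 3 ^ k := one_le_pow₀ (by norm_num)
    have e3 : 3^k * (A * J k g x + J k f x * B) ≤ 3^k * (A * (b + B) + (a + A) * B) := by gcongr
    have e4 : a * b ≤ 3^k * (a * b) := le_mul_of_one_le_left (by positivity) h3
    have e5 : 3^k * (a * b) + 3^k * (A * (b + B) + (a + A) * B) ≤ 3^(k+1) * ((a + A) * (b + B)) := by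
      have e6 : a * b + (A * (b + B) + (a + A) * B) ≤ 3 * ((a + A) * (b + B)) := by
        nlinarith [mul_nonneg ha hb, mul_nonneg ha hB0, mul_nonneg hA0 hb, mul_nonneg hA0 hB0]
      have e7 := mnL e6 (by linarith : (0:ℝ) ≤ 3^k)
      rw [pow_succ]; linarith
    linarith
lemma J_one (k : ℕ) (x : Euc n) : J k (1 : SA n) x = 1 := by
  cases k with
  | zero => simp [J]
  | succ k => simp [J, Derivation.map_one_eq_zero, J_zero]
lemma J_germ (k : ℕ) : ∀ (f : SA n) (U : Set (Euc n)), IsOpen U → (∀ y ∈ U, ev y f = 0) →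
    ∀ x ∈ U, J k f x = 0 := by
  induction k with
  | zero => intro f U hU hf x hx; simp [J, hf x hx]
  | succ k ih =>
    intro f U hU hf x hx
    have : ∀ i, J k (D i f) x = 0 := by
      intro i
      apply ih _ U hU _ x hx
      intro y hy
      rw [ev_D]
      have : (f : Euc n → ℝ) =ᶠ[nhds y] (fun _ => 0) := by
        filter_upwards [hU.mem_nhds hy] with z hz
        exact hf z hz
      rw [this.fderiv_eq]; simp
    simp [J, hf x hx, this]
def Ob {ι : Type*} (F : ι → SA n) (a : ℤ) : Prop :=
  ∀ k : ℕ, ∃ C : ℝ, 0 ≤ C ∧ ∀ t x, J k (F t) x ≤ C * lam x ^ a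
lemma Ob.mul {ι : Type*} {F G : ι → SA n} {a b c : ℤ} (hF : Ob F a) (hG : Ob G b) (hc : c = a + b) :
    Ob (fun t => F t * G t) c := by
  intro k
  obtain ⟨C, hC0, hC⟩ := hF k
  obtain ⟨C', hC0', hC'⟩ := hG k
  refine ⟨3^k * (C * C'), by positivity, fun t x => ?_⟩
  refine (J_mul k _ _ x).trans ?_
  have h1 := hC t x
  have h2 := hC' t x
  have h0 := J_nonneg k (F t) x
  have h0' := J_nonneg k (G t) x
  have hl := lam_pos x
  have : J k (F t) x * J k (G t) x ≤ (C * lam x ^ a) * (C' * lam x ^ b) := by gcongr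
  calc _ ≤ 3^k * ((C * lam x ^ a) * (C' * lam x ^ b)) := by gcongr
    _ = _ := by rw [hc, zpow_add₀ hl.ne']; ring
lemma Ob.add {ι : Type*} {F G : ι → SA n} {a : ℤ} (hF : Ob F a) (hG : Ob G a) :
    Ob (fun t => F t + G t) a := by
  intro k
  obtain ⟨C, hC0, hC⟩ := hF k
  obtain ⟨C', hC0', hC'⟩ := hG k
  refine ⟨C + C', by positivity, fun t x => ?_⟩
  have := J_add k (F t) (G t) x
  have h1 := hC t x
  have h2 := hC' t x
  linarith
lemma Ob_X {ι : Type*} (i : Fin n) : Ob (fun _ : ι => X i) 1 := by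
  intro k
  refine ⟨2, by norm_num, fun _ x => ?_⟩
  have hl := one_le_lam x
  cases k with
  | zero => simp only [J, ev_X, zpow_one]; linarith [coord_le_lam x i]
  | succ k =>
    simp only [J, ev_X, D_X, zpow_one]
    have : ∑ k_1, J k (if k_1 = i then (1 : SA n) else 0) x = 1 := by
      rw [Finset.sum_eq_single i]
      · simp [J_one]
      · intro b _ hb; simp [hb, J_zero]
      · simp
    rw [this]; linarith [coord_le_lam x i]
lemma Ob_one {ι : Type*} : Ob (fun _ : ι => (1 : SA n)) 0 := by
  intro k; exact ⟨1, by norm_num, fun _ x => by simp [J_one]⟩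
lemma Ob_w {ι : Type*} : Ob (fun _ : ι => w n) (-2) := by
  intro k
  induction k with
  | zero => exact ⟨1, by norm_num, fun _ x => by simp only [J, one_mul]; rw [w_lam, abs_of_pos (zpow_pos (lam_pos x) _)]⟩
  | succ k ih =>
    obtain ⟨C, hC0, hC⟩ := ih
    refine ⟨1 + n * (2 * (3^k * (3^k * (2 * C * C)))), by positivity, fun t x => ?_⟩
    have hl := lam_pos x
    obtain h := hC t x
    have h0 := J_nonneg k (w n) x
    have hX : ∀ i, J k (X i) x ≤ 2 * lam x := by
      intro i
      have hl := one_le_lam x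
      cases k with
      | zero => simp only [J, ev_X]; linarith [coord_le_lam x i]
      | succ k =>
        simp only [J, ev_X, D_X]
        have : ∑ k_1, J k (if k_1 = i then (1 : SA n) else 0) x = 1 := by
          rw [Finset.sum_eq_single i]
          · simp [J_one]
          · intro b _ hb; simp [hb, J_zero]
          · simp
        rw [this]; linarith [coord_le_lam x i]
    have e : ∀ i, J k (D i (w n)) x ≤ 2 * (3^k * (3^k * (2 * C * C))) * lam x ^ (-3 : ℤ) := by
      intro i
      have : D i (w n) = (-2 : ℝ) • (X i * (w n * w n)) := by
        apply SA.ext'; intro y; rw [ev_D_w, ev_smul]; simp only [map_mul, ev_X]; ring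
      rw [this, J_smul]
      have e1 : J k (w n * w n) x ≤ 3^k * ((C * lam x ^ (-2:ℤ)) * (C * lam x ^ (-2:ℤ))) := by
        refine (J_mul _ _ _ _).trans ?_
        gcongr
      have e2 : J k (X i * (w n * w n)) x ≤ 3^k * ((2 * lam x) * (3^k * ((C * lam x ^ (-2:ℤ)) * (C * lam x ^ (-2:ℤ))))) := by
        refine (J_mul _ _ _ _).trans ?_
        have := J_nonneg k (w n * w n) x
        have := hX i
        gcongr
      have e3 : |(-2:ℝ)| = 2 := by norm_num
      rw [e3]
      calc _ ≤ 2 * (3^k * ((2 * lam x) * (3^k * ((C * lam x ^ (-2:ℤ)) * (C * lam x ^ (-2:ℤ)))))) := by gcongr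
        _ = 2 * (3^k * (3^k * (2 * C * C))) * (lam x * lam x ^ (-2:ℤ) * lam x ^ (-2:ℤ)) := by ring
        _ = _ := by
          congr 1
          rw [← zpow_one_add₀ hl.ne', ← zpow_add₀ hl.ne']; norm_num
    show |eW x| + lam x * ∑ i, J k (D i (w n)) x ≤ _
    have e4 : ∑ i, J k (D i (w n)) x ≤ n * (2 * (3^k * (3^k * (2 * C * C))) * lam x ^ (-3 : ℤ)) := by
      refine (sum_le_sum fun i _ => e i).trans ?_
      simp
    have e5 := mnL e4 hl.le
    have e6 : |eW x| = lam x ^ (-2:ℤ) := by rw [w_lam, abs_of_pos (zpow_pos (lam_pos x) _)]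
    have e7 : lam x * lam x ^ (-3:ℤ) = lam x ^ (-2:ℤ) := by rw [← zpow_one_add₀ hl.ne']; norm_num
    rw [e6, ← e7]
    rw [← e7] at e6
    linarith
lemma Ob.pow {ι : Type*} {F : ι → SA n} {a : ℤ} (hF : Ob F a) (p : ℕ) : Ob (fun t => F t ^ p) (p * a) := by
  induction p with
  | zero => simpa using Ob_one
  | succ p ih =>
    simp only [pow_succ]
    exact ih.mul hF (by push_cast; ring)
def mono' (α : Fin n → ℕ) : SA n := ∏ m, X m ^ α m
lemma ev_mono (α : Fin n → ℕ) (x : Euc n) : ev x (mono' α) = ∏ m, x m ^ α m := by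
  simp [mono', map_prod, ev_X]
lemma Ob_mono {ι : Type*} (α : Fin n → ℕ) : Ob (fun _ : ι => mono' α) (∑ m, α m : ℕ) := by
  classical
  unfold mono'
  have : ∀ s : Finset (Fin n), Ob (fun _ : ι => (∏ m ∈ s, X m ^ α m : SA n)) (∑ m ∈ s, α m : ℕ) := by
    intro s
    induction s using Finset.induction_on with
    | empty => simpa using Ob_one
    | insert a s ha ih =>
      simp only [prod_insert ha, sum_insert ha]
      exact ((Ob_X a).pow (α a)).mul ih (by push_cast; ring)
  exact this univ
end
section
open Finset
def cmpf (g : ℝ → ℝ) (hg : ContDiff ℝ (⊤ : ℕ∞) g) (f : SA n) : SA n :=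
  ⟨fun x => g (ev x f), show ContDiff ℝ (⊤ : ℕ∞) _ from hg.comp (SA.sm f)⟩
lemma ev_cmpf (g : ℝ → ℝ) (hg : ContDiff ℝ (⊤ : ℕ∞) g) (f : SA n) (x : Euc n) :
    ev x (cmpf g hg f) = g (ev x f) := rfl
lemma deriv_sm {g : ℝ → ℝ} (hg : ContDiff ℝ (⊤ : ℕ∞) g) : ContDiff ℝ (⊤ : ℕ∞) (deriv g) :=
  (contDiff_infty_iff_deriv.1 hg).2
lemma D_cmpf (g : ℝ → ℝ) (hg : ContDiff ℝ (⊤ : ℕ∞) g) (f : SA n) (i : Fin n) :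
    D i (cmpf g hg f) = cmpf (deriv g) (deriv_sm hg) f * D i f := by
  apply SA.ext'; intro x
  rw [map_mul, ev_cmpf, ev_D, ev_D]
  have h1 : HasDerivAt g (deriv g (ev x f)) (ev x f) := (hg.differentiable (by simp) _).hasDerivAt
  have h2 := h1.comp_hasFDerivAt x (SA.diff f x).hasFDerivAt
  have h3 : HasFDerivAt ((cmpf g hg f : SA n) : Euc n → ℝ) _ x := h2
  rw [h3.fderiv]; simp
def cut (g : ℝ → ℝ) (hg : ContDiff ℝ (⊤ : ℕ∞) g) (t c : ℝ) : SA n :=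
  cmpf g hg (t • sqf n - c • 1)
lemma ev_cut (g : ℝ → ℝ) (hg : ContDiff ℝ (⊤ : ℕ∞) g) (t c : ℝ) (x : Euc n) :
    ev x (cut g hg t c) = g (t * eS x - c) := by
  simp only [cut, ev_cmpf, map_sub, ev_smul, map_one, mul_one]
lemma D_cut (g : ℝ → ℝ) (hg : ContDiff ℝ (⊤ : ℕ∞) g) (t c : ℝ) (i : Fin n) :
    D i (cut g hg t c) = (2 * t) • (X i * cut (deriv g) (deriv_sm hg) t c) := by
  unfold cut
  rw [D_cmpf]
  apply SA.ext'; intro x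
  have h2 : ev x (2 : SA n) = 2 := map_ofNat (ev x) 2
  simp only [map_mul, map_sub, D_smul, D_sq, ev_smul, Derivation.map_one_eq_zero, map_zero, h2, ev_cmpf]
  ring
lemma cut_bd {g : ℝ → ℝ} (hg : ContDiff ℝ (⊤ : ℕ∞) g) {a : ℝ} (h : ∀ τ, a < τ → g τ = 0) :
    ∃ M, 0 ≤ M ∧ ∀ τ, -1 ≤ τ → |g τ| ≤ M := by
  obtain ⟨M, hM⟩ := (isCompact_Icc (a := (-1:ℝ)) (b := a)).exists_bound_of_continuousOn hg.continuous.continuousOn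
  refine ⟨max M 0, le_max_right _ _, fun τ hτ => ?_⟩
  by_cases h1 : τ ≤ a
  · exact (hM τ ⟨hτ, h1⟩).trans (le_max_left _ _)
  · rw [h τ (not_le.1 h1)]; simp
lemma J_X (k : ℕ) (i : Fin n) (x : Euc n) : J k (X i) x ≤ 2 * lam x := by
  have hl := one_le_lam x
  cases k with
  | zero => simp only [J, ev_X]; linarith [coord_le_lam x i]
  | succ k =>
    simp only [J, ev_X, D_X]
    have : ∑ k_1, J k (if k_1 = i then (1 : SA n) else 0) x = 1 := by
      rw [Finset.sum_eq_single i]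
      · simp [J_one]
      · intro b _ hb; simp [hb, J_zero]
      · simp
    rw [this]; linarith [coord_le_lam x i]
lemma cut_J (k : ℕ) : ∀ {g : ℝ → ℝ} (hg : ContDiff ℝ (⊤ : ℕ∞) g) {a : ℝ} (_ : 0 ≤ a)
    (_ : ∀ τ, a < τ → g τ = 0), ∃ C, 0 ≤ C ∧ ∀ t c : ℝ, 0 ≤ t → 0 ≤ c → c ≤ 1 → ∀ x : Euc n,
      J k (cut g hg t c) x ≤ C := by
  induction k with
  | zero =>
    intro g hg a ha h
    obtain ⟨M, hM0, hM⟩ := cut_bd hg h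
    refine ⟨M, hM0, fun t c ht hc hc1 x => ?_⟩
    simp only [J, ev_cut]
    apply hM
    have := mul_nonneg ht (by linarith [ev_sq_pos x] : 0 ≤ eS x)
    linarith
  | succ k ih =>
    intro g hg a ha h
    obtain ⟨M, hM0, hM⟩ := cut_bd hg h
    have h' : ∀ τ, a < τ → deriv g τ = 0 := by
      intro τ hτ
      have : g =ᶠ[nhds τ] fun _ => 0 := by
        filter_upwards [Ioi_mem_nhds hτ] with z hz using h z hz
      rw [this.deriv_eq]; simp
    obtain ⟨C, hC0, hC⟩ := ih (deriv_sm hg) ha h'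
    refine ⟨M + n * (4 * 3^k * C * (a + 1)), by positivity, fun t c ht hc hc1 x => ?_⟩
    simp only [J, ev_cut]
    have hs := ev_sq_pos x
    have hl := lam_pos x
    have e1 : |g (t * eS x - c)| ≤ M := by
      apply hM
      have := mul_nonneg ht (by linarith : 0 ≤ eS x)
      linarith
    have e2 : ∀ i, lam x * J k (D i (cut g hg t c)) x ≤ 4 * 3^k * C * (a+1) := by
      intro i
      rw [D_cut, J_smul]
      have e3 := J_mul k (X i) (cut (deriv g) (deriv_sm hg) t c) x
      by_cases hc2 : a < t * eS x - c
      · have : J k (cut (deriv g) (deriv_sm hg) t c) x = 0 := by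
          apply J_germ k _ {y : Euc n | a < t * eS y - c}
          · exact isOpen_lt continuous_const ((continuous_const.mul (ev_cont (sqf n))).sub continuous_const)
          · intro y hy; rw [ev_cut]; exact h' _ hy
          · exact hc2
        rw [this] at e3
        have h0 := J_nonneg k (X i * cut (deriv g) (deriv_sm hg) t c) x
        have : J k (X i * cut (deriv g) (deriv_sm hg) t c) x = 0 := by linarith
        rw [this]; simp; positivity
      · have h5 : t * lam x ^ 2 ≤ a + 1 := by rw [lam_sq]; linarith
        have h6 := hC t c ht hc hc1 x
        have h7 := J_X k i x
        have h8 := J_nonneg k (cut (deriv g) (deriv_sm hg) t c) x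
        have h9 := J_nonneg k (X i) x
        rw [abs_of_nonneg (by positivity)]
        calc lam x * (2 * t * J k (X i * cut (deriv g) (deriv_sm hg) t c) x)
            ≤ lam x * (2 * t * (3^k * ((2 * lam x) * C))) := by gcongr; exact e3.trans (by gcongr)
          _ = 4 * 3^k * C * (t * lam x ^ 2) := by ring
          _ ≤ _ := by gcongr
    have e3 : lam x * ∑ i, J k (D i (cut g hg t c)) x ≤ n * (4 * 3^k * C * (a + 1)) := by
      rw [mul_sum]
      refine (sum_le_sum fun i _ => e2 i).trans ?_
      simp
    linarith
def NN (d : ℕ) (c : Fin n → Fin n → (Fin n → ℕ) → ℝ) (τ : ℝ) : ℝ :=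
  ∑ α ∈ MIdx n d, ∑ i, ∑ k, c i k α ^ 2 * τ ^ (∑ m, α m)
lemma NN_nonneg (d : ℕ) (c : Fin n → Fin n → (Fin n → ℕ) → ℝ) {τ : ℝ} (h : 0 ≤ τ) : 0 ≤ NN d c τ :=
  sum_nonneg fun α _ => sum_nonneg fun i _ => sum_nonneg fun k _ => by positivity
lemma NN_mono (d : ℕ) (c : Fin n → Fin n → (Fin n → ℕ) → ℝ) {τ σ : ℝ} (h : 0 ≤ τ) (h' : τ ≤ σ) :
    NN d c τ ≤ NN d c σ :=
  sum_le_sum fun α _ => sum_le_sum fun i _ => sum_le_sum fun k _ => by gcongr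
lemma mem_MIdx {d : ℕ} {α : Fin n → ℕ} (h : α ∈ MIdx n d) : 2 ≤ ∑ i, α i ∧ ∑ i, α i ≤ d :=
  (Finset.mem_filter.1 h).2
lemma NN_dil (d : ℕ) (c : Fin n → Fin n → (Fin n → ℕ) → ℝ) {τ q : ℝ} (h : 0 ≤ τ) (hq : 1 ≤ q) :
    NN d c (q * τ) ≤ q^d * NN d c τ := by
  unfold NN
  simp only [mul_sum]
  refine sum_le_sum fun α hα => sum_le_sum fun i _ => sum_le_sum fun k _ => ?_
  have h1 : q ^ (∑ m, α m) ≤ q ^ d := pow_le_pow_right₀ hq (mem_MIdx hα).2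
  rw [mul_pow]
  have : 0 ≤ c i k α ^ 2 * τ ^ (∑ m, α m) := by positivity
  nlinarith
lemma h_J (d : ℕ) {ψ : ℝ → ℝ} (hψ : ContDiff ℝ (⊤ : ℕ∞) ψ) {a : ℝ} (ha : 0 ≤ a)
    (h : ∀ τ, a < τ → ψ τ = 0) (k : ℕ) : ∃ C, 0 ≤ C ∧ ∀ t c' : ℝ, 0 ≤ t → 0 ≤ c' → c' ≤ 1 →
      ∀ (c : Fin n → Fin n → (Fin n → ℕ) → ℝ) (i j : Fin n) (x : Euc n),
      J k (cut ψ hψ t c' * ∑ α ∈ MIdx n d, c i j α • mono' α) x ^ 2 ≤ C * NN d c (eS x) := by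
  obtain ⟨C1, hC1, H1⟩ := cut_J (n := n) k hψ ha h
  have hm := fun α : Fin n → ℕ => Ob_mono (ι := Unit) α k
  choose M hM0 hM using hm
  set M1 := ∑ α ∈ MIdx n d, M α ^ 2 with hM1
  have hM10 : 0 ≤ M1 := sum_nonneg fun α _ => by positivity
  refine ⟨(3^k * C1)^2 * M1, by positivity, fun t c' ht hc0 hc1 c i j x => ?_⟩
  have h1 := H1 t c' ht hc0 hc1 x
  have h10 := J_nonneg k (cut ψ hψ t c') x
  set P : SA n := ∑ α ∈ MIdx n d, c i j α • mono' α with hP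
  have hP0 := J_nonneg k P x
  have h2 : J k P x ≤ ∑ α ∈ MIdx n d, M α * (|c i j α| * lam x ^ (∑ m, α m)) := by
    refine (J_sum k _ _ x).trans (sum_le_sum fun α _ => ?_)
    rw [J_smul]
    have := hM α () x
    rw [zpow_natCast] at this
    nlinarith [abs_nonneg (c i j α)]
  have h3 : J k P x ^ 2 ≤ M1 * NN d c (eS x) := by
    refine (pow_le_pow_left₀ hP0 h2 2).trans ((sum_mul_sq_le_sq_mul_sq _ _ _).trans ?_)
    rw [hM1]
    refine mnL ?_ hM10
    refine sum_le_sum fun α _ => ?_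
    rw [mul_pow, sq_abs, ← pow_mul, mul_comm _ 2, pow_mul, lam_sq]
    have hs : 0 ≤ eS x := by linarith [ev_sq_pos x]
    refine (single_le_sum (f := fun i => ∑ k, c i k α ^ 2 * eS x ^ (∑ m, α m))
      (fun i _ => sum_nonneg fun k _ => by positivity) (mem_univ i)).trans' ?_
    exact single_le_sum (f := fun k => c i k α ^ 2 * eS x ^ (∑ m, α m))
      (fun i _ => by positivity) (mem_univ j)
  have h4 := J_mul k (cut ψ hψ t c') P x
  have h5 : J k (cut ψ hψ t c' * P) x ≤ 3^k * C1 * J k P x :=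
    h4.trans (by rw [mul_assoc]; gcongr)
  calc _ ≤ (3^k * C1 * J k P x)^2 := pow_le_pow_left₀ (J_nonneg _ _ _) h5 2
    _ = (3^k * C1)^2 * J k P x ^ 2 := by ring
    _ ≤ (3^k * C1)^2 * (M1 * NN d c (eS x)) := by gcongr
    _ = _ := by ring
lemma zz_le (hn : 2 ≤ n) (l0 : Fin n) (h : Fin n → Fin n → SA n) (x : Euc n) (B : ℝ)
    (hB : ∀ i k, J 1 (h i k) x ≤ B) (i : Fin n) : lam x * |zz l0 h x i| ≤ (2 * n + 1) * (1 + 2 * n) * B := by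
  have hl := lam_pos x
  have hB0 : 0 ≤ B := (J_nonneg 1 (h i i) x).trans (hB i i)
  have key : ∀ (p : ℝ), 0 ≤ p → p ≤ 2 * n → ∀ a b k, lam x * |ev x (D k (h a b)) - p * eW x * (x k * ev x (h a b))| ≤ (1 + 2 * n) * B := by
    intro p hp hp2 a b k
    have h1 : lam x * |ev x (D k (h a b))| ≤ B := by
      have := J_D 0 (h a b) x k
      exact this.trans (hB a b)
    have h2 : |ev x (h a b)| ≤ B := (abs_le_J 1 _ x).trans (hB a b)
    have h3 : lam x * |p * eW x * (x k * ev x (h a b))| ≤ 2 * n * B := by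
      rw [abs_mul, abs_mul, abs_mul, abs_of_nonneg hp, abs_of_pos (ev_w_pos x)]
      have h4 := coord_le_lam x k
      have h5 : lam x * (eW x * lam x) = 1 := by
        rw [w_lam, ← zpow_add_one₀ hl.ne', ← zpow_one_add₀ hl.ne']; norm_num
      have h6 := ev_w_pos x
      calc lam x * (p * eW x * (|x k| * |ev x (h a b)|))
          ≤ lam x * ((2*n) * eW x * (lam x * B)) := by gcongr
        _ = 2 * n * B * (lam x * (eW x * lam x)) := by ring
        _ = _ := by rw [h5]; ring
    have h4 := abs_sub (ev x (D k (h a b))) (p * eW x * (x k * ev x (h a b)))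
    have h5 := mnL h4 hl.le
    linarith
  have hn1 : (2:ℝ) ≤ n := by exact_mod_cast hn
  have k1 : lam x * |∑ k, (ev x (D k (h i k)) - 2 * n * eW x * (x k * ev x (h i k)))| ≤ n * ((1 + 2 * n) * B) := by
    refine (mnL (abs_sum_le_sum_abs _ _) hl.le).trans ?_
    rw [mul_sum]
    exact (sum_le_sum fun k _ => key (2*n) (by positivity) le_rfl i k k).trans (by simp)
  have k2 := key (2 * ((n:ℝ) - 2)) (by linarith) (by linarith) i l0 l0
  have k3 : lam x * |if i = l0 then ∑ k, (ev x (D k (h k l0)) - 2 * ((n:ℝ) - 2) * eW x * (x k * ev x (h k l0))) else 0|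
      ≤ n * ((1 + 2 * n) * B) := by
    split_ifs
    · refine (mnL (abs_sum_le_sum_abs _ _) hl.le).trans ?_
      rw [mul_sum]
      exact (sum_le_sum fun k _ => key (2 * ((n:ℝ) - 2)) (by linarith) (by linarith) k l0 k).trans (by simp)
    · simp; positivity
  unfold zz
  generalize (∑ k, (ev x (D k (h i k)) - 2 * n * eW x * (x k * ev x (h i k)))) = A1 at *
  generalize (ev x (D l0 (h i l0)) - 2 * ((n:ℝ) - 2) * eW x * (x l0 * ev x (h i l0))) = A2 at *
  generalize (if i = l0 then ∑ k, (ev x (D k (h k l0)) - 2 * ((n:ℝ) - 2) * eW x * (x k * ev x (h k l0))) else 0) = A3 at *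
  have h4 := (abs_add_le (A1 - A2) A3).trans (add_le_add_left (abs_sub A1 A2) _)
  have h5 := mnL h4 hl.le
  linarith
end
section
open Finset
lemma wx2 (x : Euc n) : eW x * (∑ i, x i * x i) ≤ 1 := by
  have h1 := ev_w_mul x
  have h2 := ev_w_pos x
  linarith
lemma xv2_le (x : Euc n) (V : Fin n → SA n) : eW x * ev x (xv V) ^ 2 ≤ ev x (V2 V) := by
  have h1 := cs1 (fun i => x i) (fun i => ev x (V i))
  have h2 := wx2 x
  have h3 := ev_w_pos x
  have h0 := V2_nonneg x V
  rw [ev_xv]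
  rw [ev_V2] at *
  have h4 := mnL h1 h3.le
  have h5 := mnR h2 h0
  linarith
lemma a2_le (x : Euc n) (V : Fin n → SA n) :
    a2 x V ≤ (32 + 16 * n) * (bb x V + eW x * ev x (V2 V)) := by
  have h3 := ev_w_pos x
  have h0 := V2_nonneg x V
  have hb := bb_nonneg x V
  have p1 : ∀ i k, ev x (D i (V k)) * ev x (D i (V k)) ≤ 4 * Bm x V i k ^ 2
      + 16 * eW x ^ 2 * ((x i * x i) * (ev x (V k) * ev x (V k)))
      + 16 * eW x ^ 2 * ((ev x (V i) * ev x (V i)) * (x k * x k))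
      + (if i = k then 16 * eW x ^ 2 * ev x (xv V) ^ 2 else 0) := by
    intro i k
    have q : ∀ a b c d : ℝ, (a + b - c + d) * (a + b - c + d) ≤ 4 * a^2 + 4 * b^2 + 4*c^2+4*d^2 := by
      intro a b c d
      nlinarith [sq_nonneg (a-b), sq_nonneg (a+c), sq_nonneg (a-d), sq_nonneg (b+c), sq_nonneg (b-d), sq_nonneg (c+d)]
    have e : ev x (D i (V k)) = Bm x V i k + 2 * eW x * (x i * ev x (V k)) - 2 * eW x * (ev x (V i) * x k)
      + (if i = k then 2 * eW x * ev x (xv V) else 0) := by unfold Bm; ring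
    rw [e]
    refine (q _ _ _ _).trans (le_of_eq ?_)
    split_ifs <;> ring
  have e : a2 x V ≤ 4 * bb x V + 32 * eW x^2 * ((∑ i, x i * x i) * ev x (V2 V)) + n * (16 * eW x ^ 2 * ev x (xv V) ^ 2) := by
    refine (sum_le_sum fun i _ => sum_le_sum fun k _ => p1 i k).trans (le_of_eq ?_)
    simp only [sum_add_distrib, ← mul_sum, sum_ite_eq, mem_univ, if_true, sum_const, card_univ, Fintype.card_fin, nsmul_eq_mul]
    rw [ev_V2, bb]
    simp only [← mul_sum, ← sum_mul]
    ring
  have h1 := mnL (xv2_le x V) (by positivity : 0 ≤ n * 16 * eW x)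
  have h2 := mnR (wx2 x) (by positivity : 0 ≤ 32 * eW x * ev x (V2 V))
  have h4 : 0 ≤ (n:ℝ) * bb x V := by positivity
  linarith
lemma T0_sq (x : Euc n) (V : Fin n → SA n) : ev x (T0 V) ^ 2 ≤ n * a2 x V := by
  rw [ev_T0]
  refine (sq_sum_le_card_mul_sum_sq).trans ?_
  simp only [card_univ, Fintype.card_fin]
  gcongr
  unfold a2
  refine sum_le_sum fun i _ => ?_
  rw [pow_two]
  exact single_le_sum (f := fun k => ev x (D i (V k)) * ev x (D i (V k))) (fun k _ => mul_self_nonneg _) (mem_univ i)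
lemma Tf_sq (x : Euc n) (V : Fin n → SA n) :
    ev x (Tf V) ^ 2 ≤ (2 * n + 8 * n^2) * (a2 x V + eW x * ev x (V2 V)) := by
  rw [ev_Tf]
  have h1 := T0_sq x V
  have h2 := mnL (xv2_le x V) (by have := ev_w_pos x; positivity : 0 ≤ 8 * (n:ℝ)^2 * eW x)
  have ha : 0 ≤ a2 x V := sum_nonneg fun i _ => sum_nonneg fun k _ => mul_self_nonneg _
  have h5 : 0 ≤ (n:ℝ) * (eW x * ev x (V2 V)) := by have := ev_w_pos x; have := V2_nonneg x V; positivity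
  have h6 : 0 ≤ (n:ℝ)^2 * a2 x V := by positivity
  nlinarith [sq_nonneg (ev x (T0 V) + 2 * n * eW x * ev x (xv V))]
def ff (n : ℕ) (R : ℝ) : SA n :=
  ⟨fun x => √((1 + R^2 * eW x)⁻¹), show ContDiff ℝ (⊤ : ℕ∞) _ from by
    have h : ∀ x : Euc n, 0 < 1 + R^2 * eW x := fun x => by have := ev_w_pos x; positivity
    have h1 : ContDiff ℝ (⊤ : ℕ∞) fun x : Euc n => 1 + R^2 * eW x :=
      contDiff_const.add (contDiff_const.mul (SA.sm (w n)))
    exact (h1.inv fun x => (h x).ne').sqrt fun x => (inv_pos.2 (h x)).ne'⟩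
lemma ff_pos (R : ℝ) (x : Euc n) : 0 < ev x (ff n R) :=
  Real.sqrt_pos.2 (inv_pos.2 (by have := ev_w_pos x; positivity))
lemma ff_sq' (R : ℝ) (x : Euc n) : ev x (ff n R) ^ 2 * (1 + R^2 * eW x) = 1 := by
  have : 0 < 1 + R^2 * eW x := by have := ev_w_pos x; positivity
  show √((1 + R^2 * eW x)⁻¹) ^ 2 * _ = 1
  rw [Real.sq_sqrt (inv_pos.2 this).le, inv_mul_cancel₀ this.ne']
lemma ff_le (R : ℝ) (x : Euc n) : ev x (ff n R) ≤ 1 := by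
  have h1 := ff_sq' R x
  have h2 := ff_pos R x
  have h3 : 0 ≤ R^2 * eW x := by have := ev_w_pos x; positivity
  nlinarith [mul_nonneg (sq_nonneg (ev x (ff n R))) h3]
lemma ff_lam (R : ℝ) (hR : 0 ≤ R) (x : Euc n) : ev x (ff n R) * R ≤ lam x := by
  have h1 := ff_sq' R x
  have h2 := ff_pos R x
  have hl := lam_pos x
  have hw := ev_w_pos x
  apply abs_le_of_sq_le_sq' _ hl.le |>.2
  rw [lam_sq]
  have h3 : eW x * eS x = 1 := by rw [ev_sq]; exact ev_w_mul x
  have h4 : ev x (ff n R) ^ 2 * R^2 * eW x ≤ 1 := by nlinarith [sq_nonneg (ev x (ff n R))]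
  have h5 := mnR h4 (by linarith [ev_sq_pos x] : 0 ≤ eS x)
  calc _ = ev x (ff n R) ^ 2 * R^2 * (eW x * eS x) := by rw [h3]; ring
    _ ≤ _ := by linarith
lemma ff_D (R : ℝ) (x : Euc n) (i : Fin n) :
    ev x (D i (ff n R)) = R^2 * eW x * ev x (ff n R) ^ 2 * eW x * x i * ev x (ff n R) := by
  have h : ff n R * ff n R * (1 + R^2 • w n) = 1 := by
    apply SA.ext'; intro y
    have := ff_sq' R y
    simp only [map_mul, map_add, ev_smul, map_one]; linarith
  have h2 : D i (ff n R * ff n R * (1 + R^2 • w n)) = 0 := by rw [h]; exact Derivation.map_one_eq_zero _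
  have h3 := congrArg (ev x) h2
  simp only [D_mul, map_add, map_mul, D_smul, ev_smul, Derivation.map_one_eq_zero, ev_D_w, map_zero, map_one] at h3
  have h4 := ff_sq' R x
  have h5 := ff_pos R x
  have h6 := ev_w_pos x
  generalize ev x (D i (ff n R)) = a at *
  generalize ev x (ff n R) = f at *
  generalize eW x = W at *
  have e : a * f * (1 + R^2 * W) = f^2 * R^2 * x i * W^2 := by linarith
  calc a = a * (f^2 * (1 + R^2 * W)) := by rw [h4]; ring
    _ = f * (a * f * (1 + R^2 * W)) := by ring
    _ = _ := by rw [e]; ring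
lemma ff_D_pow (R : ℝ) (x : Euc n) (i : Fin n) (M : ℕ) :
    ev x (D i (ff n R ^ M)) = (M * (R^2 * eW x * ev x (ff n R) ^ 2)) * eW x * x i * ev x (ff n R ^ M) := by
  cases M with
  | zero => simp [Derivation.map_one_eq_zero]
  | succ M =>
    rw [D_pow, ev_smul, map_mul, ff_D]; push_cast; simp only [map_pow]; ring
lemma fld1_supp (l0 : Fin n) (h : Fin n → Fin n → SA n) (V : Fin n → SA n) (q : SA n) (p : ℕ) {R : ℝ}
    (hq : ∀ x, R ≤ ‖x‖ → ev x q = 0) (k : Fin n) (x : Euc n) (hx : R ≤ ‖x‖) : ev x (fld1 l0 h V q p k) = 0 := by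
  have h1 : ∀ x, R ≤ ‖x‖ → ev x (psf V q) = 0 := fun x hx => by simp [psf, hq x hx]
  have h2 : ∀ i, ev x (D i (psf V q)) = 0 := fun i => D_supp h1 i x hx
  unfold fld1
  simp [h2, h1 x hx, hq x hx]
lemma comb_pt (hn : 6 ≤ n) : ∃ C : ℝ, 0 ≤ C ∧ ∀ {l0 : Fin n} {h : Fin n → Fin n → SA n} {V : Fin n → SA n}
    (_ : Sys l0 h V) (R : ℝ) (_ : 0 < R) (η : SA n), ∃ Y : Fin n → SA n,
    (∀ r, (∀ x, r ≤ ‖x‖ → ev x η = 0) → ∀ i x, r ≤ ‖x‖ → ev x (Y i) = 0) ∧ (∀ x, x l0 = 0 → ev x (Y l0) = 0) ∧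
    ∀ x ∈ HS l0, eW x ^ n * ev x (ff n R) ^ (n-3) * (ev x η ^ 2 * (bb x V + eW x * ev x (V2 V))) ≤
      C * (eW x ^ n * ev x (ff n R) ^ (n-3) * (ev x η ^ 2 * (hh x h + eS x * ∑ i, zz l0 h x i * zz l0 h x i)))
      + C * ((R^(n-3))⁻¹ * (ev x η ^ 2 * (eW x ^ (n+2) * ev x (V2 V))))
      + C * (eW x ^ n * (g2 x η * (ev x (V2 V) + eS x * ev x (Tf V) ^ 2)))
      + ∑ i, ev x (D i (Y i)) := by
  obtain ⟨p, hp⟩ : ∃ p, p + 2 = n := ⟨n - 2, by omega⟩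
  have hn' : (6:ℝ) ≤ n := by exact_mod_cast hn
  obtain ⟨c, hc⟩ : ∃ c : ℝ, c = 160 * n^2 + 2560 * n^2 * (2000 * n^6) := ⟨_, rfl⟩
  have hc1 : 1 ≤ c := by
    have : (1:ℝ) ≤ n^2 := by nlinarith
    have : (0:ℝ) ≤ 2560 * n^2 * (2000 * n^6) := by positivity
    linarith
  have hcM : c ≤ c^(n-3+1) := le_self_pow₀ hc1 (by omega)
  refine ⟨c^(n-3+1), by positivity, fun {l0 h V} H R hR η => ?_⟩
  refine ⟨fun k => (8:ℝ) • fld2 h V (ff n R ^ (n-3) * (η * η)) k + (2560 * (n:ℝ)^2) • fld1 l0 h V (ff n R ^ (n-3) * (η * η)) p k, ?_, ?_, ?_⟩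
  · intro r hr i x hx
    have hq : ∀ x, r ≤ ‖x‖ → ev x (ff n R ^ (n-3) * (η * η)) = 0 := fun x hx => by simp [hr x hx]
    simp only [map_add, ev_smul, fld2_supp h V _ x (hq x hx), fld1_supp l0 h V _ p hq i x hx]; simp
  · intro x hx
    simp only [map_add, ev_smul, fld2_bdry H _ x hx, fld1_bdry H _ _ x hx]; simp
  intro x hx
  have hf := ff_pos R x
  have hf1 := ff_le R x
  have hw := ev_w_pos x
  have hw1 := ev_w_le x
  have hm0 : 0 ≤ ((n-3:ℕ):ℝ) * (R^2 * eW x * ev x (ff n R) ^ 2) := by positivity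
  have hm1 : ((n-3:ℕ):ℝ) * (R^2 * eW x * ev x (ff n R) ^ 2) ≤ n - 3 := by
    have h1 := ff_sq' R x
    rw [Nat.cast_sub (by omega)]; push_cast
    have : R^2 * eW x * ev x (ff n R) ^ 2 ≤ 1 := by nlinarith [sq_nonneg (ev x (ff n R))]
    nlinarith
  have hF0 : 0 ≤ ev x (ff n R ^ (n-3)) := by rw [map_pow]; positivity
  have s2 := step2_pt hn H x hx (ff n R ^ (n-3)) η _ (fun i => ff_D_pow R x i (n-3)) hF0 hm0 hm1
  have s1 := step1_pt hn H p hp x hx (ff n R ^ (n-3)) η _ (fun i => ff_D_pow R x i (n-3)) hF0 hm0 hm1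
  have hdv : ∑ i, ev x (D i ((8:ℝ) • fld2 h V (ff n R ^ (n-3) * (η * η)) i + (2560 * (n:ℝ)^2) • fld1 l0 h V (ff n R ^ (n-3) * (η * η)) p i))
     = 8 * dv x (fld2 h V (ff n R ^ (n-3) * (η * η))) + (2560 * (n:ℝ)^2) * dv x (fld1 l0 h V (ff n R ^ (n-3) * (η * η)) p) := by
    simp only [dv, map_add, D_smul, ev_smul, sum_add_distrib, mul_sum]
  rw [hdv]
  have hws : eW x * eS x = 1 := by rw [ev_sq]; exact ev_w_mul x
  have hwp : eW x ^ (p+1) = eW x ^ n * eS x := by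
    have : eW x ^ n = eW x ^ (p+1) * eW x := by rw [← pow_succ]; congr 1; omega
    rw [this, mul_assoc, hws, mul_one]
  rw [hwp] at s1
  have hkey : c * ev x (ff n R) ^ (n-3) * eW x ≤ ev x (ff n R) ^ (n-3) + c^(n-3+1) * (R^(n-3))⁻¹ * eW x := by
    by_cases h1 : c * eW x ≤ 1
    · have h2 : 0 ≤ c^(n-3+1) * (R^(n-3))⁻¹ * eW x := by positivity
      have h3 := mnL h1 (pow_pos hf (n-3)).le
      linarith
    · have h2 : eS x ≤ c := by
        have h3 := mnR (not_le.1 h1).le (by linarith [ev_sq_pos x] : 0 ≤ eS x)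
        rw [mul_assoc, hws] at h3; linarith
      have h3 : lam x ≤ c := by
        have := lam_sq x
        have := one_le_lam x
        nlinarith
      have h4 : ev x (ff n R) ≤ c * R⁻¹ := by
        rw [← div_eq_mul_inv, le_div_iff₀ hR]; exact (ff_lam R hR.le x).trans h3
      have h5 : ev x (ff n R) ^ (n-3) ≤ c ^ (n-3) * (R^(n-3))⁻¹ := by
        rw [← inv_pow, ← mul_pow]; exact pow_le_pow_left₀ hf.le h4 _
      have h6 := mnL h5 (by positivity : 0 ≤ c * eW x)
      have h7 : 0 ≤ ev x (ff n R) ^ (n-3) := by positivity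
      rw [pow_succ c]
      linarith
  rw [map_pow] at s1 s2
  have hFl : ev x (ff n R) ^ (n-3) ≤ 1 := pow_le_one₀ hf.le hf1
  rw [map_pow] at hF0
  have hRi : 0 ≤ (R^(n-3))⁻¹ := by positivity
  have hWn : 0 ≤ eW x ^ n := by positivity
  have hb := bb_nonneg x V
  have hv := V2_nonneg x V
  have hg := g2_nonneg x η
  have hhn := hh_nonneg x h
  have hz : 0 ≤ ∑ i, zz l0 h x i * zz l0 h x i := sum_nonneg fun i _ => mul_self_nonneg _
  have hE := sq_nonneg (ev x η)
  have hT := sq_nonneg (ev x (Tf V))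
  have hs0 : 0 ≤ eS x := by linarith [ev_sq_pos x]
  have hw2 : eW x ^ (n+2) = eW x ^ n * eW x ^ 2 := pow_add _ _ _
  rw [hw2]
  generalize dv x (fld2 h V (ff n R ^ (n-3) * (η * η))) = d2 at *
  generalize dv x (fld1 l0 h V (ff n R ^ (n-3) * (η * η)) p) = d1 at *
  generalize ev x (ff n R) ^ (n-3) = F at *
  generalize c^(n-3+1) = C at *
  generalize (R^(n-3))⁻¹ = Ri at *
  generalize eW x ^ n = Wn at *
  generalize ev x η ^ 2 = E at *
  generalize ev x (Tf V) ^ 2 = T at *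
  generalize ev x (V2 V) = v at *
  generalize (∑ i, zz l0 h x i * zz l0 h x i) = Z at *
  generalize hh x h = hhh at *
  generalize g2 x η = G at *
  generalize bb x V = b at *
  generalize eS x = s at *
  generalize eW x = W at *
  have e1 : Wn * s * F * (1/16 * (E * (W * T))) = Wn * F * E * T * (1/16) := by
    linear_combination (Wn * F * E * T / 16) * hws
  have e2 : Wn * s * F * (2000 * n^6 * (E * (W^2 * (W^2*v)) + E * Z + G * T)) =
     2000 * n^6 * (Wn * F * (E * W^3 * v + s * E * Z + s * G * T)) := by
    linear_combination (2000 * n^6 * Wn * F * E * W^3 * v) * hws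
  rw [e1, e2] at s1
  have e3 : Wn * F * (E * W^3 * v + s * E * Z + s * G * T) ≤ Wn * F * (E * W^2 * v + s * E * Z + s * G * T) := by
    have : W^3 ≤ W^2 := pow_le_pow_of_le_one hw.le hw1 (by norm_num)
    gcongr
  have e4 := mnL e3 (by positivity : (0:ℝ) ≤ 2560 * n^2 * (2000 * n^6))
  have s1' := mnL s1 (by positivity : (0:ℝ) ≤ 2560 * n^2)
  have p1 : 0 ≤ 160 * (n:ℝ)^2 * (Wn * F * (s * E * Z + s * G * T)) := by positivity
  have p2 : 0 ≤ 2560 * n^2 * (2000 * n^6) * (Wn * F * (E * hhh + G * v)) := by positivity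
  have e5 : 2 * (Wn * F * (E * (b + W * v))) ≤ c * (Wn * F * (E * W^2 * v + E * (hhh + s * Z) + G * (v + s * T)))
      + (8 * d2 + 2560 * n^2 * d1) := by
    rw [hc]
    linarith
  have e6 := mnL hkey (by positivity : 0 ≤ Wn * E * W * v)
  have e7 : 0 ≤ Wn * F * (E * b) := by positivity
  have e8 : c * (Wn * F * (E * (hhh + s * Z))) ≤ C * (Wn * F * (E * (hhh + s * Z))) := by gcongr
  have e9 : c * (Wn * F * (G * (v + s * T))) ≤ C * (Wn * (G * (v + s * T))) := by
    have : Wn * F * (G * (v + s * T)) ≤ Wn * (G * (v + s * T)) := by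
      have := mnL hFl hWn
      rw [mul_one] at this
      gcongr
    exact mul_le_mul hcM this (by positivity) (by linarith)
  linarith
end
section
open Finset
def Gr (n : ℕ) (R r : ℝ) : ℝ := ((√(1 + r^2))^(n-1))⁻¹ * (1 + r^2 + R^2)⁻¹
lemma Gr_int (hn : 0 < n) : ∃ C, 0 ≤ C ∧ ∀ R : ℝ, 1 ≤ R →
    Integrable (fun x : Euc n => Gr n R ‖x‖) ∧ ∫ x : Euc n, Gr n R ‖x‖ ≤ C * R⁻¹ := by
  haveI : Nonempty (Fin n) := ⟨⟨0, hn⟩⟩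
  haveI : Nontrivial (Euc n) := inferInstance
  refine ⟨n * (volume.real (ball (0 : Euc n) 1) * (Real.pi / 2)), by positivity, fun R hR => ?_⟩
  have hR0 : 0 < R := by linarith
  have hdim : Module.finrank ℝ (Euc n) = n := by simp
  have hle : ∀ y : ℝ, 0 < y → y^(n-1) * Gr n R y ≤ R⁻¹^2 * (1 + (R⁻¹ * y)^2)⁻¹ := by
    intro y hy
    have h1 : y ≤ √(1 + y^2) := Real.le_sqrt_of_sq_le (by linarith)
    have h2 : y^(n-1) * ((√(1 + y^2))^(n-1))⁻¹ ≤ 1 := by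
      rw [← div_eq_mul_inv, div_le_one (by positivity)]; exact pow_le_pow_left₀ hy.le h1 _
    have h3 : (1 + y^2 + R^2)⁻¹ ≤ R⁻¹^2 * (1 + (R⁻¹ * y)^2)⁻¹ := by
      have : R⁻¹^2 * (1 + (R⁻¹ * y)^2)⁻¹ = (R^2 + y^2)⁻¹ := by field_simp
      rw [this]; exact inv_anti₀ (by positivity) (by linarith)
    unfold Gr
    have h4 : 0 < (1 + y^2 + R^2)⁻¹ := by positivity
    rw [← mul_assoc]
    exact (mul_le_of_le_one_left h4.le h2).trans h3
  have hm : IntegrableOn (fun y : ℝ => R⁻¹^2 * (1 + (R⁻¹ * y)^2)⁻¹) (Set.Ioi 0) := by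
    apply Integrable.const_mul
    exact (integrable_inv_one_add_sq.comp_mul_left' (inv_pos.2 hR0).ne').integrableOn
  have hcont : Continuous (fun y : ℝ => y^(n-1) * Gr n R y) := by
    unfold Gr
    refine (continuous_pow _).mul (Continuous.mul (Continuous.inv₀ (by fun_prop) ?_) (Continuous.inv₀ (by fun_prop) ?_))
    · intro y; positivity
    · intro y; positivity
  have hI : IntegrableOn (fun y : ℝ => y^(n-1) * Gr n R y) (Set.Ioi 0) := by
    refine Integrable.mono' hm hcont.aestronglyMeasurable ?_
    filter_upwards [ae_restrict_mem measurableSet_Ioi] with y hy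
    have hy' : 0 < y := hy
    rw [Real.norm_of_nonneg]
    · exact hle y hy
    · unfold Gr; positivity
  constructor
  · rw [integrable_fun_norm_addHaar volume (f := Gr n R), hdim]
    simpa only [smul_eq_mul] using hI
  · rw [integral_fun_norm_addHaar volume (Gr n R), hdim]
    simp only [smul_eq_mul, nsmul_eq_mul]
    have : ∫ y in Set.Ioi (0:ℝ), y^(n-1) * Gr n R y ≤ Real.pi / 2 * R⁻¹ := by
      refine (setIntegral_mono_on hI hm measurableSet_Ioi (fun y hy => hle y hy)).trans (le_of_eq ?_)
      rw [integral_const_mul, integral_comp_mul_left_Ioi (fun y => (1 + y^2)⁻¹) 0 (inv_pos.2 hR0)]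
      rw [mul_zero, integral_Ioi_inv_one_add_sq, Real.arctan_zero]
      simp only [smul_eq_mul, inv_inv]
      field_simp; simp
    calc _ ≤ (n:ℝ) * (volume.real (ball (0 : Euc n) 1) * (Real.pi / 2 * R⁻¹)) := by gcongr
      _ = _ := by ring
lemma data_pt (j : ℕ) (hj : 2 ≤ j) (hjn : 2 * j + 2 ≤ n) (R : ℝ) (hR : 1 ≤ R) (x : Euc n) :
    eW x ^ n * ev x (ff n R) ^ (n-3) * eS x ^ j ≤ R^(2*j+1) * (R^n)⁻¹ * Gr n R ‖x‖ := by
  obtain ⟨j, rfl⟩ : ∃ k, j = k + 2 := ⟨j - 2, by omega⟩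
  obtain ⟨e, he⟩ : ∃ e, n = 2 * j + 5 + e := ⟨n - (2*j+5), by omega⟩
  have hR0 : 0 < R := by linarith
  have hl := lam_pos x
  have hf := ff_pos R x
  obtain ⟨Q, hQ⟩ : ∃ Q, Q = lam x / ev x (ff n R) := ⟨_, rfl⟩
  have hQ0 : 0 < Q := by rw [hQ]; positivity
  have hfQ : ev x (ff n R) = lam x / Q := by rw [hQ]; field_simp
  have hw : eW x = (lam x ^ 2)⁻¹ := by rw [ev_w, lam_sq]
  have hQ2 : Q^2 = lam x ^ 2 + R^2 := by
    have := ff_sq' R x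
    rw [hfQ, hw] at this
    field_simp at this
    linarith
  have hlQ : lam x ≤ Q := by nlinarith [sq_nonneg R]
  have hRQ : R ≤ Q := by nlinarith [sq_nonneg (lam x)]
  have hG : Gr n R ‖x‖ = (lam x ^ (n-1))⁻¹ * (Q^2)⁻¹ := by
    unfold Gr; rw [hQ2, lam_sq, lam, ev_sq']
  rw [hG, hfQ, hw, ← lam_sq x]
  have e1 : n - 3 = 2 * j + 2 + e := by omega
  have e2 : n - 1 = 2 * j + 4 + e := by omega
  have hk : lam x ^ (2*j) * R^e ≤ Q^(2*j) * Q^e := by gcongr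
  have p1 : R^(2*(j+2)+1) * (R^n)⁻¹ = (R^e)⁻¹ := by
    rw [show R^n = R^(2*j+5+e) from by rw [← he], show 2*(j+2)+1 = 2*j+5 by ring, pow_add R (2*j+5) e]; field_simp
  have p2 : ((lam x ^ 2)⁻¹)^n = (lam x ^ (2*(2*j+5+e)))⁻¹ := by rw [inv_pow, ← pow_mul, ← he]
  rw [p1, p2, e1, e2, div_pow, ← one_div, ← one_div, ← one_div, ← one_div]
  rw [div_mul_div_comm, div_mul_eq_mul_div, div_mul_div_comm, div_mul_div_comm, div_le_div_iff₀ (by positivity) (by positivity)]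
  have h2 := mnL hk (by positivity : 0 ≤ lam x ^ (4*j+10+2*e) * Q^2)
  calc _ = lam x ^ (4*j+10+2*e) * Q^2 * (lam x ^ (2*j) * R^e) := by ring
    _ ≤ _ := h2
    _ = _ := by ring
lemma data_int (hn : 0 < n) : ∃ C, 0 ≤ C ∧ ∀ j, 2 ≤ j → 2 * j + 2 ≤ n → ∀ R : ℝ, 1 ≤ R →
    Integrable (fun x : Euc n => eW x ^ n * ev x (ff n R) ^ (n-3) * eS x ^ j) ∧
    ∫ x : Euc n, eW x ^ n * ev x (ff n R) ^ (n-3) * eS x ^ j ≤ C * ((R^2)^j * (R^n)⁻¹) := by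
  obtain ⟨C, hC0, hC⟩ := Gr_int hn
  refine ⟨C, hC0, fun j hj hjn R hR => ?_⟩
  obtain ⟨h1, h2⟩ := hC R hR
  have hR0 : 0 < R := by linarith
  have hi : Integrable (fun x : Euc n => eW x ^ n * ev x (ff n R) ^ (n-3) * eS x ^ j) := by
    refine Integrable.mono' (h1.const_mul (R^(2*j+1) * (R^n)⁻¹)) ?_ ?_
    · exact ((((ev_cont _).pow _).mul ((ev_cont _).pow _)).mul ((ev_cont _).pow _)).aestronglyMeasurable
    · refine Filter.Eventually.of_forall fun x => ?_
      rw [Real.norm_of_nonneg]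
      · exact data_pt j hj hjn R hR x
      · have := ev_w_pos x; have := ff_pos R x; have := ev_sq_pos x; positivity
  refine ⟨hi, ?_⟩
  refine (integral_mono hi (h1.const_mul (R^(2*j+1) * (R^n)⁻¹)) (fun x => data_pt j hj hjn R hR x)).trans ?_
  rw [integral_const_mul]
  calc _ ≤ R^(2*j+1) * (R^n)⁻¹ * (C * R⁻¹) := by gcongr
    _ = _ := by rw [pow_succ, pow_mul]; field_simp
lemma N_int {d : ℕ} (hn : 0 < n) (hd : 2 * d + 2 ≤ n) : ∃ C, 0 ≤ C ∧ ∀ (c : Fin n → Fin n → (Fin n → ℕ) → ℝ) (R : ℝ), 1 ≤ R →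
    Integrable (fun x : Euc n => eW x ^ n * ev x (ff n R) ^ (n-3) * NN d c (eS x)) ∧
    ∫ x : Euc n, eW x ^ n * ev x (ff n R) ^ (n-3) * NN d c (eS x) ≤ C * (NN d c (R^2) * (R^n)⁻¹) := by
  obtain ⟨C, hC0, hC⟩ := data_int hn
  refine ⟨C, hC0, fun c R hR => ?_⟩
  have hR0 : 0 < R := by linarith
  have e : ∀ x : Euc n, eW x ^ n * ev x (ff n R) ^ (n-3) * NN d c (eS x) =
    ∑ α ∈ MIdx n d, ∑ i, ∑ k, c i k α ^ 2 * (eW x ^ n * ev x (ff n R) ^ (n-3) * eS x ^ (∑ m, α m)) := by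
    intro x; unfold NN; simp only [mul_sum]
    refine sum_congr rfl fun α _ => sum_congr rfl fun i _ => sum_congr rfl fun k _ => by ring
  have hI : ∀ α ∈ MIdx n d, Integrable fun x : Euc n => (eW x ^ n * ev x (ff n R) ^ (n-3) * eS x ^ (∑ m, α m)) :=
    fun α hα => (hC _ (mem_MIdx hα).1 (by have := (mem_MIdx hα).2; omega) R hR).1
  simp only [e]
  constructor
  · exact integrable_finset_sum _ fun α hα => integrable_finset_sum _ fun i _ => integrable_finset_sum _ fun k _ => (hI α hα).const_mul _
  · rw [integral_finset_sum _ fun α hα => integrable_finset_sum _ fun i _ => integrable_finset_sum _ fun k _ => (hI α hα).const_mul _]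
    unfold NN
    simp only [sum_mul, mul_sum]
    refine sum_le_sum fun α hα => ?_
    rw [integral_finset_sum _ fun i _ => integrable_finset_sum _ fun k _ => (hI α hα).const_mul _]
    refine sum_le_sum fun i _ => ?_
    rw [integral_finset_sum _ fun k _ => (hI α hα).const_mul _]
    refine sum_le_sum fun k _ => ?_
    rw [integral_const_mul]
    have := (hC _ (mem_MIdx hα).1 (by have := (mem_MIdx hα).2; omega) R hR).2
    have h3 := mnL this (sq_nonneg (c i k α))
    linarith
end
section
open Finset
def An (l0 : Fin n) (R : ℝ) : Set (Euc n) := {x | x ∈ HS l0 ∧ R^2/4 ≤ eS x ∧ eS x ≤ 4 * R^2}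
lemma An_sub (l0 : Fin n) (R : ℝ) : An l0 R ⊆ HS l0 := fun _ hx => hx.1
lemma An_compact (l0 : Fin n) (R : ℝ) : IsCompact (An l0 R) := by
  refine (isCompact_closedBall (0 : Euc n) (2 * |R|)).of_isClosed_subset ?_ ?_
  · exact (HS_closed l0).inter ((isClosed_le continuous_const (ev_cont _)).inter (isClosed_le (ev_cont _) continuous_const))
  · intro x hx
    have := hx.2.2
    rw [ev_sq'] at this
    rw [mem_closedBall_zero_iff]
    apply abs_le_of_sq_le_sq' _ (by positivity) |>.2
    rw [mul_pow, sq_abs]; linarith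
lemma An_meas (l0 : Fin n) (R : ℝ) : MeasurableSet (An l0 R) := (An_compact l0 R).isClosed.measurableSet
lemma An_int (l0 : Fin n) (R : ℝ) {f : Euc n → ℝ} (hf : Continuous f) : IntegrableOn f (An l0 R) :=
  hf.continuousOn.integrableOn_compact (An_compact l0 R)
lemma IntOn_mono {l0 : Fin n} {f g : Euc n → ℝ} (hg : IntegrableOn g (HS l0)) (hf : Continuous f)
    (h : ∀ x ∈ HS l0, |f x| ≤ g x) : IntegrableOn f (HS l0) := by
  refine Integrable.mono' hg hf.aestronglyMeasurable ?_
  filter_upwards [ae_restrict_mem (HS_meas l0)] with x hx using h x hx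
lemma a2_nonneg (x : Euc n) (V : Fin n → SA n) : 0 ≤ a2 x V :=
  sum_nonneg fun i _ => sum_nonneg fun k _ => mul_self_nonneg _
lemma a2_cont (V : Fin n → SA n) : Continuous fun x => a2 x V :=
  continuous_finset_sum _ fun i _ => continuous_finset_sum _ fun k _ => (ev_cont _).mul (ev_cont _)
lemma hh_cont (h : Fin n → Fin n → SA n) : Continuous fun x => hh x h :=
  continuous_finset_sum _ fun i _ => continuous_finset_sum _ fun k _ => (ev_cont _).pow 2
lemma bb_cont (V : Fin n → SA n) : Continuous fun x => bb x V := by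
  refine continuous_finset_sum _ fun i _ => continuous_finset_sum _ fun k _ => Continuous.pow ?_ 2
  have hX : ∀ i : Fin n, Continuous fun x : Euc n => x i := fun i => ev_cont (X i)
  unfold Bm
  refine Continuous.sub (Continuous.add (Continuous.sub (ev_cont _) ?_) ?_) ?_
  · exact (continuous_const.mul (ev_cont _)).mul ((hX i).mul (ev_cont _))
  · exact (continuous_const.mul (ev_cont _)).mul ((ev_cont _).mul (hX k))
  · split_ifs
    · exact (continuous_const.mul (ev_cont _)).mul (ev_cont _)
    · exact continuous_const
lemma data_le {d : ℕ} (hn : 2 ≤ n) {l0 : Fin n} {h : Fin n → Fin n → SA n} {c : Fin n → Fin n → (Fin n → ℕ) → ℝ} {C0 : ℝ}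
    (x : Euc n) (hh0 : 0 ≤ C0 * NN d c (eS x))
    (hJ : ∀ i k, J 1 (h i k) x ^ 2 ≤ C0 * NN d c (eS x)) :
    hh x h ≤ n^2 * (C0 * NN d c (eS x)) ∧
    hh x h + eS x * ∑ i, zz l0 h x i * zz l0 h x i ≤ (n^2 + n * ((2*n+1)*(1+2*n))^2) * (C0 * NN d c (eS x)) := by
  set Q := C0 * NN d c (eS x)
  have h1 : hh x h ≤ n^2 * Q := by
    have : ∀ i k, ev x (h i k) ^ 2 ≤ Q := fun i k => by
      refine le_trans ?_ (hJ i k)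
      rw [← sq_abs]; exact pow_le_pow_left₀ (abs_nonneg _) (abs_le_J 1 _ x) 2
    refine (sum_le_sum fun i _ => sum_le_sum fun k _ => this i k).trans (le_of_eq ?_)
    simp; ring
  refine ⟨h1, ?_⟩
  have h2 : ∀ i, eS x * (zz l0 h x i * zz l0 h x i) ≤ ((2*n+1)*(1+2*n))^2 * Q := by
    intro i
    have h3 := zz_le hn l0 h x (√Q) (fun i k => Real.le_sqrt_of_sq_le (hJ i k)) i
    have h4 := pow_le_pow_left₀ (mul_nonneg (lam_pos x).le (abs_nonneg _)) h3 2
    rw [mul_pow, mul_pow, sq_abs, lam_sq, Real.sq_sqrt hh0] at h4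
    linarith
  have h3 : eS x * ∑ i, zz l0 h x i * zz l0 h x i ≤ n * (((2*n+1)*(1+2*n))^2 * Q) := by
    rw [mul_sum]
    exact (sum_le_sum fun i _ => h2 i).trans (by simp)
  linarith
lemma NN_grow (d : ℕ) (c : Fin n → Fin n → (Fin n → ℕ) → ℝ) {R : ℝ} (hR : 1 ≤ R) :
    R^3 * NN d c 1 ≤ NN d c (R^2) := by
  unfold NN
  simp only [mul_sum]
  refine sum_le_sum fun α hα => sum_le_sum fun i _ => sum_le_sum fun k _ => ?_
  have h1 : R^3 ≤ (R^2)^(∑ m, α m) := by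
    rw [← pow_mul]; exact pow_le_pow_right₀ hR (by have := (mem_MIdx hα).1; omega)
  rw [one_pow, mul_one, mul_comm]
  gcongr
def g0 (τ : ℝ) : ℝ := Real.smoothTransition (2 - τ)
lemma g0_sm : ContDiff ℝ (⊤ : ℕ∞) g0 := Real.smoothTransition.contDiff.comp (contDiff_const.sub contDiff_id)
lemma g0_one {τ : ℝ} (h : τ ≤ 1) : g0 τ = 1 := Real.smoothTransition.one_of_one_le (by linarith)
lemma g0_zero {τ : ℝ} (h : 2 ≤ τ) : g0 τ = 0 := Real.smoothTransition.zero_of_nonpos (by linarith)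
lemma eta_ex (n : ℕ) : ∃ C, 0 ≤ C ∧ ∀ S : ℝ, 1 ≤ S → ∃ η : SA n, (∀ x, 2 * S ≤ ‖x‖ → ev x η = 0) ∧
    (∀ x, eS x ≤ S^2 → ev x η = 1) ∧ (∀ x, ev x η ^ 2 ≤ 1) ∧
    (∀ x, g2 x η ≤ C * eW x) ∧ (∀ x, eS x < S^2 → g2 x η = 0) := by
  obtain ⟨C, hC0, hC⟩ := cut_J (n := n) 1 g0_sm (a := 2) (by norm_num) (fun τ hτ => g0_zero hτ.le)
  refine ⟨n * C^2, by positivity, fun S hS => ⟨cut g0 g0_sm (1/S^2) 0, ?_, ?_, ?_, ?_, ?_⟩⟩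
  · intro x hx
    rw [ev_cut, sub_zero]
    apply g0_zero
    rw [ev_sq', one_div_mul_eq_div, le_div_iff₀ (by positivity)]
    nlinarith [norm_nonneg x]
  · intro x hx
    rw [ev_cut, sub_zero]
    apply g0_one
    rw [one_div_mul_eq_div, div_le_one (by positivity)]; exact hx
  · intro x
    rw [ev_cut]
    exact pow_le_one₀ (Real.smoothTransition.nonneg _) (Real.smoothTransition.le_one _)
  · intro x
    have h1 : ∀ i, ev x (D i (cut g0 g0_sm (1/S^2) 0)) * ev x (D i (cut g0 g0_sm (1/S^2) 0)) ≤ C^2 * eW x := by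
      intro i
      have h2 := (J_D 0 _ x i).trans (hC (1/S^2) 0 (by positivity) le_rfl (by norm_num) x)
      have h3 := pow_le_pow_left₀ (mul_nonneg (lam_pos x).le (J_nonneg 0 _ x)) h2 2
      simp only [J, mul_pow, sq_abs, lam_sq] at h3
      have h4 := ev_w_pos x
      have h5 : eW x * eS x = 1 := by rw [ev_sq]; exact ev_w_mul x
      have h6 := mnL h3 h4.le
      rw [← mul_assoc, h5] at h6
      linarith
    exact (sum_le_sum fun i _ => h1 i).trans (by simp; linarith)
  · intro x hx
    unfold g2
    refine sum_eq_zero fun i _ => ?_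
    have : ev x (D i (cut g0 g0_sm (1/S^2) 0)) = 0 := by
      rw [D_cut, ev_smul, map_mul, ev_cut]
      have : deriv g0 (1/S^2 * eS x - 0) = 0 := by
        have h1 : 1/S^2 * eS x - 0 < 1 := by
          rw [sub_zero, one_div_mul_eq_div, div_lt_one (by positivity)]; exact hx
        have : g0 =ᶠ[nhds (1/S^2 * eS x - 0)] fun _ => 1 := by
          filter_upwards [Iio_mem_nhds h1] with z hz using g0_one (le_of_lt hz)
        rw [this.deriv_eq]; simp
      rw [this]; simp
    rw [this]; simp
end
section
open Finset
lemma NN_cont {d : ℕ} (c : Fin n → Fin n → (Fin n → ℕ) → ℝ) : Continuous fun τ => NN d c τ := by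
  unfold NN; fun_prop
lemma tail_zero {l0 : Fin n} {E : Euc n → ℝ} (hE : IntegrableOn E (HS l0)) :
    Filter.Tendsto (fun k : ℕ => ∫ x in HS l0, Set.indicator {x : Euc n | ((k:ℝ)+1)^2 ≤ eS x} E x) Filter.atTop (nhds 0) := by
  have : Filter.Tendsto (fun k : ℕ => ∫ x in HS l0, Set.indicator {x : Euc n | ((k:ℝ)+1)^2 ≤ eS x} E x) Filter.atTop
      (nhds (∫ x in HS l0, (0:ℝ))) := by
    apply tendsto_integral_of_dominated_convergence (fun x => ‖E x‖)
    · intro k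
      exact (hE.1.indicator (isClosed_le continuous_const (ev_cont _)).measurableSet)
    · exact hE.norm
    · intro k
      exact Filter.Eventually.of_forall fun x => norm_indicator_le_norm_self _ _
    · refine Filter.Eventually.of_forall fun x => ?_
      apply tendsto_const_nhds.congr'
      obtain ⟨m, hm⟩ := exists_nat_ge (eS x)
      filter_upwards [Filter.eventually_ge_atTop m] with k hk
      rw [Set.indicator_of_notMem]
      simp only [Set.mem_setOf_eq, not_le]
      have : (m:ℝ) ≤ k := by exact_mod_cast hk
      have : (0:ℝ) ≤ k := by positivity
      nlinarith
  simpa using this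
lemma wN_int {d : ℕ} (hn : 6 ≤ n) (hd : 2 * d + 2 ≤ n) : ∃ C, 0 ≤ C ∧ ∀ (c : Fin n → Fin n → (Fin n → ℕ) → ℝ),
    Integrable (fun x : Euc n => eW x ^ n * NN d c (eS x)) ∧
    ∫ x : Euc n, eW x ^ n * NN d c (eS x) ≤ C * NN d c 1 := by
  obtain ⟨C, hC0, hC⟩ := N_int (n := n) (d := d) (by omega) hd
  refine ⟨2^(n-3) * C, by positivity, fun c => ?_⟩
  obtain ⟨h1, h2⟩ := hC c 1 le_rfl
  have hN : ∀ x : Euc n, 0 ≤ NN d c (eS x) := fun x => NN_nonneg d c (by linarith [ev_sq_pos x])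
  have hp : ∀ x : Euc n, eW x ^ n * NN d c (eS x) ≤ 2^(n-3) * (eW x ^ n * ev x (ff n 1) ^ (n-3) * NN d c (eS x)) := by
    intro x
    have e1 := ff_sq' 1 x
    have e2 := ff_pos 1 x
    have e3 := ff_le 1 x
    have e4 := ev_w_le x
    have e5 := ev_w_pos x
    have e6 : 1 ≤ 2 * ev x (ff n 1) := by nlinarith [mul_nonneg (sq_nonneg (ev x (ff n 1))) (sub_nonneg.2 e4)]
    have e7 : (1:ℝ) ≤ 2^(n-3) * ev x (ff n 1) ^ (n-3) := by rw [← mul_pow]; exact one_le_pow₀ e6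
    have e8 := mnL e7 (mul_nonneg (pow_pos e5 n).le (hN x))
    linarith
  have hi : Integrable (fun x : Euc n => eW x ^ n * NN d c (eS x)) := by
    refine Integrable.mono' (h1.const_mul (2^(n-3))) ?_ ?_
    · exact (((ev_cont _).pow _).mul ((NN_cont c).comp (ev_cont _))).aestronglyMeasurable
    · refine Filter.Eventually.of_forall fun x => ?_
      rw [Real.norm_of_nonneg]
      · exact hp x
      · exact mul_nonneg (pow_pos (ev_w_pos x) n).le (hN x)
  refine ⟨hi, (integral_mono hi (h1.const_mul (2^(n-3))) hp).trans ?_⟩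
  rw [integral_const_mul]
  have := mnL h2 (by positivity : (0:ℝ) ≤ 2^(n-3))
  simp only [one_pow, inv_one, mul_one] at this
  linarith
lemma main_energy {d : ℕ} (hn : 6 ≤ n) (hd : 2 * d + 2 ≤ n) (K C0 : ℝ) (hK : 0 ≤ K) (hC0 : 0 ≤ C0) :
    ∃ C, 0 ≤ C ∧ ∀ (l0 : Fin n) (c : Fin n → Fin n → (Fin n → ℕ) → ℝ) (h : Fin n → Fin n → SA n) (V : Fin n → SA n),
    Sys l0 h V → (∀ x i k, J 1 (h i k) x ^ 2 ≤ C0 * NN d c (eS x)) →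
    (∫ x in HS l0, eW x ^ (n+2) * ev x (V2 V) ≤ K * ∫ x in HS l0, eW x ^ n * hh x h) →
    IntegrableOn (fun x => eW x ^ n * a2 x V) (HS l0) →
    IntegrableOn (fun x => eW x ^ (n+1) * ev x (V2 V)) (HS l0) →
    ∀ R : ℝ, 1 ≤ R → ∫ x in An l0 R, (a2 x V + eW x * ev x (V2 V)) ≤ C * (R^n * NN d c (R^2)) := by
  obtain ⟨C1, hC1, H1⟩ := comb_pt hn
  obtain ⟨C2, hC2, H2⟩ := N_int (n := n) (d := d) (by omega) hd
  obtain ⟨C3, hC3, H3⟩ := wN_int hn hd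
  obtain ⟨C4, hC4, H4⟩ := eta_ex n
  set q : ℝ := (n^2 + n * ((2*n+1)*(1+2*n))^2) * C0 with hq
  have hq0 : 0 ≤ q := by positivity
  refine ⟨(33 + 16 * n) * (4^n * 5^(n-3)) * (C1 * q * C2 + C1 * (K * (n^2 * C0 * C3))), by positivity,
    fun l0 c h V HS' hJ hc ha hv R hR => ?_⟩
  have hR0 : 0 < R := by linarith
  have hN : ∀ x : Euc n, 0 ≤ NN d c (eS x) := fun x => NN_nonneg d c (by linarith [ev_sq_pos x])
  have hdl := fun x => data_le (by omega : 2 ≤ n) (l0 := l0) x (mul_nonneg hC0 (hN x)) (hJ x)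
  have hhint : ∫ x in HS l0, eW x ^ n * hh x h ≤ n^2 * C0 * C3 * NN d c 1 := by
    obtain ⟨i1, i2⟩ := H3 c
    have e1 : ∫ x in HS l0, eW x ^ n * hh x h ≤ ∫ x in HS l0, n^2 * C0 * (eW x ^ n * NN d c (eS x)) := by
      have hle : ∀ x, eW x ^ n * hh x h ≤ n^2 * C0 * (eW x ^ n * NN d c (eS x)) := by
        intro x
        have := mnL (hdl x).1 (pow_pos (ev_w_pos x) n).le
        linarith
      refine setIntegral_mono_on ?_ (i1.integrableOn.const_mul _) (HS_meas l0) (fun x _ => hle x)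
      refine IntOn_mono (i1.integrableOn.const_mul (n^2 * C0)) (((ev_cont _).pow _).mul (hh_cont h)) (fun x _ => ?_)
      rw [abs_of_nonneg (mul_nonneg (pow_pos (ev_w_pos x) n).le (hh_nonneg x h))]
      exact hle x
    have e2 : ∫ x in HS l0, eW x ^ n * NN d c (eS x) ≤ ∫ x : Euc n, eW x ^ n * NN d c (eS x) :=
      setIntegral_le_integral i1 (Filter.Eventually.of_forall fun x => mul_nonneg (pow_pos (ev_w_pos x) n).le (hN x))
    rw [integral_const_mul] at e1
    have := mnL (e2.trans i2) (by positivity : 0 ≤ n^2 * C0)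
    linarith
  have hvint : ∫ x in HS l0, eW x ^ (n+2) * ev x (V2 V) ≤ K * (n^2 * C0 * C3 * NN d c 1) :=
    hc.trans (mnL hhint hK)
  have hv2 : IntegrableOn (fun x => eW x ^ (n+2) * ev x (V2 V)) (HS l0) := by
    refine IntOn_mono hv (((ev_cont _).pow _).mul (ev_cont _)) (fun x _ => ?_)
    have := ev_w_pos x
    have := V2_nonneg x V
    rw [abs_of_nonneg (by positivity)]
    have := pow_le_pow_of_le_one (ev_w_pos x).le (ev_w_le x) (by omega : n + 1 ≤ n + 2)
    gcongr
  set E : Euc n → ℝ := fun x => C1 * C4 * (eW x ^ (n+1) * ev x (V2 V) + eW x ^ n * ev x (Tf V) ^ 2) with hEd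
  have hT : IntegrableOn (fun x => eW x ^ n * ev x (Tf V) ^ 2) (HS l0) := by
    refine IntOn_mono ((ha.add hv).const_mul (2 * n + 8 * n^2)) (((ev_cont _).pow _).mul ((ev_cont _).pow _)) (fun x _ => ?_)
    have h1 := ev_w_pos x
    rw [abs_of_nonneg (by positivity)]
    have h2 := mnL (Tf_sq x V) (pow_pos h1 n).le
    simp only [Pi.add_apply]
    rw [pow_succ (eW x) n]
    linarith
  have hEi : IntegrableOn E (HS l0) := (hv.add hT).const_mul _
  have hE0 : ∀ x, 0 ≤ E x := fun x => by
    have := ev_w_pos x; have := V2_nonneg x V; simp only [hEd]; positivity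
  have hdat := H2 c R hR
  set Gd : Euc n → ℝ := fun x => C1 * q * (eW x ^ n * ev x (ff n R) ^ (n-3) * NN d c (eS x))
    + C1 * (R^(n-3))⁻¹ * (eW x ^ (n+2) * ev x (V2 V)) with hGd
  have hGi : IntegrableOn Gd (HS l0) := (hdat.1.integrableOn.const_mul _).add (hv2.const_mul _)
  have hb0 : ∀ x, 0 ≤ bb x V + eW x * ev x (V2 V) := fun x =>
    add_nonneg (bb_nonneg x V) (mul_nonneg (ev_w_pos x).le (V2_nonneg x V))
  have hbc : Continuous fun x => bb x V + eW x * ev x (V2 V) := (bb_cont V).add ((ev_cont _).mul (ev_cont _))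
  have key : ∀ k : ℕ, 2 * R ≤ (k:ℝ) + 1 → ∫ x in An l0 R, eW x ^ n * ev x (ff n R) ^ (n-3) * (bb x V + eW x * ev x (V2 V))
      ≤ (∫ x in HS l0, Gd x) + ∫ x in HS l0, Set.indicator {x : Euc n | ((k:ℝ)+1)^2 ≤ eS x} E x := by
    intro k hk
    obtain ⟨η, hη1, hη2, hη3, hη4, hη5⟩ := H4 ((k:ℝ)+1) (by linarith [(Nat.cast_nonneg k : (0:ℝ) ≤ k)])
    obtain ⟨Y, hY1, hY2, hY3⟩ := H1 HS' R hR0 η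
    set f : Euc n → ℝ := fun x => eW x ^ n * ev x (ff n R) ^ (n-3) * (ev x η ^ 2 * (bb x V + eW x * ev x (V2 V))) with hfd
    have hf0 : ∀ x, 0 ≤ f x := fun x => by
      have := ev_w_pos x; have := ff_pos R x; have := hb0 x; simp only [hfd]; positivity
    have hfc : Continuous f := (((ev_cont _).pow _).mul ((ev_cont _).pow _)).mul (((ev_cont _).pow _).mul hbc)
    have hfi : Integrable f := by
      apply intble_of_supp hfc (2 * ((k:ℝ)+1))
      intro x hx; simp only [hfd, hη1 x hx]; simp
    have hIi : IntegrableOn (Set.indicator {x : Euc n | ((k:ℝ)+1)^2 ≤ eS x} E) (HS l0) :=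
      Integrable.indicator hEi (isClosed_le continuous_const (ev_cont _)).measurableSet
    have hen := energy l0 Y (2 * ((k:ℝ)+1)) (hY1 _ hη1) hY2 (f := f)
      (g := fun x => Gd x + Set.indicator {x : Euc n | ((k:ℝ)+1)^2 ≤ eS x} E x) hfi.integrableOn (hGi.add hIi) (by
        intro x hx
        have h1 := hY3 x hx
        have hw := ev_w_pos x
        have hf := ff_pos R x
        have hv := V2_nonneg x V
        have hs := ev_sq_pos x
        have t1 : C1 * (eW x ^ n * ev x (ff n R) ^ (n-3) * (ev x η ^ 2 * (hh x h + eS x * ∑ i, zz l0 h x i * zz l0 h x i)))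
            ≤ C1 * q * (eW x ^ n * ev x (ff n R) ^ (n-3) * NN d c (eS x)) := by
          have e1 := (hdl x).2
          have hz : 0 ≤ hh x h + eS x * ∑ i, zz l0 h x i * zz l0 h x i :=
            add_nonneg (hh_nonneg x h) (mul_nonneg (by linarith) (sum_nonneg fun i _ => mul_self_nonneg _))
          have e2 : ev x η ^ 2 * (hh x h + eS x * ∑ i, zz l0 h x i * zz l0 h x i) ≤ q * NN d c (eS x) := by
            refine (mul_le_of_le_one_left hz (hη3 x)).trans (e1.trans (le_of_eq ?_))
            rw [hq]; ring
          calc _ ≤ C1 * (eW x ^ n * ev x (ff n R) ^ (n-3) * (q * NN d c (eS x))) := by gcongr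
            _ = _ := by ring
        have t2 : C1 * ((R^(n-3))⁻¹ * (ev x η ^ 2 * (eW x ^ (n+2) * ev x (V2 V)))) ≤ C1 * (R^(n-3))⁻¹ * (eW x ^ (n+2) * ev x (V2 V)) := by
          have e1 := mul_le_of_le_one_left (by positivity : 0 ≤ eW x^(n+2)*ev x (V2 V)) (hη3 x)
          have := mnL e1 (by positivity : 0 ≤ C1*(R^(n-3))⁻¹)
          linarith
        have t3 : C1 * (eW x ^ n * (g2 x η * (ev x (V2 V) + eS x * ev x (Tf V) ^ 2))) ≤
            Set.indicator {x : Euc n | ((k:ℝ)+1)^2 ≤ eS x} E x := by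
          by_cases hc : ((k:ℝ)+1)^2 ≤ eS x
          · rw [Set.indicator_of_mem (show x ∈ {x : Euc n | ((k:ℝ)+1)^2 ≤ eS x} from hc)]
            have hws : eW x * eS x = 1 := by rw [ev_sq]; exact ev_w_mul x
            have e1 : g2 x η * (ev x (V2 V) + eS x * ev x (Tf V) ^ 2) ≤ (C4 * eW x) * (ev x (V2 V) + eS x * ev x (Tf V) ^ 2) := by
              have := hη4 x
              gcongr
            calc _ ≤ C1 * (eW x ^ n * ((C4 * eW x) * (ev x (V2 V) + eS x * ev x (Tf V) ^ 2))) := by gcongr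
              _ = C1 * C4 * (eW x ^ (n+1) * ev x (V2 V) + eW x ^ n * ev x (Tf V) ^ 2 * (eW x * eS x)) := by ring
              _ = _ := by rw [hws, mul_one]
          · rw [Set.indicator_of_notMem (show x ∉ {x : Euc n | ((k:ℝ)+1)^2 ≤ eS x} from hc), hη5 x (not_le.1 hc)]
            simp
        simp only [hfd, hGd]
        linarith)
    rw [integral_add hGi hIi] at hen
    refine le_trans ?_ hen
    have e1 : ∫ x in An l0 R, eW x ^ n * ev x (ff n R) ^ (n-3) * (bb x V + eW x * ev x (V2 V)) = ∫ x in An l0 R, f x := by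
      apply setIntegral_congr_fun (An_meas l0 R)
      intro x hx
      have : ev x η = 1 := hη2 x (hx.2.2.trans (by nlinarith))
      simp only [hfd, this]; ring
    rw [e1]
    exact setIntegral_mono_set hfi.integrableOn (Filter.Eventually.of_forall hf0) (An_sub l0 R).eventuallyLE
  have key2 : ∫ x in An l0 R, eW x ^ n * ev x (ff n R) ^ (n-3) * (bb x V + eW x * ev x (V2 V)) ≤ ∫ x in HS l0, Gd x := by
    have ht := (tail_zero hEi).const_add (∫ x in HS l0, Gd x)
    rw [add_zero] at ht
    refine ge_of_tendsto ht ?_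
    obtain ⟨m, hm⟩ := exists_nat_ge (2 * R)
    filter_upwards [Filter.eventually_ge_atTop m] with k hk
    apply key k
    have : (m:ℝ) ≤ k := by exact_mod_cast hk
    linarith
  have hGint : ∫ x in HS l0, Gd x ≤ (C1 * q * C2 + C1 * (K * (n^2 * C0 * C3))) * (NN d c (R^2) * (R^n)⁻¹) := by
    rw [hGd, integral_add (hdat.1.integrableOn.const_mul _) (hv2.const_mul _), integral_const_mul, integral_const_mul]
    have e2 : ∫ x in HS l0, eW x ^ n * ev x (ff n R) ^ (n-3) * NN d c (eS x) ≤ C2 * (NN d c (R^2) * (R^n)⁻¹) :=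
      (setIntegral_le_integral hdat.1 (Filter.Eventually.of_forall fun x => by
        have := ev_w_pos x; have := ff_pos R x; have := hN x; simp only [Pi.zero_apply]; positivity)).trans hdat.2
    have e3 : (R^(n-3))⁻¹ * NN d c 1 ≤ NN d c (R^2) * (R^n)⁻¹ := by
      have e4 : (R^n)⁻¹ = (R^(n-3))⁻¹ * (R^3)⁻¹ := by
        rw [← mul_inv, ← pow_add]; congr 2; omega
      have e5 := NN_grow d c hR
      rw [e4, mul_comm (NN d c (R^2)), mul_assoc]
      gcongr
      rw [← div_eq_inv_mul, le_div_iff₀ (by positivity)]; linarith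
    have e6 := mnL e2 (by positivity : 0 ≤ C1 * q)
    have e7 := mnL hvint (by positivity : 0 ≤ C1 * (R^(n-3))⁻¹)
    have e8 := mnL e3 (by positivity : 0 ≤ C1 * (K * (n^2 * C0 * C3)))
    linarith
  have hpt : ∀ x ∈ An l0 R, a2 x V + eW x * ev x (V2 V) ≤ (33 + 16 * n) * (4^n * 5^(n-3)) * (R^(2*n)) *
      (eW x ^ n * ev x (ff n R) ^ (n-3) * (bb x V + eW x * ev x (V2 V))) := by
    intro x hx
    have hw := ev_w_pos x
    have hws : eW x * eS x = 1 := by rw [ev_sq]; exact ev_w_mul x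
    have h1 := a2_le x V
    have hv := mul_nonneg hw.le (V2_nonneg x V)
    have h2 : a2 x V + eW x * ev x (V2 V) ≤ (33 + 16 * n) * (bb x V + eW x * ev x (V2 V)) := by
      have := bb_nonneg x V
      linarith
    have h3 : 1 ≤ (4 * R^2) * eW x := by
      have := mnL hx.2.2 hw.le
      linarith
    have h4 : 1 ≤ 5 * ev x (ff n R) := by
      have e1 := ff_sq' R x
      have e2 := ff_pos R x
      have e3 := ff_le R x
      have e4 : R^2 * eW x ≤ 4 := by
        have := mnL hx.2.1 hw.le
        linarith
      nlinarith [mul_nonneg (sq_nonneg (ev x (ff n R))) (sub_nonneg.2 e4)]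
    have h5 : 1 ≤ 4^n * R^(2*n) * eW x ^ n := by
      have := one_le_pow₀ h3 (n := n)
      rwa [mul_pow, mul_pow, ← pow_mul] at this
    have h6 : (1:ℝ) ≤ 5^(n-3) * ev x (ff n R) ^ (n-3) := by rw [← mul_pow]; exact one_le_pow₀ h4
    have h7 := one_le_mul_of_one_le_of_one_le h5 h6
    have h8 := mnL h7 (mul_nonneg (by positivity : (0:ℝ) ≤ 33 + 16 * n) (hb0 x))
    refine h2.trans ?_
    linarith
  have hfin := setIntegral_mono_on (An_int l0 R ((a2_cont V).add ((ev_cont (w n)).mul (ev_cont (V2 V)))))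
    ((An_int l0 R ((((ev_cont (w n)).pow n).mul ((ev_cont (ff n R)).pow (n-3))).mul hbc)).const_mul
      ((33 + 16 * n) * (4^n * 5^(n-3)) * (R^(2*n)))) (An_meas l0 R) hpt
  rw [integral_const_mul] at hfin
  refine hfin.trans ?_
  have e1 := mnL (key2.trans hGint) (by positivity : (0:ℝ) ≤ (33 + 16 * n) * (4^n * 5^(n-3)) * (R^(2*n)))
  refine e1.trans (le_of_eq ?_)
  have : R^(2*n) * (R^n)⁻¹ = R^n := by rw [two_mul, pow_add]; field_simp
  generalize (R^n)⁻¹ = z at this ⊢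
  rw [← this]; ring
end
section
open Finset
lemma dv_sum {ι : Type*} (x : Euc n) (s : Finset ι) (P : ι → Fin n → SA n) :
    dv x (fun k => ∑ i ∈ s, P i k) = ∑ i ∈ s, dv x (P i) := by
  unfold dv
  simp only [map_sum]
  exact sum_comm
def Zf (l0 m : Fin n) (ζ : SA n) (Y W Φ : Fin n → SA n) (k : Fin n) : SA n :=
  ∑ i, (ζ * ζ * Y i) * (D k (Y i) - (if k = l0 then W i else 0) - (if k = m then Φ i else 0))
lemma Zf_dv (l0 m : Fin n) (ζ : SA n) (Y W Φ : Fin n → SA n) (x : Euc n) :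
    dv x (Zf l0 m ζ Y W Φ) = ∑ i, (ev x ζ * ev x ζ * ev x (Y i) * (∑ k, ev x (D k (D k (Y i))) - ev x (D l0 (W i)) - ev x (D m (Φ i)))
      + (∑ k, (2 * ev x ζ * ev x (D k ζ) * ev x (Y i) + ev x ζ * ev x ζ * ev x (D k (Y i))) * ev x (D k (Y i))
        - (2 * ev x ζ * ev x (D l0 ζ) * ev x (Y i) + ev x ζ * ev x ζ * ev x (D l0 (Y i))) * ev x (W i)
        - (2 * ev x ζ * ev x (D m ζ) * ev x (Y i) + ev x ζ * ev x ζ * ev x (D m (Y i))) * ev x (Φ i))) := by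
  unfold Zf
  rw [dv_sum]
  refine sum_congr rfl fun i _ => ?_
  rw [dv_mul]
  congr 1
  · rw [map_mul, map_mul]
    congr 1
    unfold dv
    simp only [map_sub, sum_sub_distrib, apply_ite (D _), apply_ite (ev x), map_zero]
    congr 1
    · congr 1
      simp
    · simp
  · simp only [map_sub, mul_sub, sum_sub_distrib, apply_ite (ev x), map_zero, mul_ite, mul_zero, sum_ite_eq', mem_univ, if_true]
    simp only [D_mul, map_add, map_mul]
    congr 1
    · congr 1
      · refine sum_congr rfl fun k _ => ?_
        ring
      · ring
    · ring
lemma cacc_sc (l0 m : Fin n) (z y W Φ : ℝ) (zk a : Fin n → ℝ) :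
    1/2 * (z * z * ∑ k, a k * a k) ≤ (∑ k, (2 * z * zk k * y + z * z * a k) * a k
        - (2 * z * zk l0 * y + z * z * a l0) * W - (2 * z * zk m * y + z * z * a m) * Φ)
      + 6 * ((∑ k, zk k * zk k) * (y * y)) + 3 * (z * z * (W * W + Φ * Φ)) := by
  have h1 : 3/4 * (z * z * ∑ k, a k * a k) ≤ ∑ k, (2 * z * zk k * y + z * z * a k) * a k + 4 * ((∑ k, zk k * zk k) * (y * y)) := by
    rw [mul_sum, mul_sum, sum_mul, mul_sum, ← sum_add_distrib]
    refine sum_le_sum fun k _ => ?_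
    nlinarith [sq_nonneg (z * a k / 2 + 2 * zk k * y)]
  have h2 : ∀ l, a l * a l ≤ ∑ k, a k * a k := fun l =>
    single_le_sum (f := fun k => a k * a k) (fun i _ => mul_self_nonneg _) (mem_univ l)
  have h3 : ∀ l, zk l * zk l ≤ ∑ k, zk k * zk k := fun l =>
    single_le_sum (f := fun k => zk k * zk k) (fun i _ => mul_self_nonneg _) (mem_univ l)
  have h4 : ∀ l U, (2 * z * zk l * y + z * z * a l) * U ≤ (∑ k, zk k * zk k) * (y * y) + 3 * (z * z * (U * U)) + 1/8 * (z * z * ∑ k, a k * a k) := by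
    intro l U
    have e1 := mnR (h3 l) (mul_self_nonneg y)
    have e2 := mnL (h2 l) (mul_self_nonneg z)
    nlinarith [sq_nonneg (zk l * y - z * U), sq_nonneg (z * a l - 4 * z * U)]
  have h5 := h4 l0 W
  have h6 := h4 m Φ
  linarith
lemma cacc_pt (hn : 2 ≤ n) (l0 m : Fin n) (ζ : SA n) (Y W Φ : Fin n → SA n) (x : Euc n) (P Q : ℝ) (hQ : 0 < Q) (hPQ : P * Q = 1)
    (heq : ∀ i, ∑ k, ev x (D k (D k (Y i))) + (1 - 2 / (n:ℝ)) * ev x (D i (T0 Y)) = ev x (D m (Φ i))) :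
    ev x ζ * ev x ζ * a2 x Y ≤ 2 * (7 * (g2 x ζ * ev x (V2 Y)) + 3 * (ev x ζ * ev x ζ * (ev x (V2 W) + ev x (V2 Φ)))
      + ev x ζ * ev x ζ * (Q * ev x (V2 Y) + P * ev x (V2 fun i => D l0 (W i))))
      + ∑ k, ev x (D k ((2:ℝ) • (Zf l0 m ζ Y W Φ k + (1 - 2 / (n:ℝ)) • ((ζ * ζ * T0 Y) * Y k)))) := by
  have hn' : (2:ℝ) ≤ n := by exact_mod_cast hn
  have hc0 : 0 ≤ 1 - 2 / (n:ℝ) := by rw [sub_nonneg, div_le_one (by linarith)]; exact hn'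
  have hc1 : 1 - 2 / (n:ℝ) ≤ 1 := by rw [sub_le_self_iff]; positivity
  generalize 1 - 2 / (n:ℝ) = c at *
  have e1 : ∑ k, ev x (D k ((2:ℝ) • (Zf l0 m ζ Y W Φ k + c • ((ζ * ζ * T0 Y) * Y k)))) =
     2 * (dv x (Zf l0 m ζ Y W Φ) + c * dv x (fun k => (ζ * ζ * T0 Y) * Y k)) := by
    rw [← dv_smul, ← dv_add, ← dv_smul]; rfl
  rw [e1, Zf_dv, dv_mul, dv_V]
  set z := ev x ζ with hz
  have e2 : ∑ i, ev x (D i (ζ * ζ * T0 Y)) * ev x (Y i) = 2 * z * ev x (T0 Y) * ∑ i, ev x (D i ζ) * ev x (Y i)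
      + z * z * ∑ i, ev x (D i (T0 Y)) * ev x (Y i) := by
    rw [mul_sum, mul_sum, ← sum_add_distrib]
    refine sum_congr rfl fun i _ => ?_
    simp only [D_mul, map_add, map_mul, ← hz]; ring
  rw [e2, map_mul, map_mul, ← hz]
  have hcs : (∑ i, ev x (D i ζ) * ev x (Y i))^2 ≤ g2 x ζ * ev x (V2 Y) := by
    have := sum_mul_sq_le_sq_mul_sq univ (fun i => ev x (D i ζ)) (fun i => ev x (Y i))
    rw [ev_V2]; unfold g2
    simpa only [sq] using this
  set β := ∑ i, ev x (D i ζ) * ev x (Y i)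
  have hT : -(g2 x ζ * ev x (V2 Y)) ≤ c * (z * z * ev x (T0 Y) * ev x (T0 Y) + 2 * z * ev x (T0 Y) * β) := by
    nlinarith [mul_nonneg hc0 (sq_nonneg (z * ev x (T0 Y) + β)), mnL hcs hc0,
      mnR hc1 ((sq_nonneg β).trans hcs)]
  have hmain : 1/2 * (z * z * a2 x Y) ≤ ∑ i, (z * z * ev x (Y i) * (∑ k, ev x (D k (D k (Y i))) - ev x (D l0 (W i)) - ev x (D m (Φ i)))
      + (∑ k, (2 * z * ev x (D k ζ) * ev x (Y i) + z * z * ev x (D k (Y i))) * ev x (D k (Y i))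
        - (2 * z * ev x (D l0 ζ) * ev x (Y i) + z * z * ev x (D l0 (Y i))) * ev x (W i)
        - (2 * z * ev x (D m ζ) * ev x (Y i) + z * z * ev x (D m (Y i))) * ev x (Φ i)))
       + c * (z * z * ∑ i, ev x (D i (T0 Y)) * ev x (Y i)) + 6 * (g2 x ζ * ev x (V2 Y)) + 3 * (z * z * (ev x (V2 W) + ev x (V2 Φ)))
       + z * z * (Q * ev x (V2 Y) + P * ev x (V2 fun i => D l0 (W i))) := by
    unfold a2
    rw [sum_comm]
    simp only [ev_V2, mul_sum, ← sum_add_distrib]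
    refine sum_le_sum fun i _ => ?_
    have h1 := cacc_sc l0 m z (ev x (Y i)) (ev x (W i)) (ev x (Φ i)) (fun k => ev x (D k ζ)) (fun k => ev x (D k (Y i)))
    have h2 := heq i
    have h3 : ev x (Y i) * ev x (D l0 (W i)) ≤ Q * (ev x (Y i) * ev x (Y i)) + P * (ev x (D l0 (W i)) * ev x (D l0 (W i))) := by
      generalize ev x (Y i) = y
      generalize ev x (D l0 (W i)) = u
      have hP : 0 < P := by
        by_contra hP
        nlinarith [mul_nonpos_of_nonpos_of_nonneg (not_lt.1 hP) hQ.le]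
      have h5 : 0 ≤ P * (Q * y - u)^2 := by positivity
      have h6 : P * (Q * y - u)^2 = (P * Q) * Q * y^2 - 2 * (P * Q) * (y * u) + P * u^2 := by ring
      rw [h6, hPQ] at h5
      nlinarith [mul_nonneg hQ.le (sq_nonneg y), mul_nonneg hP.le (sq_nonneg u)]
    have h4 := mnL h3 (mul_self_nonneg z)
    simp only [mul_sum] at h1
    unfold g2
    have h7 : ∑ k, ev x (D k (D k (Y i))) = ev x (D m (Φ i)) - c * ev x (D i (T0 Y)) := by linarith
    rw [h7]
    linarith
  linarith
lemma Zf_supp (l0 m : Fin n) (ζ : SA n) (Y W Φ : Fin n → SA n) (k : Fin n) (x : Euc n) (h : ev x ζ = 0) :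
    ev x ((2:ℝ) • (Zf l0 m ζ Y W Φ k + (1 - 2 / (n:ℝ)) • ((ζ * ζ * T0 Y) * Y k))) = 0 := by
  simp [Zf, ev_smul, h, map_sum]
lemma cacc (hn : 2 ≤ n) (l0 m : Fin n) (hm : m ≠ l0) (ζ : SA n) (Y W Φ : Fin n → SA n) (P Q r : ℝ) (hQ : 0 < Q) (hPQ : P * Q = 1)
    (hr : ∀ x, r ≤ ‖x‖ → ev x ζ = 0) (hb1 : ∀ x, x l0 = 0 → ev x (Y l0) = 0)
    (hb2 : ∀ x, x l0 = 0 → ∀ i, i ≠ l0 → ev x (D l0 (Y i)) = ev x (W i))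
    (heq : ∀ x ∈ HS l0, ∀ i, ∑ k, ev x (D k (D k (Y i))) + (1 - 2 / (n:ℝ)) * ev x (D i (T0 Y)) = ev x (D m (Φ i)))
    {g : Euc n → ℝ} (hgi : IntegrableOn g (HS l0))
    (hg : ∀ x ∈ HS l0, 2 * (7 * (g2 x ζ * ev x (V2 Y)) + 3 * (ev x ζ * ev x ζ * (ev x (V2 W) + ev x (V2 Φ)))
      + ev x ζ * ev x ζ * (Q * ev x (V2 Y) + P * ev x (V2 fun i => D l0 (W i)))) ≤ g x) :
    ∫ x in HS l0, ev x ζ * ev x ζ * a2 x Y ≤ ∫ x in HS l0, g x := by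
  refine energy l0 (fun k => (2:ℝ) • (Zf l0 m ζ Y W Φ k + (1 - 2 / (n:ℝ)) • ((ζ * ζ * T0 Y) * Y k))) r ?_ ?_ ?_ hgi ?_
  · intro i x hx; exact Zf_supp _ _ _ _ _ _ _ _ (hr x hx)
  · intro x hx
    have h1 : ev x (Zf l0 m ζ Y W Φ l0) = 0 := by
      simp only [Zf, map_sum]
      apply sum_eq_zero; intro i _
      by_cases hi : i = l0
      · subst hi; simp [hb1 x hx]
      · simp [hb2 x hx i hi, hm.symm]
    simp [ev_smul, h1, hb1 x hx]
  · apply Integrable.integrableOn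
    apply intble_of_supp (((ev_cont _).mul (ev_cont _)).mul (a2_cont _)) r
    intro x hx; simp [hr x hx]
  · intro x hx
    have := cacc_pt hn l0 m ζ Y W Φ x P Q hQ hPQ (heq x hx)
    have := hg x hx
    linarith
end
section
open Finset
structure Dat {n : ℕ} (d : ℕ) (l0 : Fin n) (H : ℕ → ℝ) (M : ℝ) where
  c : Fin n → Fin n → (Fin n → ℕ) → ℝ
  h : Fin n → Fin n → SA n
  V : Fin n → SA n
  sys : Sys l0 h V
  hJ : ∀ k x i j, J k (h i j) x ^ 2 ≤ H k * NN d c (eS x)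
  en : ∀ R : ℝ, 1 ≤ R → ∫ x in An l0 R, (a2 x V + eW x * ev x (V2 V)) ≤ M * (R^n * NN d c (R^2))
variable {d : ℕ} {l0 : Fin n} {H : ℕ → ℝ} {M : ℝ}
def LL (F : Dat d l0 H M → SA n) (m : ℕ) : Prop :=
  ∃ C : ℝ, 0 ≤ C ∧ ∀ (p : Dat d l0 H M) (R : ℝ), 1 ≤ R →
    ∫ x in An l0 R, eS x ^ m * ev x (F p) ^ 2 ≤ C * (R^(n+2) * NN d p.c (R^2))
lemma LL_int (m : ℕ) (f : SA n) (R : ℝ) : IntegrableOn (fun x => eS x ^ m * ev x f ^ 2) (An l0 R) :=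
  An_int _ _ (((ev_cont _).pow _).mul ((ev_cont _).pow _))
lemma LL.mono {F G : Dat d l0 H M → SA n} {m m' : ℕ} (hG : LL G m') (A : ℝ) (hA : 0 ≤ A)
    (h : ∀ p, ∀ x ∈ HS l0, eS x ^ m * ev x (F p) ^ 2 ≤ A * (eS x ^ m' * ev x (G p) ^ 2)) : LL F m := by
  obtain ⟨C, hC, hG⟩ := hG
  refine ⟨A * C, by positivity, fun p R hR => ?_⟩
  have h1 := setIntegral_mono_on (LL_int m (F p) R) ((LL_int m' (G p) R).const_mul A) (An_meas l0 R) (fun x hx => h p x hx.1)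
  rw [integral_const_mul] at h1
  have := mnL (hG p R hR) hA
  linarith
lemma LL.congr {F G : Dat d l0 H M → SA n} {m : ℕ} (hG : LL G m)
    (h : ∀ p, ∀ x ∈ HS l0, ev x (F p) = ev x (G p)) : LL F m :=
  hG.mono 1 zero_le_one (fun p x hx => by rw [h p x hx, one_mul])
lemma LL.add {F G : Dat d l0 H M → SA n} {m : ℕ} (hF : LL F m) (hG : LL G m) : LL (fun p => F p + G p) m := by
  obtain ⟨C, hC, hF⟩ := hF
  obtain ⟨C', hC', hG⟩ := hG
  refine ⟨2 * C + 2 * C', by positivity, fun p R hR => ?_⟩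
  have h1 := setIntegral_mono_on (LL_int m (F p + G p) R) (((LL_int m (F p) R).const_mul 2).add ((LL_int m (G p) R).const_mul 2)) (An_meas l0 R) (fun x hx => by
    simp only [Pi.add_apply, map_add]
    have h2 : 0 ≤ eS x ^ m := pow_nonneg (by linarith [ev_sq_pos x]) _
    nlinarith [mul_nonneg h2 (sq_nonneg (ev x (F p) - ev x (G p)))])
  simp only [Pi.add_apply] at h1
  rw [integral_add ((LL_int m (F p) R).const_mul 2) ((LL_int m (G p) R).const_mul 2), integral_const_mul, integral_const_mul] at h1
  have := hF p R hR
  have := hG p R hR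
  linarith
lemma LL.smul {F : Dat d l0 H M → SA n} {m : ℕ} (hF : LL F m) (c : ℝ) : LL (fun p => c • F p) m :=
  hF.mono (c^2) (sq_nonneg _) (fun p x hx => by rw [ev_smul]; exact le_of_eq (by ring))
lemma LL_zero (m : ℕ) : LL (fun _ : Dat d l0 H M => (0 : SA n)) m :=
  ⟨0, le_rfl, fun p R hR => by simp⟩
lemma LL.sum {ι : Type*} (s : Finset ι) {F : ι → Dat d l0 H M → SA n} {m : ℕ} (hF : ∀ i ∈ s, LL (F i) m) :
    LL (fun p => ∑ i ∈ s, F i p) m := by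
  classical
  induction s using Finset.induction_on with
  | empty => simpa using LL_zero m
  | insert a s ha ih =>
    simp only [sum_insert ha]
    exact (hF a (mem_insert_self _ _)).add (ih fun i hi => hF i (mem_insert_of_mem hi))
lemma LL.sub {F G : Dat d l0 H M → SA n} {m : ℕ} (hF : LL F m) (hG : LL G m) : LL (fun p => F p - G p) m := by
  have := hF.add (hG.smul (-1))
  simpa [sub_eq_add_neg] using this
lemma LL.mul {F : Dat d l0 H M → SA n} {m : ℕ} (hF : LL F m) {g : SA n} {a : ℕ} (hg : Ob (fun _ : Unit => g) (-(a:ℤ))) :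
    LL (fun p => g * F p) (m + a) := by
  obtain ⟨C, hC, hg⟩ := hg 0
  refine hF.mono (C^2) (sq_nonneg _) (fun p x hx => ?_)
  have h1 := hg () x
  have hl := lam_pos x
  simp only [J, zpow_neg, zpow_natCast] at h1
  have h2 : lam x ^ a * |ev x g| ≤ C := by
    have := mnL h1 (pow_pos hl a).le
    refine this.trans (le_of_eq ?_)
    field_simp
  have h3 : eS x ^ a * ev x g ^ 2 ≤ C^2 := by
    rw [← lam_sq, ← sq_abs (ev x g), ← pow_mul, mul_comm 2 a, pow_mul, ← mul_pow]
    exact pow_le_pow_left₀ (by positivity) h2 2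
  have h4 : 0 ≤ eS x ^ m * ev x (F p) ^ 2 := mul_nonneg (pow_nonneg (by linarith [ev_sq_pos x]) _) (sq_nonneg _)
  have := mnR h3 h4
  rw [map_mul, pow_add]
  linarith
lemma Ob.dd {ι : Type*} {F : ι → SA n} {a b : ℤ} (hF : Ob F a) (i : Fin n) (hb : b = a - 1) : Ob (fun t => D i (F t)) b := by
  intro k
  obtain ⟨C, hC0, hC⟩ := hF (k+1)
  refine ⟨C, hC0, fun t x => ?_⟩
  have h1 := (J_D k (F t) x i).trans (hC t x)
  have hl := lam_pos x
  rw [hb, zpow_sub_one₀ hl.ne']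
  rw [← mul_assoc, ← div_eq_mul_inv, le_div_iff₀ hl]
  linarith
def PJ (F : Dat d l0 H M → SA n) (m b : ℕ) : Prop := ∀ L : List (Fin n), L.length ≤ b → LL (fun p => DL L (F p)) (m + L.length)
lemma PJ.mono {F : Dat d l0 H M → SA n} {m b b' : ℕ} (h : PJ F m b) (hb : b' ≤ b) : PJ F m b' := fun L hL => h L (hL.trans hb)
lemma PJ.add {F G : Dat d l0 H M → SA n} {m b : ℕ} (hF : PJ F m b) (hG : PJ G m b) : PJ (fun p => F p + G p) m b := fun L hL => by
  simp only [DL_add]; exact (hF L hL).add (hG L hL)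
lemma PJ.sub {F G : Dat d l0 H M → SA n} {m b : ℕ} (hF : PJ F m b) (hG : PJ G m b) : PJ (fun p => F p - G p) m b := fun L hL => by
  simp only [DL_sub]; exact (hF L hL).sub (hG L hL)
lemma PJ.smul {F : Dat d l0 H M → SA n} {m b : ℕ} (hF : PJ F m b) (c : ℝ) : PJ (fun p => c • F p) m b := fun L hL => by
  simp only [DL_smul]; exact (hF L hL).smul c
lemma PJ.sum {ι : Type*} (s : Finset ι) {F : ι → Dat d l0 H M → SA n} {m b : ℕ} (hF : ∀ i ∈ s, PJ (F i) m b) :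
    PJ (fun p => ∑ i ∈ s, F i p) m b := fun L hL => by
  simp only [DL_sum]; exact LL.sum s fun i hi => hF i hi L hL
lemma PJ.dd {F : Dat d l0 H M → SA n} {m b : ℕ} (hF : PJ F m (b+1)) (i : Fin n) : PJ (fun p => D i (F p)) (m+1) b := fun L hL => by
  have h1 := hF (i :: L) (by simpa using hL)
  simp only [DL_D]
  have e : m + 1 + L.length = m + (i :: L).length := by simp; omega
  rw [e]; exact h1
lemma PJ.mul {b : ℕ} : ∀ {F : Dat d l0 H M → SA n} {m : ℕ} (hF : PJ F m b) {g : SA n} {a : ℕ} (hg : Ob (fun _ : Unit => g) (-(a:ℤ))),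
    PJ (fun p => g * F p) (m+a) b := by
  induction b with
  | zero =>
    intro F m hF g a hg L hL
    have : L = [] := List.length_eq_zero_iff.1 (by omega)
    subst this
    exact (hF [] le_rfl).mul hg
  | succ b ih =>
    intro F m hF g a hg L hL
    cases L with
    | nil => exact (hF [] (by simp)).mul hg
    | cons i L =>
      have hL' : L.length ≤ b := by simpa using hL
      have h1 := ih (hF.mono (Nat.le_succ b)) (a := a+1) (hg.dd i (b := -((a+1:ℕ):ℤ)) (by push_cast; ring)) L hL'
      have h2 := ih (hF.dd i) hg L hL'
      have e1 : m + (a+1) + L.length = m + a + (i :: L).length := by simp; omega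
      have e2 : m + 1 + a + L.length = m + a + (i :: L).length := by simp; omega
      rw [e1] at h1; rw [e2] at h2
      convert h1.add h2 using 2 with p
      show D i (DL L _) = _
      rw [← DL_D, D_mul, DL_add]
lemma An_vol : ∃ C : ℝ, 0 ≤ C ∧ ∀ R : ℝ, 0 ≤ R → (volume (An l0 R)).toReal ≤ C * R^n := by
  refine ⟨2^n * (volume (ball (0 : Euc n) 1)).toReal, by positivity, fun R hR => ?_⟩
  have h1 : An l0 R ⊆ closedBall (0 : Euc n) (2 * R) := by
    intro x hx
    have := hx.2.2
    rw [ev_sq'] at this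
    rw [mem_closedBall_zero_iff]
    exact abs_le_of_sq_le_sq' (by nlinarith) (by linarith) |>.2
  have h2 := ENNReal.toReal_mono (isCompact_closedBall (0 : Euc n) (2 * R)).measure_lt_top.ne (measure_mono h1 (μ := volume))
  refine h2.trans (le_of_eq ?_)
  rw [Measure.addHaar_closedBall _ _ (by linarith), ENNReal.toReal_mul, ENNReal.toReal_ofReal (by positivity), finrank_euclideanSpace_fin]
  ring
lemma LL_h (hH : ∀ k, 0 ≤ H k) (i j : Fin n) (b : ℕ) : PJ (fun p : Dat d l0 H M => p.h i j) 1 b := by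
  intro L _
  obtain ⟨C, hC, hvol⟩ := An_vol (l0 := l0)
  have hk := hH L.length
  refine ⟨4 * (H L.length * 4^d) * C, by positivity, fun p R hR => ?_⟩
  have hN : 0 ≤ NN d p.c (R^2) := NN_nonneg d _ (sq_nonneg R)
  have hb : ∀ x ∈ An l0 R, ‖eS x ^ (1 + L.length) * ev x (DL L (p.h i j)) ^ 2‖ ≤ 4 * R^2 * (H L.length * (4^d * NN d p.c (R^2))) := by
    intro x hx
    have hs := ev_sq_pos x
    have h1 := J_DL L 0 (p.h i j) x
    have h2 := p.hJ L.length x i j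
    rw [zero_add] at h1
    have hl := lam_pos x
    have h3 : eS x ^ L.length * ev x (DL L (p.h i j)) ^ 2 ≤ J L.length (p.h i j) x ^ 2 := by
      rw [← lam_sq, ← sq_abs (ev x (DL L (p.h i j))), ← pow_mul, mul_comm 2 L.length, pow_mul, ← mul_pow]
      exact pow_le_pow_left₀ (mul_nonneg (pow_nonneg hl.le _) (abs_nonneg _)) h1 2
    have h4 : NN d p.c (eS x) ≤ 4^d * NN d p.c (R^2) :=
      (NN_mono d _ (by linarith) hx.2.2).trans (NN_dil d _ (sq_nonneg R) (by norm_num))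
    have h5 := mnL h4 hk
    have h6 : 0 ≤ eS x ^ L.length * ev x (DL L (p.h i j)) ^ 2 := by positivity
    rw [Real.norm_of_nonneg (by positivity), pow_add, pow_one, mul_assoc]
    exact mul_le_mul hx.2.2 (h3.trans (h2.trans h5)) h6 (by positivity)
  have h1 := norm_setIntegral_le_of_norm_le_const (μ := volume) (An_compact l0 R).measure_lt_top hb
  have h2 := (Real.le_norm_self _).trans h1
  refine h2.trans ?_
  have h3 := mnL (hvol R (by linarith)) (by positivity : 0 ≤ 4 * R^2 * (H L.length * (4^d * NN d p.c (R^2))))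
  refine h3.trans (le_of_eq ?_)
  rw [pow_add]; ring
lemma base (hM : 0 ≤ M) (i : Fin n) : PJ (fun p : Dat d l0 H M => p.V i) 0 1 := by
  have key : ∀ (F : Dat d l0 H M → SA n) (m : ℕ), (∀ p, ∀ R : ℝ, 1 ≤ R → ∀ x ∈ An l0 R, eS x ^ m * ev x (F p) ^ 2 ≤ 4 * R^2 * (a2 x p.V + eW x * ev x (V2 p.V))) → LL F m := by
    intro F m h
    refine ⟨4 * M, by positivity, fun p R hR => ?_⟩
    have h1 := setIntegral_mono_on (LL_int m (F p) R) ((An_int l0 R ((a2_cont p.V).add ((ev_cont (w n)).mul (ev_cont (V2 p.V))))).const_mul (4 * R^2)) (An_meas l0 R) (fun x hx => h p R hR x hx)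
    rw [integral_const_mul] at h1
    have h2 := mnL (p.en R hR) (by positivity : 0 ≤ 4 * R^2)
    refine h1.trans (h2.trans (le_of_eq ?_))
    rw [pow_add]; ring
  have hV : ∀ (p : Dat d l0 H M) x, ev x (p.V i) ^ 2 ≤ ev x (V2 p.V) := fun p x => by
    rw [ev_V2, sq]
    exact single_le_sum (f := fun k => ev x (p.V k) * ev x (p.V k)) (fun i _ => mul_self_nonneg _) (mem_univ i)
  have ha : ∀ (p : Dat d l0 H M) x k, ev x (D k (p.V i)) ^ 2 ≤ a2 x p.V := fun p x k => by
    rw [sq]; unfold a2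
    refine (single_le_sum (f := fun j => ev x (D k (p.V j)) * ev x (D k (p.V j))) (fun i _ => mul_self_nonneg _) (mem_univ i)).trans ?_
    exact single_le_sum (f := fun k => ∑ j, ev x (D k (p.V j)) * ev x (D k (p.V j))) (fun i _ => sum_nonneg fun _ _ => mul_self_nonneg _) (mem_univ k)
  intro L hL
  match L, hL with
  | [], _ =>
    apply key
    intro p R hR x hx
    have hws : eW x * eS x = 1 := by rw [ev_sq]; exact ev_w_mul x
    have h2 := V2_nonneg x p.V
    have h3 := ev_w_pos x
    have h4 : 1 ≤ 4 * R^2 * eW x := by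
      have := mnL hx.2.2 h3.le
      linarith
    have h5 := mnR h4 h2
    have h6 := a2_nonneg x p.V
    have h7 := hV p x
    show eS x ^ 0 * _ ≤ _
    have : 0 ≤ R^2 * a2 x p.V := by positivity
    simp only [DL, pow_zero, one_mul]
    linarith
  | [k], _ =>
    apply key
    intro p R hR x hx
    have h1 := ha p x k
    have h2 := mul_nonneg (ev_w_pos x).le (V2_nonneg x p.V)
    have hs := ev_sq_pos x
    simp only [DL, List.length_singleton, zero_add, pow_one]
    exact mul_le_mul hx.2.2 (by linarith) (sq_nonneg _) (by positivity)
end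
section
open Finset
variable {d : ℕ} {l0 : Fin n} {H : ℕ → ℝ} {M : ℝ}
def Bn (l0 : Fin n) (R : ℝ) : Set (Euc n) := {x | x ∈ HS l0 ∧ R^2/16 ≤ eS x ∧ eS x ≤ 16 * R^2}
lemma Bn_cover {R : ℝ} (hR : 1 ≤ R) : Bn l0 R ⊆ An l0 (max (R/2) 1) ∪ (An l0 R ∪ An l0 (2*R)) := by
  intro x hx
  obtain ⟨h0, h1, h2⟩ := hx
  have hs := ev_sq_pos x
  by_cases h3 : eS x < R^2/4
  · left
    refine ⟨h0, ?_, ?_⟩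
    · rcases max_choice (R/2) 1 with h | h <;> rw [h] <;> nlinarith
    · have : R/2 ≤ max (R/2) 1 := le_max_left _ _
      nlinarith
  · right
    push Not at h3
    by_cases h4 : eS x ≤ 4 * R^2
    · left; exact ⟨h0, h3, h4⟩
    · right; push Not at h4; exact ⟨h0, by linarith, by linarith⟩
lemma Bn_meas (l0 : Fin n) (R : ℝ) : MeasurableSet (Bn l0 R) :=
  ((HS_closed l0).inter ((isClosed_le continuous_const (ev_cont _)).inter (isClosed_le (ev_cont _) continuous_const))).measurableSet
lemma Bn_int {f : Euc n → ℝ} (hf : Continuous f) {R : ℝ} (hR : 1 ≤ R) : IntegrableOn f (Bn l0 R) :=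
  ((An_int _ _ hf).union ((An_int _ _ hf).union (An_int _ _ hf))).mono_set (Bn_cover hR)
lemma LL.big {F : Dat d l0 H M → SA n} {m : ℕ} (hF : LL F m) : ∃ C, 0 ≤ C ∧ ∀ (p : Dat d l0 H M) (R : ℝ), 1 ≤ R →
    ∫ x in Bn l0 R, eS x ^ m * ev x (F p) ^ 2 ≤ C * (R^(n+2) * NN d p.c (R^2)) := by
  obtain ⟨C, hC, hF⟩ := hF
  refine ⟨3 * (C * (2^(n+2) * 4^d)), by positivity, fun p R hR => ?_⟩
  have h0 : ∀ x : Euc n, 0 ≤ eS x ^ m * ev x (F p) ^ 2 := fun x =>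
    mul_nonneg (pow_nonneg (by linarith [ev_sq_pos x]) _) (sq_nonneg _)
  have hi := fun R => LL_int (l0 := l0) m (F p) R
  have hN := NN_nonneg d p.c (sq_nonneg R)
  have key : ∀ R', 1 ≤ R' → R' ≤ 2 * R → ∫ x in An l0 R', eS x ^ m * ev x (F p) ^ 2 ≤ C * (2^(n+2) * 4^d) * (R^(n+2) * NN d p.c (R^2)) := by
    intro R' h1 h2
    have e1 : NN d p.c (R'^2) ≤ 4^d * NN d p.c (R^2) :=
      (NN_mono d _ (sq_nonneg _) (by nlinarith : R'^2 ≤ 4 * R^2)).trans (NN_dil d _ (sq_nonneg R) (by norm_num))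
    have e2 : R'^(n+2) ≤ (2*R)^(n+2) := pow_le_pow_left₀ (by linarith) h2 _
    rw [mul_pow] at e2
    refine (hF p R' h1).trans ?_
    calc _ ≤ C * (2^(n+2) * R^(n+2) * (4^d * NN d p.c (R^2))) := by
          refine mnL ?_ hC
          exact mul_le_mul e2 e1 (NN_nonneg d _ (sq_nonneg _)) (by positivity)
      _ = _ := by ring
  have u1 : ∫ x in Bn l0 R, eS x ^ m * ev x (F p) ^ 2 ≤ ∫ x in An l0 (max (R/2) 1) ∪ (An l0 R ∪ An l0 (2*R)), eS x ^ m * ev x (F p) ^ 2 :=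
    setIntegral_mono_set ((hi _).union ((hi _).union (hi _))) (Filter.Eventually.of_forall h0) (Bn_cover hR).eventuallyLE
  have un : ∀ A B : Set (Euc n), MeasurableSet A → MeasurableSet B → IntegrableOn (fun x => eS x ^ m * ev x (F p) ^ 2) A → IntegrableOn (fun x => eS x ^ m * ev x (F p) ^ 2) B →
      ∫ x in A ∪ B, eS x ^ m * ev x (F p) ^ 2 ≤ (∫ x in A, eS x ^ m * ev x (F p) ^ 2) + ∫ x in B, eS x ^ m * ev x (F p) ^ 2 := by
    intro A B hA hB iA iB
    rw [← Set.union_diff_self, setIntegral_union Set.disjoint_sdiff_right (hB.diff hA) iA (iB.mono_set Set.diff_subset)]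
    have := setIntegral_mono_set iB (Filter.Eventually.of_forall h0) (Set.diff_subset (s := B) (t := A)).eventuallyLE
    linarith
  have u2 := un _ _ (An_meas l0 (max (R/2) 1)) ((An_meas l0 R).union (An_meas l0 (2*R))) (hi _) ((hi _).union (hi _))
  have u3 := un _ _ (An_meas l0 R) (An_meas l0 (2*R)) (hi _) (hi _)
  have k1 := key (max (R/2) 1) (le_max_right _ _) (max_le (by linarith) (by linarith))
  have k2 := key R hR (by linarith)
  have k3 := key (2*R) (by linarith) le_rfl
  linarith
def g1 (τ : ℝ) : ℝ := Real.smoothTransition (8 * τ - 1) * Real.smoothTransition (5 - τ)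
lemma g1_sm : ContDiff ℝ (⊤ : ℕ∞) g1 :=
  (Real.smoothTransition.contDiff.comp ((contDiff_const.mul contDiff_id).sub contDiff_const)).mul
    (Real.smoothTransition.contDiff.comp (contDiff_const.sub contDiff_id))
lemma g1_one {τ : ℝ} (h : 1/4 ≤ τ) (h' : τ ≤ 4) : g1 τ = 1 := by
  unfold g1
  rw [Real.smoothTransition.one_of_one_le (by linarith), Real.smoothTransition.one_of_one_le (by linarith), one_mul]
lemma g1_lo {τ : ℝ} (h : τ ≤ 1/8) : g1 τ = 0 := by
  unfold g1; rw [Real.smoothTransition.zero_of_nonpos (by linarith), zero_mul]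
lemma g1_hi {τ : ℝ} (h : 5 ≤ τ) : g1 τ = 0 := by
  unfold g1; rw [Real.smoothTransition.zero_of_nonpos (x := 5 - τ) (by linarith), mul_zero]
lemma g1_dlo {τ : ℝ} (h : τ < 1/8) : deriv g1 τ = 0 := by
  have : g1 =ᶠ[nhds τ] fun _ => 0 := by
    filter_upwards [gt_mem_nhds h] with t ht using g1_lo (le_of_lt ht)
  rw [this.deriv_eq]; simp
lemma g1_dhi {τ : ℝ} (h : 5 < τ) : deriv g1 τ = 0 := by
  have : g1 =ᶠ[nhds τ] fun _ => 0 := by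
    filter_upwards [lt_mem_nhds h] with t ht using g1_hi (le_of_lt ht)
  rw [this.deriv_eq]; simp
lemma zeta_ex (n : ℕ) (l0 : Fin n) : ∃ C, 0 ≤ C ∧ ∀ R : ℝ, 1 ≤ R → ∃ ζ : SA n, (∀ x, 4 * R ≤ ‖x‖ → ev x ζ = 0) ∧
    (∀ x ∈ An l0 R, ev x ζ = 1) ∧ (∀ x, ev x ζ * ev x ζ ≤ C) ∧ (∀ x ∈ Bn l0 R, R^2 * g2 x ζ ≤ C) ∧
    (∀ x ∈ HS l0, x ∉ Bn l0 R → ev x ζ = 0 ∧ g2 x ζ = 0) := by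
  obtain ⟨C, hC0, hC⟩ := cut_J (n := n) 1 g1_sm (a := 5) (by norm_num) (fun τ hτ => g1_hi hτ.le)
  refine ⟨16 * n * C^2 + C^2, by positivity, fun R hR => ⟨cut g1 g1_sm (1/R^2) 0, ?_, ?_, ?_, ?_, ?_⟩⟩
  · intro x hx
    rw [ev_cut]
    apply g1_hi
    rw [sub_zero, ev_sq', one_div, ← div_eq_inv_mul, le_div_iff₀ (by positivity)]
    nlinarith
  · intro x hx
    rw [ev_cut]
    apply g1_one
    · rw [sub_zero, one_div (R^2), ← div_eq_inv_mul, le_div_iff₀ (by positivity)]; linarith [hx.2.1]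
    · rw [sub_zero, one_div (R^2), ← div_eq_inv_mul, div_le_iff₀ (by positivity)]; linarith [hx.2.2]
  · intro x
    have h1 := (abs_le_J 1 _ x).trans (hC (1/R^2) 0 (by positivity) le_rfl zero_le_one x)
    have := mul_self_le_mul_self (abs_nonneg _) h1
    rw [abs_mul_abs_self] at this
    have : 0 ≤ 16 * n * C^2 := by positivity
    nlinarith
  · intro x hx
    have h1 : ∀ i, R^2 * (ev x (D i (cut g1 g1_sm (1/R^2) 0)) * ev x (D i (cut g1 g1_sm (1/R^2) 0))) ≤ 16 * C^2 := by
      intro i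
      have h2 := (J_D 0 _ x i).trans (hC (1/R^2) 0 (by positivity) le_rfl zero_le_one x)
      simp only [J] at h2
      set u := ev x (D i (cut g1 g1_sm (1/R^2) 0))
      have h3 := pow_le_pow_left₀ (mul_nonneg (lam_pos x).le (abs_nonneg _)) h2 2
      rw [mul_pow, lam_sq, sq_abs] at h3
      have := mnR hx.2.1 (sq_nonneg u)
      nlinarith
    unfold g2
    rw [mul_sum]
    refine (sum_le_sum fun i _ => h1 i).trans ?_
    rw [sum_const, card_univ, Fintype.card_fin, nsmul_eq_mul]
    nlinarith [sq_nonneg C]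
  · intro x hx hx'
    have hR2 : 0 < R^2 := by positivity
    have : 1/R^2 * eS x - 0 < 1/8 ∨ 5 < 1/R^2 * eS x - 0 := by
      by_contra hcon
      push Not at hcon
      apply hx'
      rw [sub_zero, one_div (R^2), ← div_eq_inv_mul, le_div_iff₀ hR2, div_le_iff₀ hR2] at hcon
      exact ⟨hx, by linarith, by linarith⟩
    constructor
    · rw [ev_cut]; rcases this with h | h
      · exact g1_lo h.le
      · exact g1_hi h.le
    · unfold g2
      apply sum_eq_zero; intro i _
      rw [D_cut, ev_smul, map_mul, ev_cut]
      rcases this with h | h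
      · rw [g1_dlo h]; simp
      · rw [g1_dhi h]; simp
lemma tang_abs (hn : 2 ≤ n) (m : Fin n) (hm : m ≠ l0) (Y W Φ : Dat d l0 H M → Fin n → SA n) (b : ℕ)
    (hY : ∀ i, LL (fun p => Y p i) b) (hW : ∀ i, LL (fun p => W p i) (b+1)) (hΦ : ∀ i, LL (fun p => Φ p i) (b+1))
    (hDW : ∀ i, LL (fun p => D l0 (W p i)) (b+2))
    (hb1 : ∀ p x, x l0 = 0 → ev x (Y p l0) = 0)
    (hb2 : ∀ p x, x l0 = 0 → ∀ i, i ≠ l0 → ev x (D l0 (Y p i)) = ev x (W p i))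
    (heq : ∀ p, ∀ x ∈ HS l0, ∀ i, ∑ k, ev x (D k (D k (Y p i))) + (1 - 2 / (n:ℝ)) * ev x (D i (T0 (Y p))) = ev x (D m (Φ p i)))
    (j i : Fin n) : LL (fun p => D j (Y p i)) (b+1) := by
  choose CY hCY hY using fun i => (hY i).big
  choose CW hCW hW using fun i => (hW i).big
  choose CΦ hCΦ hΦ using fun i => (hΦ i).big
  choose CD hCD hDW using fun i => (hDW i).big
  obtain ⟨A, hA, hζ⟩ := zeta_ex n l0
  set B := ∑ i, (CY i + CW i + CΦ i + CD i) with hB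
  have hB0 : 0 ≤ B := sum_nonneg fun i _ => by have := hCY i; have := hCW i; have := hCΦ i; have := hCD i; positivity
  refine ⟨4^(b+1) * (2 * (16 * A) * 16^(b+2) * B), by positivity, fun p R hR => ?_⟩
  obtain ⟨ζ, z1, z2, z3, z4, z5⟩ := hζ R hR
  have hR0 : 0 < R := by linarith
  have hR2 : 0 < R^2 := by positivity
  set G : Euc n → ℝ := fun x => ∑ i, (eS x^b * ev x (Y p i)^2 + eS x^(b+1) * ev x (W p i)^2
    + eS x^(b+1) * ev x (Φ p i)^2 + eS x^(b+2) * ev x (D l0 (W p i))^2) with hG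
  have hct : ∀ (k : ℕ) (f : SA n), Continuous fun x => eS x^k * ev x f^2 := fun k f => ((ev_cont _).pow _).mul ((ev_cont _).pow _)
  have hGc : Continuous G := continuous_finset_sum _ fun i _ => (((hct _ _).add (hct _ _)).add (hct _ _)).add (hct _ _)
  have hGB : ∫ x in Bn l0 R, G x ≤ B * (R^(n+2) * NN d p.c (R^2)) := by
    have hi := fun (k : ℕ) (f : SA n) => Bn_int (l0 := l0) (hct k f) hR
    have hi2 : ∀ i, IntegrableOn (fun x => eS x^b * ev x (Y p i)^2 + eS x^(b+1) * ev x (W p i)^2) (Bn l0 R) :=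
      fun i => (hi _ _).add (hi _ _)
    have hi3 : ∀ i, IntegrableOn (fun x => eS x^b * ev x (Y p i)^2 + eS x^(b+1) * ev x (W p i)^2
      + eS x^(b+1) * ev x (Φ p i)^2) (Bn l0 R) := fun i => (hi2 i).add (hi _ _)
    have hi4 : ∀ i, IntegrableOn (fun x => eS x^b * ev x (Y p i)^2 + eS x^(b+1) * ev x (W p i)^2
      + eS x^(b+1) * ev x (Φ p i)^2 + eS x^(b+2) * ev x (D l0 (W p i))^2) (Bn l0 R) := fun i => (hi3 i).add (hi _ _)
    simp only [hG]
    rw [integral_finset_sum _ (fun i _ => hi4 i), hB, sum_mul]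
    refine sum_le_sum fun i _ => ?_
    rw [integral_add (hi3 i) (hi _ _), integral_add (hi2 i) (hi _ _), integral_add (hi _ _) (hi _ _)]
    have := hY i p R hR; have := hW i p R hR; have := hΦ i p R hR; have := hDW i p R hR
    linarith
  set κ : ℝ := 2 * (16 * A) * 16^(b+2) with hκ
  have hκ0 : 0 ≤ κ := by positivity
  have hg := cacc hn l0 m hm ζ (Y p) (W p) (Φ p) (R^2) ((R^2)⁻¹) (4*R) (by positivity) (mul_inv_cancel₀ hR2.ne') z1 (hb1 p) (hb2 p) (heq p)
    (g := Set.indicator (Bn l0 R) fun x => κ * ((R^2)^(b+1))⁻¹ * G x) (by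
      have := ((integrable_indicator_iff (Bn_meas l0 R)).2 ((Bn_int (l0 := l0) hGc hR).const_mul (κ * ((R^2)^(b+1))⁻¹)))
      exact this.integrableOn) (by
    intro x hx
    by_cases hxB : x ∈ Bn l0 R
    · rw [Set.indicator_of_mem hxB]
      have hs := ev_sq_pos x
      have hz := z3 x
      have hgz := z4 x hxB
      have hq : R^2 ≤ 16 * eS x := by linarith [hxB.2.1]
      have hpw : ∀ k, k ≤ b + 2 → (R^2)^k ≤ 16^(b+2) * eS x^k := by
        intro k hk
        refine (pow_le_pow_left₀ hR2.le hq k).trans ?_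
        rw [mul_pow]
        have : (16:ℝ)^k ≤ 16^(b+2) := pow_le_pow_right₀ (by norm_num) hk
        gcongr
      have hinv : (R^2)⁻¹ = ((R^2)^(b+1))⁻¹ * (R^2)^b := by rw [pow_succ (R^2) b, mul_inv, mul_right_comm, inv_mul_cancel₀ (by positivity), one_mul]
      have hone : (1:ℝ) = ((R^2)^(b+1))⁻¹ * (R^2)^(b+1) := (inv_mul_cancel₀ (by positivity)).symm
      have hRR : R^2 = ((R^2)^(b+1))⁻¹ * (R^2)^(b+2) := by rw [pow_succ _ (b+1), ← mul_assoc, inv_mul_cancel₀ (by positivity), one_mul]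
      have hQ0 : 0 ≤ ((R^2)^(b+1))⁻¹ := by positivity
      have vY := V2_nonneg x (Y p); have vW := V2_nonneg x (W p); have vΦ := V2_nonneg x (Φ p)
      have vD := V2_nonneg x (fun i => D l0 (W p i))
      have s1 : g2 x ζ ≤ A * (R^2)⁻¹ := by rw [← div_eq_mul_inv, le_div_iff₀ hR2]; linarith
      have s2 : 2 * (7 * (g2 x ζ * ev x (V2 (Y p))) + 3 * (ev x ζ * ev x ζ * (ev x (V2 (W p)) + ev x (V2 (Φ p))))
        + ev x ζ * ev x ζ * ((R^2)⁻¹ * ev x (V2 (Y p)) + R^2 * ev x (V2 fun i => D l0 (W p i)))) ≤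
          2 * (16 * A) * ((R^2)⁻¹ * ev x (V2 (Y p)) + 1 * (ev x (V2 (W p)) + ev x (V2 (Φ p))) + R^2 * ev x (V2 fun i => D l0 (W p i))) := by
        have t1 := mnR s1 vY
        have t2 := mnR hz (add_nonneg vW vΦ)
        have t3 : 0 ≤ (R^2)⁻¹ * ev x (V2 (Y p)) := by positivity
        have t4 : 0 ≤ R^2 * ev x (V2 fun i => D l0 (W p i)) := by positivity
        have t5 := mnR hz (add_nonneg t3 t4)
        have t6 := mul_nonneg hA t3
        have t7 := mul_nonneg hA t4
        have t8 := mul_nonneg hA (add_nonneg vW vΦ)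
        linarith
      refine s2.trans ?_
      have s3 : (R^2)⁻¹ * ev x (V2 (Y p)) + 1 * (ev x (V2 (W p)) + ev x (V2 (Φ p))) + R^2 * ev x (V2 fun i => D l0 (W p i))
         ≤ ((R^2)^(b+1))⁻¹ * (16^(b+2) * (eS x^b * ev x (V2 (Y p)) + eS x^(b+1) * (ev x (V2 (W p)) + ev x (V2 (Φ p)))
            + eS x^(b+2) * ev x (V2 fun i => D l0 (W p i)))) := by
        have t1 := mnL (mnR (hpw b (by omega)) vY) hQ0
        have t2 := mnL (mnR (hpw (b+1) (by omega)) (add_nonneg vW vΦ)) hQ0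
        have t3 := mnL (mnR (hpw (b+2) le_rfl) vD) hQ0
        rw [← mul_assoc, ← hinv] at t1
        rw [← mul_assoc, ← hone] at t2
        rw [← mul_assoc, ← hRR] at t3
        linarith
      have s4 : eS x^b * ev x (V2 (Y p)) + eS x^(b+1) * (ev x (V2 (W p)) + ev x (V2 (Φ p)))
            + eS x^(b+2) * ev x (V2 fun i => D l0 (W p i)) = G x := by
        simp only [hG, ev_V2, mul_sum, ← sum_add_distrib]
        refine sum_congr rfl fun i _ => ?_
        ring
      rw [s4] at s3
      have := mnL s3 (by positivity : 0 ≤ 2 * (16 * A))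
      refine this.trans (le_of_eq ?_)
      rw [hκ]; ring
    · rw [Set.indicator_of_notMem hxB]
      obtain ⟨h1, h2⟩ := z5 x hx hxB
      rw [h1, h2]; simp)
  rw [setIntegral_indicator (Bn_meas l0 R), Set.inter_eq_right.2 (fun x (hx : x ∈ Bn l0 R) => hx.1), integral_const_mul] at hg
  have hint : IntegrableOn (fun x => ev x ζ * ev x ζ * a2 x (Y p)) (HS l0) := by
    apply Integrable.integrableOn
    apply intble_of_supp (((ev_cont _).mul (ev_cont _)).mul (a2_cont _)) (4*R)
    intro x hx; simp [z1 x hx]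
  have f1 : ∫ x in An l0 R, eS x ^ (b+1) * ev x (D j (Y p i)) ^ 2 ≤ ∫ x in An l0 R, (4 * R^2)^(b+1) * (ev x ζ * ev x ζ * a2 x (Y p)) := by
    refine setIntegral_mono_on (LL_int _ _ _) ((hint.mono_set (An_sub _ _)).const_mul _) (An_meas _ _) fun x hx => ?_
    rw [z2 x hx, one_mul, one_mul]
    have hs := ev_sq_pos x
    refine mul_le_mul (pow_le_pow_left₀ (by linarith) hx.2.2 _) ?_ (sq_nonneg _) (by positivity)
    rw [sq]; unfold a2
    refine (single_le_sum (f := fun k => ev x (D j (Y p k)) * ev x (D j (Y p k))) (fun i _ => mul_self_nonneg _) (mem_univ i)).trans ?_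
    exact single_le_sum (f := fun j => ∑ k, ev x (D j (Y p k)) * ev x (D j (Y p k))) (fun i _ => sum_nonneg fun _ _ => mul_self_nonneg _) (mem_univ j)
  rw [integral_const_mul] at f1
  have f2 : ∫ x in An l0 R, ev x ζ * ev x ζ * a2 x (Y p) ≤ ∫ x in HS l0, ev x ζ * ev x ζ * a2 x (Y p) :=
    setIntegral_mono_set hint (Filter.Eventually.of_forall fun x => mul_nonneg (mul_self_nonneg _) (a2_nonneg _ _)) (An_sub l0 R).eventuallyLE
  have f3 := mnL hGB (by positivity : 0 ≤ κ * ((R^2)^(b+1))⁻¹)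
  have f4 := mnL (f2.trans (hg.trans f3)) (by positivity : 0 ≤ (4 * R^2)^(b+1))
  refine f1.trans (f4.trans (le_of_eq ?_))
  rw [mul_pow]
  field_simp
end
section
open Finset
variable {d : ℕ} {l0 : Fin n} {H : ℕ → ℝ} {M : ℝ}
lemma vanish1 (i : Fin n) {f : SA n} (hf : ∀ x ∈ HS l0, ev x f = 0) (x : Euc n) (hx : x ∈ HS l0) : ev x (D i f) = 0 := by
  have h1 := hasDerivAt_line f x i 0
  simp only [zero_smul, add_zero] at h1
  have h2 : ∀ t ∈ Set.Ici (0:ℝ), (fun t : ℝ => ev (x + t • EuclideanSpace.single i (1:ℝ)) f) t = 0 := by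
    intro t ht
    apply hf
    have hx' : 0 ≤ x l0 := hx
    have ht' : 0 ≤ t := ht
    change 0 ≤ (x + t • EuclideanSpace.single i (1:ℝ)) l0
    by_cases h : l0 = i
    · simp [h] at hx' ⊢; linarith
    · simpa [h] using hx'
  have h3 : HasDerivWithinAt (fun t : ℝ => ev (x + t • EuclideanSpace.single i (1:ℝ)) f) 0 (Set.Ici 0) 0 :=
    (hasDerivWithinAt_const (0:ℝ) (Set.Ici 0) (0:ℝ)).congr h2 (h2 0 (Set.mem_Ici.2 le_rfl))
  exact (uniqueDiffWithinAt_Ici 0).eq_deriv _ h1.hasDerivWithinAt h3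
lemma vanish (L : List (Fin n)) {f : SA n} (hf : ∀ x ∈ HS l0, ev x f = 0) : ∀ x ∈ HS l0, ev x (DL L f) = 0 := by
  induction L with
  | nil => exact hf
  | cons i t ih => exact fun x hx => vanish1 i ih x hx
lemma DL_bdry (L : List (Fin n)) (hL : ∀ j ∈ L, j ≠ l0) {f : SA n} (hf : ∀ x : Euc n, x l0 = 0 → ev x f = 0) :
    ∀ x : Euc n, x l0 = 0 → ev x (DL L f) = 0 := by
  induction L with
  | nil => exact hf
  | cons i t ih =>
    exact fun x hx => D_bdry (hL i (by simp)) (ih fun j hj => hL j (by simp [hj])) x hx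
def Fr (p : Dat d l0 H M) (i : Fin n) : SA n :=
  (2 * (n:ℝ)) • (∑ k, (w n * X k) * D i (p.V k) + ∑ k, (w n * X k) * D k (p.V i)) - (4:ℝ) • ((w n * X i) * T0 p.V)
   + (∑ k, D k (p.h i k) - (2 * (n:ℝ)) • ∑ k, (w n * X k) * p.h i k)
lemma Ob_wX (k : Fin n) : Ob (fun _ : Unit => w n * X k) (-((1:ℕ):ℤ)) :=
  Ob.mul (Ob_w) (Ob_X k) (by norm_num)
lemma Fr_PJ (hH : ∀ k, 0 ≤ H k) {b : ℕ} (hV : ∀ i, PJ (fun p : Dat d l0 H M => p.V i) 0 (b+1)) (i : Fin n) :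
    PJ (fun p : Dat d l0 H M => Fr p i) 2 b := by
  have h1 : ∀ j k q, PJ (fun p : Dat d l0 H M => (w n * X q) * D j (p.V k)) 2 b := fun j k q => ((hV k).dd j).mul (Ob_wX q)
  refine PJ.add (PJ.sub ((PJ.add (PJ.sum _ fun k _ => h1 _ _ _) (PJ.sum _ fun k _ => h1 _ _ _)).smul _) (PJ.smul ?_ _))
    (PJ.sub (PJ.sum _ fun k _ => (LL_h hH i k (b+1)).dd k) ((PJ.sum _ fun k _ => (LL_h hH i k b).mul (Ob_wX k)).smul _))
  have : (fun p : Dat d l0 H M => (w n * X i) * T0 p.V) = fun p => ∑ k, (w n * X i) * D k (p.V k) := by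
    funext p; rw [T0, mul_sum]
  rw [this]
  exact PJ.sum _ fun k _ => h1 _ _ _
lemma lame0 (hn : 0 < n) (p : Dat d l0 H M) (i : Fin n) : ∀ x ∈ HS l0,
    ev x (∑ k, D k (D k (p.V i)) + (1 - 2 / (n:ℝ)) • D i (T0 p.V) - Fr p i) = 0 := by
  intro x hx
  have h1 := eqn_lame hn p.sys x hx i
  have hn' : (n:ℝ) ≠ 0 := by positivity
  simp only [Fr, map_sub, map_add, map_sum, ev_smul, map_mul, ev_X]
  rw [sum_sub_distrib] at h1
  have e1 : ∀ (f : Fin n → ℝ), ∑ k, eW x * x k * f k = eW x * ∑ k, x k * f k := fun f => by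
    rw [mul_sum]; exact sum_congr rfl fun k _ => by ring
  have e2 : ∑ k, 2 * (n:ℝ) * eW x * (x k * ev x (p.h i k)) = 2 * n * eW x * ∑ k, x k * ev x (p.h i k) := by rw [mul_sum]
  rw [e2] at h1
  rw [e1, e1, e1]
  have e3 : 2 * (n:ℝ) * eW x * (2 / n * x i * ev x (T0 p.V)) = 4 * (eW x * x i * ev x (T0 p.V)) := by field_simp; ring
  linear_combination h1 - e3
lemma T0_DL (V : Fin n → SA n) (L : List (Fin n)) : T0 (fun i => DL L (V i)) = DL L (T0 V) := by
  simp only [T0, DL_sum, DL_D]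
lemma lameL (hn : 0 < n) (p : Dat d l0 H M) (i : Fin n) (L : List (Fin n)) : ∀ x ∈ HS l0,
    ∑ k, ev x (D k (D k (DL L (p.V i)))) + (1 - 2 / (n:ℝ)) * ev x (D i (T0 fun j => DL L (p.V j))) = ev x (DL L (Fr p i)) := by
  intro x hx
  have h := vanish L (lame0 hn p i) x hx
  simp only [DL_sub, DL_add, DL_sum, DL_smul, DL_D, map_sub, map_add, map_sum, ev_smul] at h
  rw [T0_DL]
  linarith
lemma tang (hn : 2 ≤ n) (hH : ∀ k, 0 ≤ H k) {b : ℕ} (hV : ∀ i, PJ (fun p : Dat d l0 H M => p.V i) 0 (b+1))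
    (L : List (Fin n)) (hL : L.length = b + 1) (hL0 : ∀ j ∈ L, j ≠ l0) (j i : Fin n) :
    LL (fun p : Dat d l0 H M => D j (DL L (p.V i))) (b+2) := by
  obtain ⟨m, L', rfl⟩ : ∃ m L', L = m :: L' := by
    cases L with
    | nil => simp at hL
    | cons m L' => exact ⟨m, L', rfl⟩
  have hL' : L'.length = b := by simpa using hL
  refine tang_abs hn m (hL0 m (by simp)) (fun p i => DL (m :: L') (p.V i)) (fun p i => DL (m :: L') (p.h i l0)) (fun p i => DL L' (Fr p i)) (b+1)
    (fun i => ?_) (fun i => ?_) (fun i => ?_) (fun i => ?_) (fun p => ?_) (fun p x hx i hi => ?_) (fun p x hx i => ?_) j i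
  · have := hV i (m :: L') hL.le
    rwa [hL, zero_add] at this
  · have := LL_h hH i l0 _ (m :: L') le_rfl (d := d) (M := M) (l0 := l0)
    rwa [hL, add_comm] at this
  · have := Fr_PJ hH hV i L' hL'.le
    rwa [hL', add_comm] at this
  · have := LL_h hH i l0 _ (l0 :: m :: L') le_rfl (d := d) (M := M) (l0 := l0)
    rw [List.length_cons, hL] at this
    have e : 1 + (b + 1 + 1) = b + 1 + 2 := by omega
    rw [e] at this
    exact this
  · exact DL_bdry _ hL0 p.sys.b1
  · have := DL_bdry (m :: L') hL0 (f := D l0 (p.V i) - p.h i l0) (fun y hy => by rw [map_sub, p.sys.b2 y hy i hi, sub_self]) x hx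
    rw [DL_sub, DL_D, map_sub] at this
    linarith
  · exact lameL (by omega) p i (m :: L') x hx
lemma normalstep (hn : 2 ≤ n) (hH : ∀ k, 0 ≤ H k) {b : ℕ} (hV : ∀ i, PJ (fun p : Dat d l0 H M => p.V i) 0 (b+1)) (c : ℕ) :
    ∀ (L : List (Fin n)), L.length = b + 2 → L.count l0 ≤ c → ∀ i, LL (fun p : Dat d l0 H M => DL L (p.V i)) (b+2) := by
  induction c with
  | zero =>
    intro L hL hc i
    have hno : ∀ j ∈ L, j ≠ l0 := fun j hj h => by
      subst h; have := List.count_pos_iff.2 hj; omega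
    cases L with
    | nil => simp at hL
    | cons m L' => exact tang hn hH hV L' (by simpa using hL) (fun j hj => hno j (by simp [hj])) m i
  | succ c ih =>
    intro L hL hc i
    by_cases hmem : l0 ∈ L
    swap
    · exact ih L hL (by rw [List.count_eq_zero_of_not_mem hmem]; omega) i
    have hp := List.perm_cons_erase hmem
    set L1 := L.erase l0 with hL1
    have e1 : ∀ f : SA n, DL L f = D l0 (DL L1 f) := fun f => DL_perm hp f
    have hlen1 : L1.length = b + 1 := by have := hp.length_eq; simp at this; omega
    by_cases hmem1 : l0 ∈ L1
    swap
    · simp only [e1]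
      exact tang hn hH hV L1 hlen1 (fun j hj h => hmem1 (h ▸ hj)) l0 i
    have hp1 := List.perm_cons_erase hmem1
    set L2 := L1.erase l0 with hL2
    have hlen2 : L2.length = b := by have := hp1.length_eq; simp at this; omega
    have e2 : ∀ f : SA n, DL L f = D l0 (D l0 (DL L2 f)) := fun f => by rw [e1, DL_perm hp1]; rfl
    have hcnt : L2.count l0 + 2 ≤ c + 1 := by
      have h1 := hp.count_eq l0
      have h2 := hp1.count_eq l0
      simp at h1 h2; omega
    have hn0 : (2:ℝ) ≤ n := by exact_mod_cast hn
    have hne : (2 - 2/(n:ℝ)) ≠ 0 := by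
      have : 2 / (n:ℝ) ≤ 1 := by rw [div_le_one (by linarith)]; exact hn0
      linarith
    have hoth : ∀ j k q, ¬ (j = l0 ∧ k = l0) → LL (fun p : Dat d l0 H M => D j (D k (DL L2 (p.V q)))) (b+2) := by
      intro j k q hjk
      refine ih (j :: k :: L2) (by simp [hlen2]) ?_ q
      simp only [List.count_cons]
      by_cases hj : j = l0
      · have hk : k ≠ l0 := fun h => hjk ⟨hj, h⟩
        simp [hj, hk]; omega
      · by_cases hk : k = l0 <;> simp [hj, hk] <;> omega
    have hF : ∀ q, LL (fun p : Dat d l0 H M => DL L2 (Fr p q)) (b+2) := by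
      intro q
      have := Fr_PJ hH hV q L2 hlen2.le
      rwa [hlen2, add_comm] at this
    have hlam : ∀ q (p : Dat d l0 H M), ∀ x ∈ HS l0, ∑ k, ev x (D k (D k (DL L2 (p.V q)))) + (1 - 2 / (n:ℝ)) * ∑ m, ev x (D q (D m (DL L2 (p.V m)))) = ev x (DL L2 (Fr p q)) := by
      intro q p x hx
      rw [← lameL (by omega) p q L2 x hx, T0, map_sum, map_sum]
    by_cases hi : i = l0
    · subst hi
      refine LL.congr (G := fun p => (2 - 2/(n:ℝ))⁻¹ • (DL L2 (Fr p i) - ∑ k ∈ univ.erase i, D k (D k (DL L2 (p.V i))) - (1 - 2/(n:ℝ)) • ∑ m ∈ univ.erase i, D i (D m (DL L2 (p.V m))))) ?_ ?_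
      · refine (((hF i).sub (LL.sum _ fun k hk => hoth _ _ _ ?_)).sub ((LL.sum _ fun k hk => hoth _ _ _ ?_).smul _)).smul _
        · exact fun h => (mem_erase.1 hk).1 h.1
        · exact fun h => (mem_erase.1 hk).1 h.2
      · intro p x hx
        have h := hlam i p x hx
        rw [← add_sum_erase _ _ (mem_univ i), ← add_sum_erase _ (fun m => ev x (D i (D m (DL L2 (p.V m))))) (mem_univ i)] at h
        simp only [e2, ev_smul, map_sub, map_sum]
        rw [eq_inv_mul_iff_mul_eq₀ hne]
        linear_combination h
    · refine LL.congr (G := fun p => DL L2 (Fr p i) - ∑ k ∈ univ.erase l0, D k (D k (DL L2 (p.V i))) - (1 - 2/(n:ℝ)) • ∑ m, D i (D m (DL L2 (p.V m)))) ?_ ?_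
      · refine (((hF i).sub (LL.sum _ fun k hk => hoth _ _ _ ?_)).sub ((LL.sum _ fun k hk => hoth _ _ _ ?_).smul _))
        · exact fun h => (mem_erase.1 hk).1 h.1
        · exact fun h => hi h.1
      · intro p x hx
        have h := hlam i p x hx
        rw [← add_sum_erase _ _ (mem_univ l0)] at h
        simp only [e2, ev_smul, map_sub, map_sum]
        linear_combination h
lemma regularity (hn : 2 ≤ n) (hH : ∀ k, 0 ≤ H k) (hM : 0 ≤ M) (b : ℕ) : ∀ i, PJ (fun p : Dat d l0 H M => p.V i) 0 b := by
  have : ∀ b i, PJ (fun p : Dat d l0 H M => p.V i) 0 (b+1) := by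
    intro b
    induction b with
    | zero => exact fun i => base hM i
    | succ b ih =>
      intro i L hL
      by_cases h : L.length ≤ b + 1
      · exact ih i L h
      · have hL' : L.length = b + 2 := by omega
        rw [hL', zero_add]
        exact normalstep hn hH ih (L.count l0) L hL' le_rfl i
  exact fun i => (this b i).mono (by omega)
end
section
open Finset
variable {d : ℕ} {l0 : Fin n} {H : ℕ → ℝ} {M : ℝ}
lemma sob1 (g g' : ℝ → ℝ) (hg : ∀ t, HasDerivAt g (g' t) t) (hg' : Continuous g') (a ℓ : ℝ) (hℓ : 0 < ℓ) :
    g a ^ 2 ≤ 2 / ℓ * ∫ t in a..(a+ℓ), (g t ^ 2 + ℓ^2 * g' t ^ 2) := by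
  have hgc : Continuous g := continuous_iff_continuousAt.2 fun t => (hg t).continuousAt
  have h1 : ∀ t, HasDerivAt (fun t => (a + ℓ - t) * g t ^ 2) (-(g t ^2) + (a + ℓ - t) * (2 * g t * g' t)) t := by
    intro t
    have := ((hasDerivAt_const t (a+ℓ)).sub (hasDerivAt_id t)).mul ((hg t).pow 2)
    refine this.congr_deriv ?_
    simp
  have h2 := intervalIntegral.integral_eq_sub_of_hasDerivAt (a := a) (b := a + ℓ) (fun t _ => h1 t)
    (by apply Continuous.intervalIntegrable; fun_prop)
  have h3 : ∫ t in a..(a+ℓ), -(2 * (g t ^ 2 + ℓ^2 * g' t ^ 2)) ≤ ∫ t in a..(a+ℓ), (-(g t ^2) + (a + ℓ - t) * (2 * g t * g' t)) := by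
    apply intervalIntegral.integral_mono_on (by linarith)
    · apply Continuous.intervalIntegrable; fun_prop
    · apply Continuous.intervalIntegrable; fun_prop
    · intro t ht
      have h5 : 0 ≤ (g t + (a + ℓ - t) * g' t)^2 := sq_nonneg _
      have h6 : (a + ℓ - t)^2 ≤ ℓ^2 := by nlinarith [ht.1, ht.2]
      have h7 := mnR h6 (sq_nonneg (g' t))
      have h8 : 0 ≤ ℓ^2 * g' t^2 := by positivity
      nlinarith
  rw [intervalIntegral.integral_neg, intervalIntegral.integral_const_mul, h2] at h3
  rw [div_mul_eq_mul_div, le_div_iff₀ hℓ]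
  have : (a + ℓ - (a + ℓ)) * g (a+ℓ)^2 - (a + ℓ - a) * g a ^2 = -(ℓ * g a^2) := by ring
  rw [this] at h3
  linarith
def Gq (ℓ : ℝ) : ℕ → SA n → Euc n → ℝ
  | 0, f, x => ev x f ^ 2
  | k+1, f, x => Gq ℓ k f x + ℓ^2 * ∑ i, Gq ℓ k (D i f) x
lemma Gq_nonneg (ℓ : ℝ) (k : ℕ) : ∀ (f : SA n) x, 0 ≤ Gq ℓ k f x := by
  induction k with
  | zero => intro f x; exact sq_nonneg _
  | succ k ih => intro f x; exact add_nonneg (ih _ _) (mul_nonneg (sq_nonneg _) (sum_nonneg fun i _ => ih _ _))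
lemma Gq_cont (ℓ : ℝ) (k : ℕ) : ∀ (f : SA n), Continuous (Gq ℓ k f) := by
  induction k with
  | zero => intro f; exact (ev_cont f).pow 2
  | succ k ih => intro f; exact (ih f).add (continuous_const.mul (continuous_finset_sum _ fun i _ => ih _))
lemma Gq_line (ℓ : ℝ) (hℓ : 0 < ℓ) (i : Fin n) (a : ℝ) (y : Euc n) (k : ℕ) : ∀ (f : SA n),
    Gq ℓ k f y ≤ 2 / ℓ * ∫ t in a..(a+ℓ), Gq ℓ (k+1) f (y + (t - a) • EuclideanSpace.single i (1:ℝ)) := by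
  have hpc : Continuous fun t : ℝ => y + (t - a) • EuclideanSpace.single i (1:ℝ) := by fun_prop
  have hii : ∀ k f, IntervalIntegrable (fun t => Gq ℓ k f (y + (t - a) • EuclideanSpace.single i (1:ℝ))) volume a (a+ℓ) :=
    fun k f => ((Gq_cont ℓ k f).comp hpc).intervalIntegrable _ _
  induction k with
  | zero =>
    intro f
    have h1 := sob1 (fun t => ev (y + (t - a) • EuclideanSpace.single i (1:ℝ)) f) (fun t => ev (y + (t - a) • EuclideanSpace.single i (1:ℝ)) (D i f))
      (fun t => (hasDerivAt_line f y i (t - a)).comp_sub_const t a) ((ev_cont (D i f)).comp hpc) a ℓ hℓ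
    simp only [sub_self, zero_smul, add_zero] at h1
    refine h1.trans ?_
    gcongr
    apply intervalIntegral.integral_mono_on (by linarith)
    · exact ((((ev_cont f).comp hpc).pow 2).add (continuous_const.mul (((ev_cont (D i f)).comp hpc).pow 2))).intervalIntegrable _ _
    · exact hii _ _
    · intro t ht
      simp only [Gq]
      gcongr
      exact single_le_sum (f := fun j => ev (y + (t - a) • EuclideanSpace.single i (1:ℝ)) (D j f) ^ 2) (fun j _ => sq_nonneg _) (mem_univ i)
  | succ k ih =>
    intro f
    have e : ∫ t in a..(a+ℓ), Gq ℓ (k+1+1) f (y + (t - a) • EuclideanSpace.single i (1:ℝ)) =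
       (∫ t in a..(a+ℓ), Gq ℓ (k+1) f (y + (t - a) • EuclideanSpace.single i (1:ℝ))) + ℓ^2 * ∑ j, ∫ t in a..(a+ℓ), Gq ℓ (k+1) (D j f) (y + (t - a) • EuclideanSpace.single i (1:ℝ)) := by
      rw [← intervalIntegral.integral_finset_sum (fun j _ => hii _ _), ← intervalIntegral.integral_const_mul, ← intervalIntegral.integral_add (hii _ _)]
      · rfl
      · exact ((continuous_finset_sum _ fun j _ => (Gq_cont ℓ (k+1) (D j f)).comp hpc).intervalIntegrable _ _).const_mul _
    rw [e, mul_add, mul_left_comm, mul_sum _ _ (2/ℓ)]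
    change Gq ℓ k f y + ℓ^2 * ∑ j, Gq ℓ k (D j f) y ≤ _
    have := ih f
    have h2 : ∑ j, Gq ℓ k (D j f) y ≤ ∑ j, 2 / ℓ * ∫ t in a..(a+ℓ), Gq ℓ (k+1) (D j f) (y + (t - a) • EuclideanSpace.single i (1:ℝ)) :=
      sum_le_sum fun j _ => ih (D j f)
    have h3 := mnL h2 (sq_nonneg ℓ)
    linarith
lemma Gq_lline (ℓ : ℝ) (hℓ : 0 < ℓ) (i : Fin n) (y : Fin n → ℝ) (k : ℕ) (f : SA n) :
    ENNReal.ofReal (Gq ℓ k f (WithLp.toLp 2 y)) ≤ ENNReal.ofReal (2/ℓ) *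
      ∫⁻ t in Set.Ioc (y i) (y i + ℓ), ENNReal.ofReal (Gq ℓ (k+1) f (WithLp.toLp 2 (Function.update y i t))) := by
  have h1 := Gq_line ℓ hℓ i (y i) (WithLp.toLp 2 y) k f
  have e : ∀ t, (WithLp.toLp 2 y : Euc n) + (t - y i) • EuclideanSpace.single i (1:ℝ) = WithLp.toLp 2 (Function.update y i t) := by
    intro t; ext j
    by_cases h : j = i
    · subst h; simp
    · simp [h]
  simp only [e] at h1
  refine (ENNReal.ofReal_le_ofReal h1).trans (le_of_eq ?_)
  rw [ENNReal.ofReal_mul (by positivity), intervalIntegral.integral_of_le (by linarith), ofReal_integral_eq_lintegral_ofReal]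
  · have hpc : Continuous fun t : ℝ => (WithLp.toLp 2 y : Euc n) + (t - y i) • EuclideanSpace.single i (1:ℝ) := by fun_prop
    simp only [e] at hpc
    exact (((Gq_cont ℓ (k+1) f).comp hpc).integrableOn_Icc (a := y i) (b := y i + ℓ)).mono_set Set.Ioc_subset_Icc_self
  · exact Filter.Eventually.of_forall fun t => Gq_nonneg _ _ _ _
lemma sobolev_aux (ℓ : ℝ) (hℓ : 0 < ℓ) (x0 : Fin n → ℝ) (f : SA n) (s : Finset (Fin n)) :
    ENNReal.ofReal (ev (WithLp.toLp 2 x0) f ^ 2) ≤ ENNReal.ofReal (2/ℓ) ^ s.card *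
      lmarginal (fun i => volume.restrict (Set.Ioc (x0 i) (x0 i + ℓ))) s (fun y => ENNReal.ofReal (Gq ℓ s.card f (WithLp.toLp 2 y))) x0 := by
  have hm : ∀ k, Measurable (fun y : Fin n → ℝ => ENNReal.ofReal (Gq ℓ k f (WithLp.toLp 2 y))) := fun k =>
    ENNReal.measurable_ofReal.comp ((Gq_cont ℓ k f).comp (PiLp.continuous_toLp 2 _)).measurable
  induction s using Finset.induction_on with
  | empty => simp [Gq]
  | insert i s hi ih =>
    rw [card_insert_of_notMem hi, lmarginal_insert' _ (hm _) hi]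
    refine ih.trans ?_
    rw [pow_succ, mul_assoc]
    gcongr
    unfold lmarginal
    rw [← lintegral_const_mul']
    · refine lintegral_mono fun z => ?_
      have h := Gq_lline ℓ hℓ i (Function.updateFinset x0 s z) s.card f
      have e : Function.updateFinset x0 s z i = x0 i := by simp [Function.updateFinset, hi]
      rw [e] at h
      exact h
    · exact ENNReal.ofReal_ne_top
lemma sobolev (x0 : Euc n) (hn : 0 < n) (hx0 : x0 ∈ HS l0) (f : SA n) :
    ev x0 f ^ 2 ≤ (4 * n / lam x0)^n * ∫ x in An l0 (lam x0), Gq (lam x0 / (2*n)) n f x := by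
  have hl := lam_pos x0
  have hn1 : (1:ℝ) ≤ n := by exact_mod_cast hn
  set R := lam x0 with hR
  set ℓ := R / (2*n) with hℓd
  have hℓ : 0 < ℓ := by positivity
  have h1 := sobolev_aux ℓ hℓ x0.ofLp f univ
  rw [lmarginal_univ, card_univ, Fintype.card_fin] at h1
  beta_reduce at h1
  rw [← Measure.restrict_pi_pi] at h1
  have hsub : Set.univ.pi (fun i => Set.Ioc (x0 i) (x0 i + ℓ)) ⊆ WithLp.toLp 2 ⁻¹' (An l0 R) := by
    intro y hy
    have hy' : ∀ i, x0 i < y i ∧ y i ≤ x0 i + ℓ := fun i => hy i (Set.mem_univ i)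
    have hx' : 0 ≤ x0 l0 := hx0
    have hs : R^2 = 1 + ∑ i, x0 i * x0 i := by rw [hR, lam_sq, ev_sq]
    have hnl : n * ℓ^2 ≤ R^2/4 := by
      have : (n:ℝ) * ℓ^2 = R^2/4 * (1/n) := by rw [hℓd]; field_simp; ring
      rw [this]
      have : 1/(n:ℝ) ≤ 1 := by rw [div_le_one (by linarith)]; exact hn1
      nlinarith [sq_nonneg R]
    have hS : ∀ i, (y i - x0 i)^2 ≤ ℓ^2 := fun i => by nlinarith [(hy' i).1, (hy' i).2]
    have hsl : ∑ i : Fin n, ℓ^2 = n * ℓ^2 := by simp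
    have u1 : ∑ i, y i * y i ≤ ∑ i, (2 * (x0 i * x0 i) + 2 * ℓ^2) := sum_le_sum fun i _ => by
      nlinarith [hS i, sq_nonneg (y i - 2 * x0 i)]
    have u2 : ∑ i, (x0 i * x0 i / 2 - ℓ^2) ≤ ∑ i, y i * y i := sum_le_sum fun i _ => by
      nlinarith [hS i, sq_nonneg (2 * y i - x0 i)]
    rw [sum_add_distrib, ← mul_sum, ← mul_sum, hsl] at u1
    rw [sum_sub_distrib, ← sum_div, hsl] at u2
    refine ⟨?_, ?_, ?_⟩
    · change 0 ≤ y l0; linarith [(hy' l0).1]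
    · rw [ev_sq]; change _ ≤ 1 + ∑ i, y i * y i; linarith
    · rw [ev_sq]; change 1 + ∑ i, y i * y i ≤ _; nlinarith [sq_nonneg R]
  have h2 : ∫⁻ y in Set.univ.pi (fun i => Set.Ioc (x0 i) (x0 i + ℓ)), ENNReal.ofReal (Gq ℓ n f (WithLp.toLp 2 y)) ≤
      ENNReal.ofReal (∫ x in An l0 R, Gq ℓ n f x) := by
    refine (lintegral_mono_set hsub).trans (le_of_eq ?_)
    rw [ofReal_integral_eq_lintegral_ofReal (An_int l0 R (Gq_cont ℓ n f)) (Filter.Eventually.of_forall fun t => Gq_nonneg _ _ _ _)]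
    exact (PiLp.volume_preserving_toLp (Fin n)).setLIntegral_comp_preimage (An_meas l0 R) (ENNReal.measurable_ofReal.comp (Gq_cont ℓ n f).measurable)
  have hI : 0 ≤ ∫ x in An l0 R, Gq ℓ n f x := integral_nonneg fun x => Gq_nonneg _ _ _ _
  have h3 := h1.trans (mul_le_mul_right h2 _)
  rw [← ENNReal.ofReal_pow (by positivity), ← ENNReal.ofReal_mul (by positivity), ENNReal.ofReal_le_ofReal_iff (by positivity)] at h3
  have e : 2 / ℓ = 4 * n / R := by rw [hℓd]; field_simp; ring
  rw [e] at h3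
  exact h3
lemma Gq_PJ (k : ℕ) : ∀ (F : Dat d l0 H M → SA n) (m : ℕ), PJ F m k → ∃ C : ℝ, 0 ≤ C ∧ ∀ p R ℓ, 1 ≤ R → 0 ≤ ℓ → ℓ ≤ R →
    (R^2)^m * ∫ x in An l0 R, Gq ℓ k (F p) x ≤ C * (R^(n+2) * NN d p.c (R^2)) := by
  induction k with
  | zero =>
    intro F m hF
    obtain ⟨C, hC, h⟩ := hF [] le_rfl
    refine ⟨4^m * C, by positivity, fun p R ℓ hR _ _ => ?_⟩
    have h1 := h p R hR
    simp only [DL, List.length_nil, add_zero] at h1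
    have h2 : ∫ x in An l0 R, (R^2)^m * Gq ℓ 0 (F p) x ≤ ∫ x in An l0 R, 4^m * (eS x^m * ev x (F p)^2) := by
      refine setIntegral_mono_on ((An_int _ _ (Gq_cont _ _ _)).const_mul _) ((LL_int _ _ _).const_mul _) (An_meas _ _) fun x hx => ?_
      rw [← mul_assoc, ← mul_pow]
      simp only [Gq]
      have := hx.2.1
      have hh : R^2 ≤ 4 * eS x := by linarith
      gcongr
    rw [integral_const_mul, integral_const_mul] at h2
    have := mnL h1 (by positivity : (0:ℝ) ≤ 4^m)
    rw [mul_assoc]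
    linarith
  | succ k ih =>
    intro F m hF
    obtain ⟨C, hC, h⟩ := ih F m (hF.mono (by omega))
    choose C' hC' h' using fun i => ih (fun p => D i (F p)) (m+1) (hF.dd i)
    refine ⟨C + ∑ i, C' i, add_nonneg hC (sum_nonneg fun i _ => hC' i), fun p R ℓ hR h0 hle => ?_⟩
    have e : ∫ x in An l0 R, Gq ℓ (k+1) (F p) x = (∫ x in An l0 R, Gq ℓ k (F p) x) + ℓ^2 * ∑ i, ∫ x in An l0 R, Gq ℓ k (D i (F p)) x := by
      rw [← integral_finset_sum _ (fun i _ => An_int _ _ (Gq_cont _ _ _)), ← integral_const_mul, ← integral_add (An_int _ _ (Gq_cont _ _ _))]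
      · rfl
      · exact (An_int _ _ (continuous_finset_sum _ fun i _ => Gq_cont _ _ _)).const_mul _
    rw [e, mul_add, add_mul]
    refine add_le_add (h p R ℓ hR h0 hle) ?_
    rw [sum_mul]
    have hS : 0 ≤ ∑ i, ∫ x in An l0 R, Gq ℓ k (D i (F p)) x := sum_nonneg fun i _ => integral_nonneg fun x => Gq_nonneg _ _ _ _
    calc (R^2)^m * (ℓ^2 * ∑ i, ∫ x in An l0 R, Gq ℓ k (D i (F p)) x) ≤ (R^2)^m * (R^2 * ∑ i, ∫ x in An l0 R, Gq ℓ k (D i (F p)) x) := by gcongr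
      _ = ∑ i, (R^2)^(m+1) * ∫ x in An l0 R, Gq ℓ k (D i (F p)) x := by rw [← mul_assoc, ← pow_succ, mul_sum]
      _ ≤ _ := sum_le_sum fun i _ => h' i p R ℓ hR h0 hle
lemma pointwise (hn : 2 ≤ n) (hH : ∀ k, 0 ≤ H k) (hM : 0 ≤ M) (b : ℕ) : ∃ C : ℝ, 0 ≤ C ∧ ∀ (p : Dat d l0 H M) (L : List (Fin n)), L.length = b →
    ∀ i, ∀ x ∈ HS l0, eS x^b * ev x (DL L (p.V i))^2 ≤ C * (eS x * NN d p.c (eS x)) := by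
  have key : ∀ (L : List.Vector (Fin n) b) (i : Fin n), ∃ C : ℝ, 0 ≤ C ∧ ∀ (p : Dat d l0 H M) R ℓ, 1 ≤ R → 0 ≤ ℓ → ℓ ≤ R →
    (R^2)^b * ∫ x in An l0 R, Gq ℓ n (DL L.1 (p.V i)) x ≤ C * (R^(n+2) * NN d p.c (R^2)) := by
    intro L i
    refine Gq_PJ n (fun p => DL L.1 (p.V i)) b ?_
    intro L' hL'
    have := regularity hn hH hM (b+n) i (L' ++ L.1) (by simp [L.2]; omega) (d := d) (l0 := l0)
    have e : ∀ f : SA n, DL (L' ++ L.1) f = DL L' (DL L.1 f) := by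
      intro f
      clear this hL'
      induction L' with
      | nil => rfl
      | cons a t ih => simp only [List.cons_append, DL, ih]
    simp only [e] at this
    have e2 : 0 + (L' ++ L.1).length = b + L'.length := by simp [L.2]; omega
    rw [e2] at this
    exact this
  choose C hC h using key
  refine ⟨(4*n)^n * ∑ L, ∑ i, C L i, mul_nonneg (by positivity) (sum_nonneg fun L _ => sum_nonneg fun i _ => hC L i), fun p L hL i x hx => ?_⟩
  have hl := lam_pos x
  have hn1 : (2:ℝ) ≤ n := by exact_mod_cast hn
  have hN : 0 ≤ NN d p.c (lam x ^2) := NN_nonneg d _ (sq_nonneg _)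
  have h1 := sobolev x (by omega) hx (DL L (p.V i))
  have h2 := h ⟨L, hL⟩ i p (lam x) (lam x / (2*n)) (one_le_lam x) (by positivity) (by rw [div_le_iff₀ (by positivity)]; nlinarith)
  have h3 : C ⟨L, hL⟩ i ≤ ∑ L, ∑ i, C L i :=
    (single_le_sum (f := fun j => C ⟨L, hL⟩ j) (fun j _ => hC _ _) (mem_univ i)).trans
      (single_le_sum (f := fun L => ∑ j, C L j) (fun j _ => sum_nonneg fun k _ => hC _ _) (mem_univ _))
  rw [← lam_sq]
  calc (lam x^2)^b * ev x (DL L (p.V i))^2 ≤ (lam x^2)^b * ((4 * n / lam x)^n * ∫ y in An l0 (lam x), Gq (lam x / (2*n)) n (DL L (p.V i)) y) := by gcongr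
    _ = (4 * n / lam x)^n * ((lam x^2)^b * ∫ y in An l0 (lam x), Gq (lam x / (2*n)) n (DL L (p.V i)) y) := by ring
    _ ≤ (4 * n / lam x)^n * (C ⟨L, hL⟩ i * (lam x^(n+2) * NN d p.c (lam x^2))) := mnL h2 (by positivity)
    _ = (4*n)^n * C ⟨L, hL⟩ i * (lam x^2 * NN d p.c (lam x^2)) := by
      rw [div_pow, pow_add]; field_simp
    _ ≤ _ := by gcongr
end
section
open Finset
lemma dyadic_int (hn : 6 ≤ n) (l0 : Fin n) (F : SA n) (hF : ∀ x, 0 ≤ ev x F) (M : ℝ)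
    (hM : ∀ r : ℝ, 1 ≤ r → ∫ x in (ball (0 : Euc n) (2 * r) \ ball (0 : Euc n) r) ∩ HS l0, ev x F ≤ M * r^(n+6)) :
    IntegrableOn (fun x => eW x^(n+1) * ev x F) (HS l0) := by
  have hcF : Continuous fun x : Euc n => ev x F := ev_cont F
  have hc : Continuous fun x : Euc n => eW x^(n+1) * ev x F := ((ev_cont _).pow _).mul (ev_cont _)
  have hb : ∀ {f : Euc n → ℝ}, Continuous f → ∀ r : ℝ, IntegrableOn f (ball (0 : Euc n) r) := fun hf r =>
    (hf.continuousOn.integrableOn_compact (isCompact_closedBall (0 : Euc n) r)).mono_set ball_subset_closedBall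
  set A : ℕ → Set (Euc n) := fun k => (ball (0 : Euc n) (2 * 2^k) \ ball (0 : Euc n) (2^k)) ∩ HS l0 with hA
  have hAb : ∀ k, A k ⊆ ball (0 : Euc n) (2 * 2^k) := fun k x hx => hx.1.1
  have hAm : ∀ k, MeasurableSet (A k) := fun k => (measurableSet_ball.diff measurableSet_ball).inter (HS_meas l0)
  have h1 : IntegrableOn (fun x => eW x^(n+1) * ev x F) (⋃ k, A k) := by
    apply integrableOn_iUnion_of_summable_integral_norm
    · exact fun k => (hb hc _).mono_set (hAb k)
    · refine Summable.of_nonneg_of_le (fun k => integral_nonneg fun x => norm_nonneg _) (fun k => ?_)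
        ((summable_geometric_of_lt_one (by norm_num : (0:ℝ) ≤ 1/4) (by norm_num)).mul_left (max M 0))
      have hr : (1:ℝ) ≤ 2^k := one_le_pow₀ (by norm_num)
      have hq : ((1:ℝ)/4)^k = ((2^k)^2)⁻¹ := by
        rw [← pow_mul, mul_comm k 2, pow_mul, ← inv_pow]; norm_num
      rw [hq]
      have hM' := hM (2^k) hr
      set r : ℝ := 2^k with hrd
      have hr0 : 0 < r := by linarith
      have h2 : ∫ x in A k, ‖eW x^(n+1) * ev x F‖ ≤ ∫ x in A k, ((r^2)^(n+1))⁻¹ * ev x F := by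
        refine setIntegral_mono_on ((hb hc _).mono_set (hAb k)).norm (((hb hcF _).mono_set (hAb k)).const_mul _) (hAm k) fun x hx => ?_
        have hw := ev_w_pos x
        rw [Real.norm_of_nonneg (mul_nonneg (by positivity) (hF x)), ← inv_pow]
        refine mnR (pow_le_pow_left₀ hw.le ?_ _) (hF x)
        rw [ev_w]
        apply inv_anti₀ (by positivity)
        rw [ev_sq']
        have : r ≤ ‖x‖ := by
          have := hx.1.2
          rw [mem_ball_zero_iff, not_lt] at this
          exact this
        nlinarith
      rw [integral_const_mul] at h2
      refine h2.trans ((mnL hM' (by positivity)).trans ?_)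
      calc ((r^2)^(n+1))⁻¹ * (M * r^(n+6)) ≤ ((r^2)^(n+1))⁻¹ * (max M 0 * r^(2*n)) := by
            have hp : r^(n+6) ≤ r^(2*n) := pow_le_pow_right₀ hr (by omega)
            have : 0 ≤ max M 0 := le_max_right _ _
            have := le_max_left M 0
            gcongr
        _ = max M 0 * (r^2)⁻¹ := by
            rw [pow_succ, pow_mul]; field_simp
  have h2 : HS l0 ⊆ ball (0 : Euc n) 1 ∪ ⋃ k, A k := by
    intro x hx
    by_cases h : ‖x‖ < 1
    · exact Or.inl (by simpa using h)
    · right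
      push Not at h
      obtain ⟨k, hk1, hk2⟩ := exists_nat_pow_near h (by norm_num : (1:ℝ) < 2)
      refine Set.mem_iUnion.2 ⟨k, ⟨?_, ?_⟩, hx⟩
      · rw [mem_ball_zero_iff]; rw [pow_succ] at hk2; linarith
      · rw [mem_ball_zero_iff, not_lt]; exact hk1
  exact ((hb hc 1).union h1).mono_set h2
lemma psi_sm {χ : ℝ → ℝ} (hχ : ContDiff ℝ (⊤ : ℕ∞) χ) (h1 : ∀ t : ℝ, t ≤ 4/3 → χ t = 1) :
    ContDiff ℝ (⊤ : ℕ∞) (fun τ => χ (√τ)) := by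
  rw [contDiff_iff_contDiffAt]
  intro τ
  by_cases h : τ < 16/9
  · have : (fun τ => χ (√τ)) =ᶠ[nhds τ] fun _ => 1 := by
      filter_upwards [Iio_mem_nhds h] with t ht
      apply h1
      rw [Real.sqrt_le_left (by norm_num)]
      have : t < 16/9 := ht
      linarith
    exact contDiffAt_const.congr_of_eventuallyEq this
  · have : τ ≠ 0 := by push Not at h; linarith
    exact hχ.contDiffAt.comp τ (Real.contDiffAt_sqrt this)
lemma u0_pow (hn : 6 ≤ n) (x : Euc n) (m : ℕ) (a : ℝ) (ha : a = m) : u0 n x ^ (2 * a / ((n:ℝ) - 2)) = eW x ^ m := by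
  have hn' : (6:ℝ) ≤ n := by exact_mod_cast hn
  have h0 : (n:ℝ) - 2 ≠ 0 := by linarith
  have e : 1 / (1 + ‖x‖^2) = eW x := by rw [ev_w, ev_sq', one_div]
  unfold u0
  rw [e, ← Real.rpow_mul (ev_w_pos x).le, ← Real.rpow_natCast, ha]
  congr 1
  field_simp
lemma final {d : ℕ} (hn : 6 ≤ n) (l0 : Fin n) (hd : d = (n - 2) / 2)
    (χ : ℝ → ℝ) (hχsm : ContDiff ℝ (⊤ : ℕ∞) χ)
    (hχ1 : ∀ t : ℝ, t ≤ 4 / 3 → χ t = 1) (hχ0 : ∀ t : ℝ, 5 / 3 ≤ t → χ t = 0)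
    (K : ℝ) (hK : 0 < K) (b : ℕ) :
    ∃ C : ℝ, 0 < C ∧
      ∀ ρ : ℝ, 1 ≤ ρ →
      ∀ c : Fin n → Fin n → (Fin n → ℕ) → ℝ,
        (∀ i k α, c i k α = c k i α) →
        (∀ α, ∑ i, c i i α = 0) →
      ∀ h : Fin n → Fin n → Euc n → ℝ,
        (∀ i k x, h i k x = χ (‖x‖ / ρ) * ∑ α ∈ MIdx n d, c i k α * ∏ m, x m ^ α m) →
      ∀ V : Fin n → Euc n → ℝ, (∀ i, ContDiff ℝ (⊤ : ℕ∞) (V i)) →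
        (∀ x : Euc n, 0 ≤ x l0 → ∀ i,
          ∑ k, pd k (fun y => u0 n y ^ (2 * (n : ℝ) / ((n : ℝ) - 2))
            * (h i k y - pd i (V k) y - pd k (V i) y
                + (2 / (n : ℝ)) * (∑ m, pd m (V m) y) * kd i k)) x = 0) →
        (∀ x : Euc n, x l0 = 0 →
          V l0 x = 0 ∧ ∀ i, i ≠ l0 → pd l0 (V i) x = h i l0 x) →
        ((∫ x in {x : Euc n | 0 ≤ x l0},
            u0 n x ^ (2 * ((n : ℝ) + 2) / ((n : ℝ) - 2)) * ∑ i, (V i x) ^ 2)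
          ≤ K * ∫ x in {x : Euc n | 0 ≤ x l0},
              u0 n x ^ (2 * (n : ℝ) / ((n : ℝ) - 2)) * ∑ i, ∑ k, (h i k x) ^ 2) →
        MeasureTheory.IntegrableOn
          (fun x : Euc n => (1 + ‖x‖ ^ 2) ^ (-(n : ℝ)) * ∑ i, ∑ k, (pd k (V i) x) ^ 2)
          {x : Euc n | 0 ≤ x l0} →
        (∀ d' : ℕ, 2 ≤ d' → d' ≤ d →
          BddAbove {y : ℝ | ∃ r : ℝ, 1 ≤ r ∧
            y = r ^ (-2 * (d' : ℝ) - (n : ℝ) - 2)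
              * ∫ x in (Metric.ball (0 : Euc n) (2 * r) \ Metric.ball (0 : Euc n) r)
                  ∩ {x : Euc n | 0 ≤ x l0}, ∑ i, (V i x) ^ 2}) →
      ∀ L : List (Fin n), L.length = b →
      ∀ (i : Fin n) (x : Euc n), 0 ≤ x l0 →
        (pdIter L (V i) x) ^ 2
          ≤ C * ∑ α ∈ MIdx n d, ∑ i', ∑ k,
              (c i' k α) ^ 2 * (1 + ‖x‖ ^ 2) ^ ((∑ m, (α m : ℝ)) + 1 - (b : ℝ)) := by
  have hψ := psi_sm hχsm hχ1
  have hψ0 : ∀ τ : ℝ, 25/9 < τ → (fun τ => χ (√τ)) τ = 0 := fun τ hτ => by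
    apply hχ0
    apply Real.le_sqrt_of_sq_le
    linarith
  choose Hc hHc hHJ using fun k => h_J (n := n) d hψ (by norm_num : (0:ℝ) ≤ 25/9) hψ0 k
  obtain ⟨Mc, hMc, hen⟩ := main_energy (n := n) (d := d) hn (by omega) K (Hc 1) hK.le (hHc 1)
  obtain ⟨C, hC, hpt⟩ := pointwise (n := n) (d := d) (l0 := l0) (H := Hc) (M := Mc) (by omega) hHc hMc b
  refine ⟨C + 1, by positivity, ?_⟩
  intro ρ hρ c hcs hct h hh0 V hV heq hbd hc1 hc2 hd' L hL i x hx
  have hρ0 : 0 < ρ := by linarith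
  set h' : Fin n → Fin n → SA n := fun i k => cut (fun τ => χ (√τ)) hψ (1/ρ^2) (1/ρ^2) * ∑ α ∈ MIdx n d, c i k α • mono' α with hh'
  set V' : Fin n → SA n := fun i => ⟨V i, hV i⟩ with hV'
  have hVe : ∀ i x, V i x = ev x (V' i) := fun i x => rfl
  have hpde : ∀ k i x, pd k (V i) x = ev x (D k (V' i)) := fun k i x => rfl
  have hhe : ∀ i k x, h i k x = ev x (h' i k) := by
    intro i k x
    rw [hh0, hh', map_mul, ev_cut, map_sum]
    congr 1
    · have : 1/ρ^2 * eS x - 1/ρ^2 = (‖x‖/ρ)^2 := by rw [ev_sq']; field_simp; ring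
      rw [this]
      rw [Real.sqrt_sq (by positivity)]
    · exact sum_congr rfl fun α _ => by rw [ev_smul, ev_mono]
  have hsys : Sys l0 h' V' := by
    refine ⟨fun i k => ?_, fun x => ?_, fun x hx i => ?_, fun x hx => (hbd x hx).1, fun x hx i hi => ?_⟩
    · simp only [hh', hcs i k]
    · simp only [← hhe, hh0]
      rw [← mul_sum, sum_comm]
      simp only [← sum_mul, hct]
      simp
    · have h1 := heq x hx i
      rw [← h1]
      refine sum_congr rfl fun k _ => ?_
      rw [ev_D]
      unfold pd
      congr 2
      funext y
      rw [← ev_def]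
      rw [u0_pow hn y n n rfl]
      have p1 : fderiv ℝ (V k) y (EuclideanSpace.single i 1) = ev y (D i (V' k)) := rfl
      have p2 : fderiv ℝ (V i) y (EuclideanSpace.single k 1) = ev y (D k (V' i)) := rfl
      have p3 : ∑ m, fderiv ℝ (V m) y (EuclideanSpace.single m 1) = ev y (T0 V') := by rw [ev_T0]; rfl
      rw [p1, p2, p3, hhe, map_mul, map_pow, map_sub, Sf, map_sub, map_add, kd]
      by_cases hik : i = k
      · simp only [hik, if_true, ev_smul]; ring
      · simp only [hik, if_false, map_zero]; ring
    · rw [← hpde, ← hhe]; exact (hbd x hx).2 i hi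
  have hVsq : ∀ x, ∑ i, V i x ^ 2 = ev x (V2 V') := fun x => by
    rw [ev_V2]; exact sum_congr rfl fun i _ => by rw [hVe]; ring
  have hJ : ∀ k x i j, J k (h' i j) x ^ 2 ≤ Hc k * NN d c (eS x) := fun k x i j =>
    hHJ k (1/ρ^2) (1/ρ^2) (by positivity) (by positivity) (by rw [div_le_one (by positivity)]; exact one_le_pow₀ hρ) c i j x
  have he := hen l0 c h' V' hsys (fun x i k => hJ 1 x i k) (by
      have e1 : ∀ x : Euc n, u0 n x ^ (2 * ((n : ℝ) + 2) / ((n : ℝ) - 2)) * ∑ i, (V i x) ^ 2 = eW x ^ (n+2) * ev x (V2 V') := fun x => by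
        rw [u0_pow hn x (n+2) _ (by push_cast; ring), hVsq]
      have e2 : ∀ x : Euc n, u0 n x ^ (2 * (n : ℝ) / ((n : ℝ) - 2)) * ∑ i, ∑ k, (h i k x) ^ 2 = eW x ^ n * hh x h' := fun x => by
        rw [u0_pow hn x n _ rfl, hh]
        congr 1
        exact sum_congr rfl fun i _ => sum_congr rfl fun k _ => by rw [hhe]
      simp only [e1, e2] at hc1
      exact hc1) (by
      refine IntegrableOn.congr_fun hc2 (fun x _ => ?_) (HS_meas l0)
      have e1 : (1 + ‖x‖^2) ^ (-(n:ℝ)) = eW x^n := by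
        rw [Real.rpow_neg (by positivity), Real.rpow_natCast, ev_w, ev_sq', inv_pow]
      rw [e1, a2, sum_comm]
      congr 1
      exact sum_congr rfl fun i _ => sum_congr rfl fun k _ => by rw [hpde]; ring) (by
      obtain ⟨B, hB⟩ := hd' 2 le_rfl (by omega)
      refine dyadic_int hn l0 (V2 V') (fun x => by rw [← hVsq]; positivity) B fun r hr => ?_
      have h1 := hB ⟨r, hr, rfl⟩
      have hr0 : 0 < r := by linarith
      simp only [hVsq] at h1
      have e : r ^ (-2 * ((2:ℕ) : ℝ) - (n : ℝ) - 2) = (r^(n+6))⁻¹ := by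
        rw [← Real.rpow_natCast, ← Real.rpow_neg hr0.le]
        congr 1
        push_cast; ring
      rw [e, inv_mul_le_iff₀ (by positivity)] at h1
      exact h1.trans_eq (mul_comm _ _))
  have hfin := hpt ⟨c, h', V', hsys, hJ, he⟩ L hL i x hx
  simp only [] at hfin
  have e1 : pdIter L (V i) x = ev x (DL L (V' i)) := by
    change _ = ((DL L (V' i) : SA n) : Euc n → ℝ) x
    rw [DL_coe]
  have hs := ev_sq_pos x
  have hs0 : 0 < eS x := by linarith
  have e2 : ∑ α ∈ MIdx n d, ∑ i', ∑ k, (c i' k α) ^ 2 * (1 + ‖x‖ ^ 2) ^ ((∑ m, (α m : ℝ)) + 1 - (b : ℝ)) = (eS x * NN d c (eS x)) * (eS x^b)⁻¹ := by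
    rw [← ev_sq', NN]
    simp only [mul_sum, sum_mul]
    refine sum_congr rfl fun α _ => sum_congr rfl fun i' _ => sum_congr rfl fun k _ => ?_
    rw [Real.rpow_sub hs0, Real.rpow_add hs0, Real.rpow_one, Real.rpow_natCast, ← Nat.cast_sum, Real.rpow_natCast]
    ring
  have hN : 0 ≤ NN d c (eS x) := NN_nonneg d _ hs0.le
  rw [e1, e2, ← mul_assoc, ← div_eq_mul_inv, le_div_iff₀ (by positivity)]
  have : 0 ≤ eS x * NN d c (eS x) := by positivity
  nlinarith
end

end

/-- pointwise derivative bounds for `V` (Corollary `polynomial`): for every order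
`b = |β|` there is a constant `C` depending only on `n`, `b`, `χ` and `K` (but not on `ρ`) such
that `|∂^β V(x)|² ≤ C Σ |h_{ik,α}|² (1+|x|²)^{|α|+1-|β|}`. -/
theorem statement15 (n : ℕ) (hn : 6 ≤ n) (l₀ : Fin n) (hl₀ : (l₀ : ℕ) = n - 1)
    (d : ℕ) (hd : d = (n - 2) / 2)
    (χ : ℝ → ℝ) (hχsm : ContDiff ℝ (⊤ : ℕ∞) χ)
    (hχ1 : ∀ t : ℝ, t ≤ 4 / 3 → χ t = 1) (hχ0 : ∀ t : ℝ, 5 / 3 ≤ t → χ t = 0)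
    (K : ℝ) (hK : 0 < K) (b : ℕ) :
    ∃ C : ℝ, 0 < C ∧
      ∀ ρ : ℝ, 1 ≤ ρ →
      ∀ c : Fin n → Fin n → (Fin n → ℕ) → ℝ,
        (∀ i k α, c i k α = c k i α) →
        (∀ α, ∑ i, c i i α = 0) →
      ∀ h : Fin n → Fin n → Euc n → ℝ,
        (∀ i k x, h i k x = χ (‖x‖ / ρ) * ∑ α ∈ MIdx n d, c i k α * ∏ m, x m ^ α m) →
      ∀ V : Fin n → Euc n → ℝ, (∀ i, ContDiff ℝ (⊤ : ℕ∞) (V i)) →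
        (∀ x : Euc n, 0 ≤ x l₀ → ∀ i,
          ∑ k, pd k (fun y => u0 n y ^ (2 * (n : ℝ) / ((n : ℝ) - 2))
            * (h i k y - pd i (V k) y - pd k (V i) y
                + (2 / (n : ℝ)) * (∑ m, pd m (V m) y) * kd i k)) x = 0) →
        (∀ x : Euc n, x l₀ = 0 →
          V l₀ x = 0 ∧ ∀ i, i ≠ l₀ → pd l₀ (V i) x = h i l₀ x) →
        ((∫ x in {x : Euc n | 0 ≤ x l₀},
            u0 n x ^ (2 * ((n : ℝ) + 2) / ((n : ℝ) - 2)) * ∑ i, (V i x) ^ 2)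
          ≤ K * ∫ x in {x : Euc n | 0 ≤ x l₀},
              u0 n x ^ (2 * (n : ℝ) / ((n : ℝ) - 2)) * ∑ i, ∑ k, (h i k x) ^ 2) →
        MeasureTheory.IntegrableOn
          (fun x : Euc n => (1 + ‖x‖ ^ 2) ^ (-(n : ℝ)) * ∑ i, ∑ k, (pd k (V i) x) ^ 2)
          {x : Euc n | 0 ≤ x l₀} →
        (∀ d' : ℕ, 2 ≤ d' → d' ≤ d →
          BddAbove {y : ℝ | ∃ r : ℝ, 1 ≤ r ∧
            y = r ^ (-2 * (d' : ℝ) - (n : ℝ) - 2)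
              * ∫ x in (Metric.ball (0 : Euc n) (2 * r) \ Metric.ball (0 : Euc n) r)
                  ∩ {x : Euc n | 0 ≤ x l₀}, ∑ i, (V i x) ^ 2}) →
      ∀ L : List (Fin n), L.length = b →
      ∀ (i : Fin n) (x : Euc n), 0 ≤ x l₀ →
        (pdIter L (V i) x) ^ 2
          ≤ C * ∑ α ∈ MIdx n d, ∑ i', ∑ k,
              (c i' k α) ^ 2 * (1 + ‖x‖ ^ 2) ^ ((∑ m, (α m : ℝ)) + 1 - (b : ℝ)) := by
  exact final hn l₀ hd χ hχsm hχ1 hχ0 K hK b
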